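/- arXiv:2401.17532 — 2 statements merged into one kernel-verified Lean document; each statement's English description precedes it below -/
import Mathlib

section
/- Let d ≥ 2, let σ be the surface measure on the unit sphere S^{d−1} ⊂ ℝ^d, and let Af(x) = ∫_{S^{d−1}} f(x−ω) dσ(ω). Let 𝒯 be the closed triangle in [0,1]² with vertices (0,0), (1,1) and (d/(d+1), 1/(d+1)). Let r₁, r₂, p₃, p₁, p₂ ∈ [1,∞] satisfy 1/r₁ + 1/r₂ + 1/p₃ = 1, (1/p₁, 1/r₁) ∈ 𝒯 and (1/p₂, 1/r₂) ∈ 𝒯. Then there exists a constant C > 0 such that ∫_{ℝ^d} Af(x) Ag(x) h(x) dx ≤ C ‖f‖_{L^{p₁}(ℝ^d)} ‖g‖_{L^{p₂}(ℝ^d)} ‖h‖_{L^{p₃}(ℝ^d)} for all nonnegative measurable f,g,h : ℝ^d → [0,∞). -/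
open MeasureTheory ENNReal NNReal

noncomputable section

/-- The surface measure on the unit sphere `S^{d-1} ⊂ ℝ^d`: the `(d−1)`-dimensional
Hausdorff measure restricted to the unit sphere. -/
def sphereMeasure (d : ℕ) : Measure (EuclideanSpace ℝ (Fin d)) :=
  (MeasureTheory.Measure.hausdorffMeasure ((d : ℝ) - 1)).restrict
    (Metric.sphere (0 : EuclideanSpace ℝ (Fin d)) 1)

/-- The spherical averaging operator `Af(x) = ∫_{S^{d-1}} f(x−ω) dσ(ω)`. -/
def sphereAvg (d : ℕ) (f : EuclideanSpace ℝ (Fin d) → ℝ≥0)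
    (x : EuclideanSpace ℝ (Fin d)) : ℝ≥0∞ :=
  ∫⁻ ω, (f (x - ω) : ℝ≥0∞) ∂(sphereMeasure d)

/-- The `L^p` norm (`p ∈ [1,∞]`) of a nonnegative function on `ℝ^d`. -/
def nnLpNorm' {d : ℕ} (p : ℝ≥0∞) (f : EuclideanSpace ℝ (Fin d) → ℝ≥0) : ℝ≥0∞ :=
  eLpNorm (fun x => (f x : ℝ)) p volume

section
open Real Set
open scoped InnerProductSpace

theorem ode_energy_bound (n : ℕ) (f g : ℝ → ℝ)
    (hf : ∀ r, 0 < r → HasDerivAt f (g r) r)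
    (hg : ∀ r, 0 < r → HasDerivAt g (-f r - (n / r) * g r) r)
    {r₀ r : ℝ} (h₀ : 1 ≤ r₀) (hn : (n : ℝ) ≤ r₀) (hr : r₀ ≤ r) :
    r ^ n * (f r ^ 2 + g r ^ 2) ≤
      4 * Real.exp 1 * (r₀ ^ n * (f r₀ ^ 2 + g r₀ ^ 2)) := by
  set Q : ℝ → ℝ := fun r => r ^ n * (f r ^ 2 + g r ^ 2 + (n / r) * (f r * g r)) with hQ
  have hfg : ∀ r : ℝ, r₀ ≤ r → |(n / r) * (f r * g r)| ≤ (f r ^ 2 + g r ^ 2) / 2 := by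
    intro r hr
    have hr0 : 0 < r := by linarith
    have h1 : (n : ℝ) / r ≤ 1 := by
      rw [div_le_one hr0]; linarith
    have h2 : 0 ≤ (n : ℝ) / r := by positivity
    rw [abs_mul, abs_of_nonneg h2]
    have h3 : |f r * g r| ≤ (f r ^ 2 + g r ^ 2) / 2 := by
      rw [abs_le]
      constructor <;> nlinarith [sq_nonneg (f r - g r), sq_nonneg (f r + g r)]
    nlinarith [abs_nonneg (f r * g r)]
  have hlow : ∀ r : ℝ, r₀ ≤ r → r ^ n * (f r ^ 2 + g r ^ 2) ≤ 2 * Q r := by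
    intro r hr
    have hr0 : 0 < r := by linarith
    have := (abs_le.1 (hfg r hr)).1
    have h4 : 0 < r ^ n := by positivity
    simp only [hQ]
    nlinarith
  have hup : Q r₀ ≤ 2 * (r₀ ^ n * (f r₀ ^ 2 + g r₀ ^ 2)) := by
    have := (abs_le.1 (hfg r₀ le_rfl)).2
    have h4 : 0 < r₀ ^ n := by positivity
    simp only [hQ]
    nlinarith [sq_nonneg (f r₀), sq_nonneg (g r₀)]
  have hder : ∀ r : ℝ, 0 < r → HasDerivAt (fun r => Q r * Real.exp (n / r))
      (Real.exp (n / r) * (-(n / r ^ 2) * (r ^ n * (f r * g r)) - n / r ^ 2 * Q r)) r := by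
    intro r hr
    have hp : HasDerivAt (fun r : ℝ => r ^ n) (n * r ^ n / r) r := by
      refine (hasDerivAt_pow n r).congr_deriv ?_
      rcases n with _ | m
      · simp
      · simp only [Nat.add_sub_cancel]; field_simp; rw [pow_succ]
    have hi : HasDerivAt (fun r : ℝ => (n : ℝ) / r) (-(n / r ^ 2)) r := by
      refine ((hasDerivAt_inv hr.ne').const_mul (n : ℝ)).congr_deriv ?_
      ring
    have hF := hf r hr
    have hG := hg r hr
    refine ((hp.mul (((hF.pow 2).add (hG.pow 2)).add (hi.mul (hF.mul hG)))).mul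
      hi.exp).congr_deriv ?_
    simp only [hQ, Pi.mul_apply, Pi.add_apply, Pi.pow_apply]
    field_simp
    ring
  have hanti : AntitoneOn (fun r => Q r * Real.exp (n / r)) (Ici r₀) := by
    apply antitoneOn_of_deriv_nonpos (convex_Ici r₀)
    · intro x hx
      exact (hder x (by linarith [mem_Ici.1 hx])).continuousAt.continuousWithinAt
    · intro x hx
      rw [interior_Ici] at hx
      exact (hder x (by linarith [mem_Ioi.1 hx])).differentiableAt.differentiableWithinAt
    · intro x hx
      rw [interior_Ici] at hx
      have hx' : r₀ ≤ x := (mem_Ioi.1 hx).le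
      have hx0 : 0 < x := by linarith
      rw [(hder x hx0).deriv]
      have h1 := hlow x hx'
      have h4 : 0 < x ^ n := by positivity
      have h5 : 0 ≤ x ^ n * (f x * g x) + Q x := by
        nlinarith [mul_nonneg h4.le (sq_nonneg (f x + g x))]
      have h6 : -(n / x ^ 2) * (x ^ n * (f x * g x)) - n / x ^ 2 * Q x
        = - ((n / x ^ 2) * (x ^ n * (f x * g x) + Q x)) := by ring
      rw [h6]
      have : 0 ≤ (n / x ^ 2) * (x ^ n * (f x * g x) + Q x) := by positivity
      have := mul_nonneg (Real.exp_pos (n / x)).le this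
      linarith
  have hW := hanti (mem_Ici.2 le_rfl) (mem_Ici.2 hr) hr
  simp only at hW
  have hr0 : 0 < r := by linarith
  have hQr : 0 ≤ Q r := by
    have := hlow r hr
    have : 0 ≤ r ^ n * (f r ^ 2 + g r ^ 2) := by positivity
    linarith
  have hQr₀ : 0 ≤ Q r₀ := by
    have := hlow r₀ le_rfl
    have : 0 ≤ r₀ ^ n * (f r₀ ^ 2 + g r₀ ^ 2) := by positivity
    linarith
  have e1 : 1 ≤ Real.exp (n / r) := Real.one_le_exp (by positivity)
  have e2 : Real.exp (n / r₀) ≤ Real.exp 1 := by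
    apply Real.exp_le_exp.2
    rw [div_le_one (by linarith)]; exact hn
  have := hlow r hr
  have h7 : Q r ≤ Q r₀ * Real.exp 1 := by
    calc Q r ≤ Q r * Real.exp (n / r) := le_mul_of_one_le_right hQr e1
      _ ≤ _ := hW
      _ ≤ _ := by gcongr
  nlinarith [Real.exp_pos 1]

theorem reflection_unit_apply {E : Type*} [NormedAddCommGroup E] [InnerProductSpace ℝ E] (u x : E) (hu : ‖u‖ = 1) :
    (ℝ ∙ u).reflection x = (2 * ⟪u, x⟫_ℝ) • u - x := by
  rw [Submodule.reflection_apply, Submodule.starProjection_unit_singleton ℝ hu, two_smul, ← add_smul, two_mul]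

theorem integral_reflection_pair {E : Type*} [NormedAddCommGroup E] [InnerProductSpace ℝ E]
    [MeasurableSpace E] [BorelSpace E] (σ : Measure E)
    (hσ : ∀ R : E ≃ₗᵢ[ℝ] E, σ.map R = σ) {e v : E} (he : ‖e‖ = 1) (hv : ‖v‖ = 1)
    (hev : ⟪e, v⟫_ℝ = 0) (F : ℝ → ℝ → ℂ) (φ : ℝ) :
    ∫ ω, F ⟪ω, e⟫_ℝ ⟪ω, v⟫_ℝ ∂σ =
      ∫ ω, F (cos φ * ⟪ω, e⟫_ℝ + sin φ * ⟪ω, v⟫_ℝ)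
        (sin φ * ⟪ω, e⟫_ℝ - cos φ * ⟪ω, v⟫_ℝ) ∂σ := by
  set u : E := cos (φ / 2) • e + sin (φ / 2) • v with hu
  have hu1 : ‖u‖ = 1 := by
    have : ‖u‖ ^ 2 = 1 := by
      rw [← real_inner_self_eq_norm_sq]
      simp only [hu, inner_add_left, inner_add_right, inner_smul_left, inner_smul_right, hev,
        real_inner_comm e v, real_inner_self_eq_norm_sq, he, hv]
      simp
      nlinarith [sin_sq_add_cos_sq (φ / 2)]
    nlinarith [norm_nonneg u]
  have hc : cos φ = 2 * cos (φ / 2) ^ 2 - 1 := by rw [← cos_two_mul]; ring_nf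
  have hs : sin φ = 2 * sin (φ / 2) * cos (φ / 2) := by rw [← sin_two_mul]; ring_nf
  have hsc := sin_sq_add_cos_sq (φ / 2)
  have hue : ⟪e, u⟫_ℝ = cos (φ / 2) := by
    simp [hu, inner_add_right, inner_smul_right, hev, he]
  have huv : ⟪v, u⟫_ℝ = sin (φ / 2) := by
    simp [hu, inner_add_right, inner_smul_right, real_inner_comm e v, hev, hv]
  have key : ∀ ω : E, ⟪(ℝ ∙ u).reflection ω, e⟫_ℝ = cos φ * ⟪ω, e⟫_ℝ + sin φ * ⟪ω, v⟫_ℝ ∧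
      ⟪(ℝ ∙ u).reflection ω, v⟫_ℝ = sin φ * ⟪ω, e⟫_ℝ - cos φ * ⟪ω, v⟫_ℝ := by
    intro ω
    rw [reflection_unit_apply u ω hu1]
    have : ⟪u, ω⟫_ℝ = cos (φ / 2) * ⟪ω, e⟫_ℝ + sin (φ / 2) * ⟪ω, v⟫_ℝ := by
      rw [hu, inner_add_left, inner_smul_left, inner_smul_left, real_inner_comm ω e,
        real_inner_comm ω v]; rfl
    simp only [inner_sub_left, inner_smul_left, real_inner_comm e u, real_inner_comm v u] at *
    rw [hue, huv, this, hc, hs]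
    simp
    constructor
    · ring
    · linear_combination (2 * ⟪ω, v⟫_ℝ) * hsc
  conv_lhs => rw [← hσ (ℝ ∙ u).reflection]
  refine ((ℝ ∙ u).reflection.toHomeomorph.measurableEmbedding.integral_map _).trans ?_
  refine integral_congr_ae (.of_forall fun ω => ?_)
  have := key ω
  simp only [LinearIsometryEquiv.coe_toHomeomorph]
  rw [this.1, this.2]

end

section
open Real Set
open scoped InnerProductSpace

theorem abs_inner_le_one_of_unit {E : Type*} [NormedAddCommGroup E] [InnerProductSpace ℝ E]
    {ω e : E} (hω : ‖ω‖ = 1) (he : ‖e‖ = 1) : |⟪ω, e⟫_ℝ| ≤ 1 := by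
  have := abs_real_inner_le_norm ω e
  rwa [hω, he, one_mul] at this

variable {E : Type*} [NormedAddCommGroup E] [InnerProductSpace ℝ E]
  [MeasurableSpace E] [BorelSpace E]

theorem integrable_inner_comp [FiniteDimensional ℝ E] (σ : Measure E) [IsFiniteMeasure σ]
    (hσ1 : ∀ᵐ ω ∂σ, ‖ω‖ = 1)
    {F : E → ℂ} (hF : Continuous F) : Integrable F σ := by
  obtain ⟨C, hC⟩ := (isCompact_sphere (0 : E) 1).exists_bound_of_continuousOn hF.continuousOn
  refine Integrable.of_bound hF.aestronglyMeasurable C ?_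
  filter_upwards [hσ1] with ω hω
  exact hC ω (by simpa using hω)

theorem integral_inner_sq_mul_deriv [FiniteDimensional ℝ E] (σ : Measure E) [IsFiniteMeasure σ]
    (hσ1 : ∀ᵐ ω ∂σ, ‖ω‖ = 1)
    (hσ : ∀ R : E ≃ₗᵢ[ℝ] E, σ.map R = σ) {e v : E} (he : ‖e‖ = 1) (hv : ‖v‖ = 1)
    (hev : ⟪e, v⟫_ℝ = 0) {H H' : ℝ → ℂ} (hH : ∀ t, HasDerivAt H (H' t) t) (hH' : Continuous H') :
    ∫ ω, (⟪ω, v⟫_ℝ : ℂ) ^ 2 * H' ⟪ω, e⟫_ℝ ∂σ = ∫ ω, (⟪ω, e⟫_ℝ : ℂ) * H ⟪ω, e⟫_ℝ ∂σ := by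
  have hHc : Continuous H := continuous_iff_continuousAt.2 fun t => (hH t).continuousAt
  obtain ⟨C, hC⟩ := (isCompact_Icc (a := (-2 : ℝ)) (b := 2)).exists_bound_of_continuousOn
    hHc.continuousOn
  obtain ⟨C', hC'⟩ := (isCompact_Icc (a := (-2 : ℝ)) (b := 2)).exists_bound_of_continuousOn
    hH'.continuousOn
  set G : ℝ → E → ℂ := fun φ ω => ((sin φ * ⟪ω, e⟫_ℝ - cos φ * ⟪ω, v⟫_ℝ : ℝ) : ℂ) *
    H (cos φ * ⟪ω, e⟫_ℝ + sin φ * ⟪ω, v⟫_ℝ) with hG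
  set G' : ℝ → E → ℂ := fun φ ω => ((cos φ * ⟪ω, e⟫_ℝ + sin φ * ⟪ω, v⟫_ℝ : ℝ) : ℂ) *
    H (cos φ * ⟪ω, e⟫_ℝ + sin φ * ⟪ω, v⟫_ℝ) +
    ((sin φ * ⟪ω, e⟫_ℝ - cos φ * ⟪ω, v⟫_ℝ : ℝ) : ℂ) *
    (((-sin φ * ⟪ω, e⟫_ℝ + cos φ * ⟪ω, v⟫_ℝ : ℝ) : ℂ) *
      H' (cos φ * ⟪ω, e⟫_ℝ + sin φ * ⟪ω, v⟫_ℝ)) with hG'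
  have hconst : ∀ φ, ∫ ω, G φ ω ∂σ = ∫ ω, (⟪ω, v⟫_ℝ : ℂ) * H ⟪ω, e⟫_ℝ ∂σ := fun φ =>
    (integral_reflection_pair σ hσ he hv hev (fun t s => (s : ℂ) * H t) φ).symm
  have hder := hasDerivAt_integral_of_dominated_loc_of_deriv_le (μ := σ) (F := G) (F' := G')
    (x₀ := 0) (s := univ) (bound := fun _ => 2 * C + 2 * (2 * C')) Filter.univ_mem
    (.of_forall fun φ => by
      refine Continuous.aestronglyMeasurable ?_
      simp only [hG]; fun_prop)
    (integrable_inner_comp σ hσ1 (by simp only [hG]; fun_prop))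
    (by
      refine Continuous.aestronglyMeasurable ?_
      simp only [hG']; fun_prop)
    (by
      filter_upwards [hσ1] with ω hω φ _
      have h1 := abs_le.1 (abs_inner_le_one_of_unit hω he)
      have h2 := abs_le.1 (abs_inner_le_one_of_unit hω hv)
      have b1 : ∀ a b : ℝ, |a| ≤ 1 → |b| ≤ 1 → |a * ⟪ω, e⟫_ℝ + b * ⟪ω, v⟫_ℝ| ≤ 2 := by
        intro a b ha hb
        calc _ ≤ |a * ⟪ω, e⟫_ℝ| + |b * ⟪ω, v⟫_ℝ| := abs_add_le _ _
          _ ≤ 1 * 1 + 1 * 1 := by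
            rw [abs_mul, abs_mul]
            gcongr
            · exact abs_inner_le_one_of_unit hω he
            · exact abs_inner_le_one_of_unit hω hv
          _ = 2 := by norm_num
      have c1 := b1 (cos φ) (sin φ) (abs_cos_le_one φ) (abs_sin_le_one φ)
      have c2 : |sin φ * ⟪ω, e⟫_ℝ - cos φ * ⟪ω, v⟫_ℝ| ≤ 2 := by
        have := b1 (sin φ) (-cos φ) (abs_sin_le_one φ) (by rw [abs_neg]; exact abs_cos_le_one φ)
        rwa [neg_mul, ← sub_eq_add_neg] at this
      have c3 := b1 (-sin φ) (cos φ) (by rw [abs_neg]; exact abs_sin_le_one φ) (abs_cos_le_one φ)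
      have d1 := hC _ (abs_le.1 c1)
      have d2 := hC' _ (abs_le.1 c1)
      have hCn := (norm_nonneg _).trans d1
      have hCn' := (norm_nonneg _).trans d2
      simp only [hG']
      refine (norm_add_le _ _).trans ?_
      rw [norm_mul, norm_mul, norm_mul, Complex.norm_real, Complex.norm_real, Complex.norm_real]
      simp only [norm_eq_abs]
      gcongr)
    (integrable_const _)
    (by
      refine .of_forall fun ω φ _ => ?_
      have s := hasDerivAt_sin φ
      have c := hasDerivAt_cos φ
      have k1 : HasDerivAt (fun φ => cos φ * ⟪ω, e⟫_ℝ + sin φ * ⟪ω, v⟫_ℝ)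
        (-sin φ * ⟪ω, e⟫_ℝ + cos φ * ⟪ω, v⟫_ℝ) φ := (c.mul_const _).add (s.mul_const _)
      have k2 : HasDerivAt (fun φ => sin φ * ⟪ω, e⟫_ℝ - cos φ * ⟪ω, v⟫_ℝ)
        (cos φ * ⟪ω, e⟫_ℝ + sin φ * ⟪ω, v⟫_ℝ) φ :=
        ((s.mul_const _).sub (c.mul_const _)).congr_deriv (by ring)
      have k3 := (hH (cos φ * ⟪ω, e⟫_ℝ + sin φ * ⟪ω, v⟫_ℝ)).scomp φ k1
      have := k2.ofReal_comp.mul k3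
      refine this.congr_deriv ?_
      simp [hG', Complex.real_smul])
  have h0 : HasDerivAt (fun φ => ∫ ω, G φ ω ∂σ) 0 0 := by
    simp only [hconst]
    exact hasDerivAt_const _ _
  have := hder.2.unique h0
  have e1 : ∀ ω, G' 0 ω = (⟪ω, e⟫_ℝ : ℂ) * H ⟪ω, e⟫_ℝ - (⟪ω, v⟫_ℝ : ℂ) ^ 2 * H' ⟪ω, e⟫_ℝ := by
    intro ω
    simp [hG']; ring
  simp only [e1] at this
  rw [integral_sub (integrable_inner_comp σ hσ1 (by fun_prop))
    (integrable_inner_comp σ hσ1 (by fun_prop))] at this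
  exact (sub_eq_zero.1 this).symm

theorem integral_one_sub_inner_sq_mul_deriv [FiniteDimensional ℝ E] (σ : Measure E)
    [IsFiniteMeasure σ] (hσ1 : ∀ᵐ ω ∂σ, ‖ω‖ = 1)
    (hσ : ∀ R : E ≃ₗᵢ[ℝ] E, σ.map R = σ) {e : E} (he : ‖e‖ = 1) {n : ℕ}
    (hn : Module.finrank ℝ E = n + 1)
    {H H' : ℝ → ℂ} (hH : ∀ t, HasDerivAt H (H' t) t) (hH' : Continuous H') :
    ∫ ω, (1 - (⟪ω, e⟫_ℝ : ℂ) ^ 2) * H' ⟪ω, e⟫_ℝ ∂σ =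
      n * ∫ ω, (⟪ω, e⟫_ℝ : ℂ) * H ⟪ω, e⟫_ℝ ∂σ := by
  have hHc : Continuous H := continuous_iff_continuousAt.2 fun t => (hH t).continuousAt
  have hdim : Module.finrank ℝ (ℝ ∙ e)ᗮ = n := by
    have : Fact (Module.finrank ℝ E = n + 1) := ⟨hn⟩
    exact Submodule.finrank_orthogonal_span_singleton (by rintro rfl; simp at he)
  let b := (stdOrthonormalBasis ℝ (ℝ ∙ e)ᗮ)
  have hbe : ∀ i, ⟪e, (b i : E)⟫_ℝ = 0 := fun i =>
    Submodule.mem_orthogonal_singleton_iff_inner_right.1 (b i).2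
  have hsum : ∀ ω : E, ‖ω‖ = 1 → ∑ i, (⟪ω, (b i : E)⟫_ℝ) ^ 2 = 1 - ⟪ω, e⟫_ℝ ^ 2 := by
    intro ω hω
    have h1 := b.sum_sq_norm_inner_right ((ℝ ∙ e)ᗮ.orthogonalProjectionOnto ω)
    have h2 : ∀ i, ⟪b i, (ℝ ∙ e)ᗮ.orthogonalProjectionOnto ω⟫_ℝ = ⟪ω, (b i : E)⟫_ℝ := by
      intro i
      rw [real_inner_comm, Submodule.inner_orthogonalProjectionOnto_eq_of_mem_right]
    simp only [h2, norm_eq_abs, sq_abs] at h1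
    rw [h1]
    have h3 := Submodule.norm_sq_eq_add_norm_sq_projection ω (ℝ ∙ e)
    rw [hω] at h3
    have h4 : ‖(ℝ ∙ e).orthogonalProjectionOnto ω‖ = |⟪ω, e⟫_ℝ| := by
      change ‖(((ℝ ∙ e).orthogonalProjectionOnto ω : (ℝ ∙ e)) : E)‖ = _
      rw [← Submodule.starProjection_apply,
        Submodule.starProjection_unit_singleton ℝ he, norm_smul, he, mul_one, norm_eq_abs,
        real_inner_comm]
    rw [h4, sq_abs] at h3
    linarith
  have hcard : Fintype.card (Fin (Module.finrank ℝ (ℝ ∙ e)ᗮ)) = n := by simp [hdim]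
  calc _ = ∫ ω, ∑ i, (⟪ω, (b i : E)⟫_ℝ : ℂ) ^ 2 * H' ⟪ω, e⟫_ℝ ∂σ := by
        refine integral_congr_ae ?_
        filter_upwards [hσ1] with ω hω
        rw [← Finset.sum_mul]
        congr 1
        have := hsum ω hω
        exact_mod_cast this.symm
    _ = ∑ i, ∫ ω, (⟪ω, (b i : E)⟫_ℝ : ℂ) ^ 2 * H' ⟪ω, e⟫_ℝ ∂σ :=
        integral_finsetSum _ fun i _ => integrable_inner_comp σ hσ1 (by fun_prop)
    _ = ∑ i : Fin (Module.finrank ℝ (ℝ ∙ e)ᗮ), ∫ ω, (⟪ω, e⟫_ℝ : ℂ) * H ⟪ω, e⟫_ℝ ∂σ := by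
        refine Finset.sum_congr rfl fun i _ => ?_
        exact integral_inner_sq_mul_deriv σ hσ1 hσ he
          (b.orthonormal.1 i) (hbe i) hH hH'
    _ = _ := by simp [hdim]

end

section
open Real Set
open scoped InnerProductSpace

variable {E : Type*} [NormedAddCommGroup E] [InnerProductSpace ℝ E]
  [MeasurableSpace E]

/-- The `k`-th moment `∫ ⟪ω, e⟫ ^ k * exp (i r ⟪ω, e⟫) ∂σ`. -/
def expMoment (σ : Measure E) (e : E) (k : ℕ) (r : ℝ) : ℂ :=
  ∫ ω, (⟪ω, e⟫_ℝ : ℂ) ^ k * Complex.exp (Complex.I * r * ⟪ω, e⟫_ℝ) ∂σ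

theorem norm_exp_I_mul_mul (r t : ℝ) : ‖Complex.exp (Complex.I * r * t)‖ = 1 := by
  rw [Complex.norm_exp]; simp

theorem norm_expMoment_le (σ : Measure E) [IsFiniteMeasure σ]
    (hσ1 : ∀ᵐ ω ∂σ, ‖ω‖ = 1) {e : E} (he : ‖e‖ = 1) (k : ℕ) (r : ℝ) :
    ‖expMoment σ e k r‖ ≤ σ.real univ := by
  have := norm_integral_le_of_norm_le_const (μ := σ) (C := 1)
    (f := fun ω => (⟪ω, e⟫_ℝ : ℂ) ^ k * Complex.exp (Complex.I * r * ⟪ω, e⟫_ℝ)) (by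
      filter_upwards [hσ1] with ω hω
      rw [norm_mul, norm_exp_I_mul_mul, mul_one, norm_pow, Complex.norm_real]
      exact pow_le_one₀ (norm_nonneg _) (abs_inner_le_one_of_unit hω he))
  simpa [expMoment] using this

variable [BorelSpace E] [FiniteDimensional ℝ E]

theorem hasDerivAt_expMoment (σ : Measure E) [IsFiniteMeasure σ]
    (hσ1 : ∀ᵐ ω ∂σ, ‖ω‖ = 1) {e : E} (he : ‖e‖ = 1) (k : ℕ) (r : ℝ) :
    HasDerivAt (expMoment σ e k) (Complex.I * expMoment σ e (k + 1) r) r := by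
  have := hasDerivAt_integral_of_dominated_loc_of_deriv_le (μ := σ)
    (F := fun (r : ℝ) ω => (⟪ω, e⟫_ℝ : ℂ) ^ k * Complex.exp (Complex.I * r * ⟪ω, e⟫_ℝ))
    (F' := fun (r : ℝ) ω => Complex.I *
      ((⟪ω, e⟫_ℝ : ℂ) ^ (k + 1) * Complex.exp (Complex.I * r * ⟪ω, e⟫_ℝ)))
    (x₀ := r) (s := univ) (bound := fun _ => 1) Filter.univ_mem
    (.of_forall fun φ => Continuous.aestronglyMeasurable (by fun_prop))
    (integrable_inner_comp σ hσ1 (by fun_prop))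
    (Continuous.aestronglyMeasurable (by fun_prop))
    (by
      filter_upwards [hσ1] with ω hω x _
      rw [norm_mul, norm_mul, norm_exp_I_mul_mul, mul_one, norm_pow, Complex.norm_real,
        Complex.norm_I, one_mul]
      exact pow_le_one₀ (norm_nonneg _) (abs_inner_le_one_of_unit hω he))
    (integrable_const _)
    (by
      refine .of_forall fun ω x _ => ?_
      have h1 : HasDerivAt (fun x : ℝ => Complex.I * (x : ℂ) * ⟪ω, e⟫_ℝ)
          (Complex.I * ⟪ω, e⟫_ℝ) x := by
        have := ((hasDerivAt_id x).ofReal_comp.const_mul Complex.I).mul_const (⟪ω, e⟫_ℝ : ℂ)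
        simpa using this
      refine ((h1.cexp).const_mul ((⟪ω, e⟫_ℝ : ℂ) ^ k)).congr_deriv ?_
      ring)
  refine this.2.congr_deriv ?_
  rw [expMoment, integral_const_mul]

theorem expMoment_recurrence (σ : Measure E) [IsFiniteMeasure σ]
    (hσ1 : ∀ᵐ ω ∂σ, ‖ω‖ = 1) (hσ : ∀ R : E ≃ₗᵢ[ℝ] E, σ.map R = σ) {e : E} (he : ‖e‖ = 1) {n : ℕ}
    (hn : Module.finrank ℝ E = n + 1) (k : ℕ) (r : ℝ) :
    k * (expMoment σ e (k - 1) r - expMoment σ e (k + 1) r) +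
      Complex.I * r * (expMoment σ e k r - expMoment σ e (k + 2) r) =
      n * expMoment σ e (k + 1) r := by
  have := integral_one_sub_inner_sq_mul_deriv σ hσ1 hσ he hn
    (H := fun t => (t : ℂ) ^ k * Complex.exp (Complex.I * r * t))
    (H' := fun t => k * (t : ℂ) ^ (k - 1) * Complex.exp (Complex.I * r * t) +
      (t : ℂ) ^ k * (Complex.exp (Complex.I * r * t) * (Complex.I * r)))
    (fun t => by
      have h1 : HasDerivAt (fun x : ℝ => Complex.I * r * (x : ℂ)) (Complex.I * r) t := by
        simpa using (hasDerivAt_id t).ofReal_comp.const_mul (Complex.I * r)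
      have h2 : HasDerivAt (fun x : ℝ => (x : ℂ) ^ k) (k * (t : ℂ) ^ (k - 1)) t := by
        exact (hasDerivAt_pow k (t : ℂ)).comp_ofReal
      exact h2.mul h1.cexp)
    (by fun_prop)
  have h_int : ∀ k, Integrable
      (fun ω => (⟪ω, e⟫_ℝ : ℂ) ^ k * Complex.exp (Complex.I * r * ⟪ω, e⟫_ℝ)) σ := fun k =>
    integrable_inner_comp σ hσ1 (by fun_prop)
  have e1 : ∀ ω : E, (⟪ω, e⟫_ℝ : ℂ) * ((⟪ω, e⟫_ℝ : ℂ) ^ k *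
      Complex.exp (Complex.I * r * ⟪ω, e⟫_ℝ)) = (⟪ω, e⟫_ℝ : ℂ) ^ (k + 1) *
      Complex.exp (Complex.I * r * ⟪ω, e⟫_ℝ) := fun ω => by ring
  have e2 : ∀ ω : E, (1 - (⟪ω, e⟫_ℝ : ℂ) ^ 2) *
      (k * (⟪ω, e⟫_ℝ : ℂ) ^ (k - 1) * Complex.exp (Complex.I * r * ⟪ω, e⟫_ℝ) +
      (⟪ω, e⟫_ℝ : ℂ) ^ k * (Complex.exp (Complex.I * r * ⟪ω, e⟫_ℝ) * (Complex.I * r))) =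
      k * (((⟪ω, e⟫_ℝ : ℂ) ^ (k - 1) * Complex.exp (Complex.I * r * ⟪ω, e⟫_ℝ)) -
        ((⟪ω, e⟫_ℝ : ℂ) ^ (k + 1) * Complex.exp (Complex.I * r * ⟪ω, e⟫_ℝ))) +
      Complex.I * r * (((⟪ω, e⟫_ℝ : ℂ) ^ k * Complex.exp (Complex.I * r * ⟪ω, e⟫_ℝ)) -
        ((⟪ω, e⟫_ℝ : ℂ) ^ (k + 2) * Complex.exp (Complex.I * r * ⟪ω, e⟫_ℝ))) := by
    intro ω
    rcases k with _ | k
    · simp; ring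
    · simp only [Nat.add_sub_cancel]; ring
  simp only [e1, e2] at this
  have hsub : ∀ a b, Integrable
      (fun ω => (⟪ω, e⟫_ℝ : ℂ) ^ a * Complex.exp (Complex.I * r * ⟪ω, e⟫_ℝ) -
        (⟪ω, e⟫_ℝ : ℂ) ^ b * Complex.exp (Complex.I * r * ⟪ω, e⟫_ℝ)) σ := fun a b =>
    (h_int a).sub (h_int b)
  rw [integral_add ((hsub _ _).const_mul _) ((hsub _ _).const_mul _),
    integral_const_mul, integral_const_mul, integral_sub (h_int _) (h_int _),
    integral_sub (h_int _) (h_int _)] at this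
  exact this

theorem norm_expMoment_zero_one_decay (σ : Measure E) [IsFiniteMeasure σ]
    (hσ1 : ∀ᵐ ω ∂σ, ‖ω‖ = 1) (hσ : ∀ R : E ≃ₗᵢ[ℝ] E, σ.map R = σ) {n : ℕ}
    (hn : Module.finrank ℝ E = n + 1) {e : E} (he : ‖e‖ = 1) {r₀ r : ℝ} (h₀ : 1 ≤ r₀)
    (hn₀ : n ≤ r₀) (hr : r₀ ≤ r) :
    r ^ n * (‖expMoment σ e 0 r‖ ^ 2 + ‖expMoment σ e 1 r‖ ^ 2) ≤
      4 * Real.exp 1 * (r₀ ^ n * (2 * σ.real univ ^ 2)) := by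
  set f := expMoment σ e 0 with hf
  set g : ℝ → ℂ := fun r => Complex.I * expMoment σ e 1 r with hg
  have hf' : ∀ r : ℝ, 0 < r → HasDerivAt f (g r) r := fun r _ =>
    hasDerivAt_expMoment σ hσ1 he 0 r
  have hg' : ∀ r : ℝ, 0 < r → HasDerivAt g (-f r - (n / r : ℝ) * g r) r := by
    intro r hr
    refine ((hasDerivAt_expMoment σ hσ1 he 1 r).const_mul Complex.I).congr_deriv ?_
    have := expMoment_recurrence σ hσ1 hσ he hn 0 r
    simp only [zero_add, Nat.cast_zero, zero_mul] at this
    have hr' : (r : ℂ) ≠ 0 := by exact_mod_cast hr.ne'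
    simp only [hf, hg]
    push_cast
    field_simp
    linear_combination (-Complex.I) * this +
      (expMoment σ e 0 r * r) * Complex.I_sq
  have hg1 : ∀ r, ‖g r‖ = ‖expMoment σ e 1 r‖ := fun r => by simp [hg]
  have key1 := ode_energy_bound n (fun r => (f r).re) (fun r => (g r).re)
    (fun r hr => (Complex.reCLM.hasFDerivAt.comp_hasDerivAt r (hf' r hr)))
    (fun r hr => ((Complex.reCLM.hasFDerivAt.comp_hasDerivAt r (hg' r hr))).congr_deriv (by
      simp)) h₀ hn₀ hr
  have key2 := ode_energy_bound n (fun r => (f r).im) (fun r => (g r).im)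
    (fun r hr => (Complex.imCLM.hasFDerivAt.comp_hasDerivAt r (hf' r hr)))
    (fun r hr => ((Complex.imCLM.hasFDerivAt.comp_hasDerivAt r (hg' r hr))).congr_deriv (by
      simp)) h₀ hn₀ hr
  have nsq : ∀ z : ℂ, ‖z‖ ^ 2 = z.re ^ 2 + z.im ^ 2 := fun z => by
    rw [Complex.sq_norm, Complex.normSq_apply]; ring
  rw [← hg1, nsq, nsq]
  have b0 : ‖f r₀‖ ^ 2 ≤ σ.real univ ^ 2 := by
    gcongr; exact norm_expMoment_le σ hσ1 he 0 r₀
  have b1 : ‖g r₀‖ ^ 2 ≤ σ.real univ ^ 2 := by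
    rw [hg1]; gcongr; exact norm_expMoment_le σ hσ1 he 1 r₀
  rw [nsq] at b0 b1
  have : 4 * Real.exp 1 * (r₀ ^ n * (((f r₀).re ^ 2 + (f r₀).im ^ 2) +
      ((g r₀).re ^ 2 + (g r₀).im ^ 2))) ≤ 4 * Real.exp 1 * (r₀ ^ n * (2 * σ.real univ ^ 2)) := by
    gcongr
    linarith
  linarith

theorem exists_norm_expMoment_le_rpow (σ : Measure E) [IsFiniteMeasure σ]
    (hσ1 : ∀ᵐ ω ∂σ, ‖ω‖ = 1) (hσ : ∀ R : E ≃ₗᵢ[ℝ] E, σ.map R = σ) {n : ℕ}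
    (hn : Module.finrank ℝ E = n + 1) (k : ℕ) :
    ∃ C : ℝ, 0 ≤ C ∧ ∀ e : E, ‖e‖ = 1 → ∀ r : ℝ, 0 < r →
      ‖expMoment σ e k r‖ ≤ C * r ^ (-(n / 2 : ℝ)) := by
  have ext : ∀ (k : ℕ) (C r₀ : ℝ), 0 ≤ C → 1 ≤ r₀ → (∀ e : E, ‖e‖ = 1 → ∀ r : ℝ, r₀ ≤ r →
      ‖expMoment σ e k r‖ ≤ C * r ^ (-(n / 2 : ℝ))) →
      ∃ C : ℝ, 0 ≤ C ∧ ∀ e : E, ‖e‖ = 1 → ∀ r : ℝ, 0 < r →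
      ‖expMoment σ e k r‖ ≤ C * r ^ (-(n / 2 : ℝ)) := by
    intro k C r₀ hC h₀ H
    have hp : 0 ≤ σ.real univ * r₀ ^ (n / 2 : ℝ) := by positivity
    refine ⟨C + σ.real univ * r₀ ^ (n / 2 : ℝ), by positivity, fun e he r hr => ?_⟩
    have hrp : 0 < r ^ (-(n / 2 : ℝ)) := by positivity
    rcases le_total r₀ r with h | h
    · refine (H e he r h).trans ?_
      gcongr
      linarith
    · refine (norm_expMoment_le σ hσ1 he k r).trans ?_
      have : 1 ≤ r₀ ^ (n / 2 : ℝ) * r ^ (-(n / 2 : ℝ)) := by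
        rw [Real.rpow_neg hr.le, ← div_eq_mul_inv, one_le_div (by positivity)]
        gcongr
      calc σ.real univ ≤ σ.real univ * (r₀ ^ (n / 2 : ℝ) * r ^ (-(n / 2 : ℝ))) :=
            le_mul_of_one_le_right (by positivity) this
        _ ≤ _ := by
          rw [← mul_assoc]
          gcongr
          linarith
  have base : ∀ k < 2, ∃ C : ℝ, 0 ≤ C ∧ ∀ e : E, ‖e‖ = 1 → ∀ r : ℝ, 0 < r →
      ‖expMoment σ e k r‖ ≤ C * r ^ (-(n / 2 : ℝ)) := by
    intro k hk
    set r₀ : ℝ := n + 1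
    set B := 4 * Real.exp 1 * (r₀ ^ n * (2 * σ.real univ ^ 2)) with hB
    have hr₀ : 1 ≤ r₀ := by simp [r₀]
    have hB0 : 0 ≤ B := by positivity
    refine ext k (Real.sqrt B) r₀ (Real.sqrt_nonneg _) hr₀ fun e he r hr => ?_
    have hr0 : 0 < r := by linarith
    have h1 := norm_expMoment_zero_one_decay σ hσ1 hσ hn he hr₀ (by simp [r₀]) hr
    have h2 : r ^ n * ‖expMoment σ e k r‖ ^ 2 ≤ B := by
      refine le_trans ?_ h1
      gcongr
      interval_cases k <;> simp
    have h3 : ‖expMoment σ e k r‖ ^ 2 ≤ B * (r ^ (-(n / 2 : ℝ))) ^ 2 := by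
      rw [← Real.rpow_natCast (r ^ (-(n / 2 : ℝ))) 2, ← Real.rpow_mul hr0.le]
      have : (-(n / 2 : ℝ)) * (2 : ℕ) = -(n : ℝ) := by push_cast; ring
      rw [this, Real.rpow_neg hr0.le, Real.rpow_natCast, ← div_eq_mul_inv, le_div_iff₀ (by positivity)]
      linarith
    have := Real.sqrt_le_sqrt h3
    rwa [Real.sqrt_mul hB0, Real.sqrt_sq (norm_nonneg _), Real.sqrt_sq (by positivity)] at this
  induction k using Nat.strong_induction_on with
  | _ k ih =>
    rcases lt_or_ge k 2 with h | h
    · exact base k h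
    · obtain ⟨m, rfl⟩ := Nat.exists_eq_add_of_le' h
      obtain ⟨C0, hC0, H0⟩ := ih m (by omega)
      obtain ⟨C1, hC1, H1⟩ := ih (m + 1) (by omega)
      obtain ⟨C2, hC2, H2⟩ := ih (m - 1) (by omega)
      refine ext (m + 2) (C0 + (m * (C2 + C1) + n * C1)) 1 (by positivity) le_rfl
        fun e he r hr => ?_
      have hr0 : 0 < r := by linarith
      have hrec := expMoment_recurrence σ hσ1 hσ he hn m r
      have hr' : (r : ℂ) ≠ 0 := by exact_mod_cast hr0.ne'
      have hI : ‖(Complex.I * r)⁻¹‖ ≤ 1 := by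
        rw [norm_inv, norm_mul, Complex.norm_I, one_mul, Complex.norm_real, norm_of_nonneg hr0.le]
        exact inv_le_one_of_one_le₀ hr
      have e1 : expMoment σ e (m + 2) r = expMoment σ e m r + (Complex.I * r)⁻¹ *
          (m * (expMoment σ e (m - 1) r - expMoment σ e (m + 1) r)
            - n * expMoment σ e (m + 1) r) := by
        have hIr : Complex.I * (r : ℂ) ≠ 0 := mul_ne_zero Complex.I_ne_zero hr'
        rw [← hrec]
        field_simp
        ring
      rw [e1]
      have g0 := H0 e he r hr0
      have g1 := H1 e he r hr0
      have g2 := H2 e he r hr0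
      set ρ := r ^ (-(n / 2 : ℝ))
      calc _ ≤ ‖expMoment σ e m r‖ + 1 * (m * (‖expMoment σ e (m - 1) r‖ +
              ‖expMoment σ e (m + 1) r‖) + n * ‖expMoment σ e (m + 1) r‖) := by
            refine (norm_add_le _ _).trans ?_
            rw [norm_mul]
            gcongr
            refine (norm_sub_le _ _).trans ?_
            rw [norm_mul, norm_mul, Complex.norm_natCast, Complex.norm_natCast]
            gcongr
            exact norm_sub_le _ _
        _ ≤ C0 * ρ + 1 * (m * (C2 * ρ + C1 * ρ) + n * (C1 * ρ)) := by gcongr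
        _ = _ := by ring

end

section
open Set
open scoped Pointwise

/-- The polar surface measure on the unit sphere, as a measure on the ambient space. -/
def unitSphereMeasure (E : Type*) [NormedAddCommGroup E] [InnerProductSpace ℝ E]
    [MeasurableSpace E] [BorelSpace E] [FiniteDimensional ℝ E] : Measure E :=
  (volume : Measure E).toSphere.map (↑)

variable {E : Type*} [NormedAddCommGroup E] [InnerProductSpace ℝ E]
  [MeasurableSpace E] [BorelSpace E] [FiniteDimensional ℝ E]

instance : IsFiniteMeasure (unitSphereMeasure E) := by
  unfold unitSphereMeasure; infer_instance

theorem ae_unitSphereMeasure_norm_eq_one : ∀ᵐ ω ∂unitSphereMeasure E, ‖ω‖ = 1 := by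
  rw [unitSphereMeasure, ae_map_iff measurable_subtype_coe.aemeasurable
    (measurableSet_eq_fun measurable_norm measurable_const)]
  exact .of_forall fun ω => by simp

theorem unitSphereMeasure_apply {s : Set E} (hs : MeasurableSet s) :
    unitSphereMeasure E s =
      Module.finrank ℝ E * volume (Ioo (0 : ℝ) 1 • (s ∩ Metric.sphere (0 : E) 1)) := by
  rw [unitSphereMeasure, Measure.map_apply measurable_subtype_coe hs,
    Measure.toSphere_apply' _ (measurable_subtype_coe hs), Subtype.image_preimage_coe, inter_comm]

theorem map_unitSphereMeasure (R : E ≃ₗᵢ[ℝ] E) :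
    (unitSphereMeasure E).map R = unitSphereMeasure E := by
  ext s hs
  have hR : Measurable R := R.continuous.measurable
  rw [Measure.map_apply hR hs, unitSphereMeasure_apply (hR hs), unitSphereMeasure_apply hs]
  congr 1
  have hmp := R.measurePreserving
  rw [← hmp.measure_preimage_equiv (f := R.toMeasurableEquiv)
    (s := Ioo (0 : ℝ) 1 • (s ∩ Metric.sphere (0 : E) 1))]
  congr 1
  ext x
  simp only [mem_smul, mem_preimage, mem_inter_iff, mem_sphere_iff_norm, sub_zero]
  constructor
  · rintro ⟨r, hr, y, ⟨hy, hy1⟩, rfl⟩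
    exact ⟨r, hr, R y, ⟨hy, by simpa using hy1⟩, by simp⟩
  · rintro ⟨r, hr, y, ⟨hy, hy1⟩, h⟩
    refine ⟨r, hr, R.symm y, ⟨by simpa using hy, by simpa using hy1⟩, ?_⟩
    apply R.injective
    simpa using h

theorem lintegral_polar [Nontrivial E] {F : E → ℝ≥0∞} (hF : Measurable F) :
    ∫⁻ x, F x = ∫⁻ ω, (∫⁻ r in Ioi (0 : ℝ),
      ENNReal.ofReal (r ^ (Module.finrank ℝ E - 1)) * F (r • ω)) ∂unitSphereMeasure E := by
  have h1 : ∫⁻ x, F x = ∫⁻ x : ({(0)}ᶜ : Set E), F x ∂(volume.comap Subtype.val) := by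
    rw [lintegral_subtype_comap (measurableSet_singleton _).compl F, restrict_compl_singleton]
  have h2 : ∫⁻ x : ({(0)}ᶜ : Set E), F x ∂(volume.comap Subtype.val) =
      ∫⁻ p : Metric.sphere (0 : E) 1 × Ioi (0 : ℝ), F ((p.2 : ℝ) • (p.1 : E))
        ∂((volume : Measure E).toSphere.prod
          (Measure.volumeIoiPow (Module.finrank ℝ E - 1))) := by
    rw [← (Measure.measurePreserving_homeomorphUnitSphereProd
      (volume : Measure E)).lintegral_comp_emb (Homeomorph.measurableEmbedding _)]
    refine lintegral_congr fun x => ?_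
    congr 1
    have hx : ‖(x : E)‖ ≠ 0 := norm_ne_zero_iff.2 x.2
    simp [smul_smul, hx]
  have hm : Measurable fun q : E × ℝ => ENNReal.ofReal (q.2 ^ (Module.finrank ℝ E - 1)) *
      F (q.2 • q.1) := by fun_prop
  rw [h1, h2, lintegral_prod _ (by fun_prop), unitSphereMeasure,
    lintegral_map (f := fun ω => ∫⁻ r in Ioi (0 : ℝ),
      ENNReal.ofReal (r ^ (Module.finrank ℝ E - 1)) * F (r • ω))
      (Measurable.lintegral_prod_right' (ν := volume.restrict (Ioi (0 : ℝ))) hm)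
      measurable_subtype_coe]
  refine lintegral_congr fun ω => ?_
  rw [Measure.volumeIoiPow, lintegral_withDensity_eq_lintegral_mul _ (by fun_prop) (by fun_prop)]
  exact lintegral_subtype_comap measurableSet_Ioi
    (fun r => ENNReal.ofReal (r ^ (Module.finrank ℝ E - 1)) * F (r • (ω : E)))

theorem map_polar_withDensity [Nontrivial E] :
    (((unitSphereMeasure E).prod (volume.restrict (Ioi (0 : ℝ)))).withDensity
      fun p => ENNReal.ofReal (p.2 ^ (Module.finrank ℝ E - 1))).map (fun p => p.2 • p.1) =
      (volume : Measure E) := by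
  refine Measure.ext_of_lintegral _ fun F hF => ?_
  rw [lintegral_map hF (by fun_prop), lintegral_withDensity_eq_lintegral_mul _ (by fun_prop)
    (by fun_prop), lintegral_polar hF]
  simp only [Pi.mul_apply]
  rw [lintegral_prod _ (by fun_prop)]

/-- Polar coordinates for a radial density times an arbitrary function. -/
theorem integral_radial_smul [Nontrivial E] (φ : ℝ → ℝ) (hφ : Measurable φ) {F : E → ℂ}
    (hF : Measurable F) :
    ∫ x, (φ ‖x‖ / ‖x‖ ^ (Module.finrank ℝ E - 1)) • F x =
      ∫ p, φ p.2 • F (p.2 • p.1) ∂(unitSphereMeasure E).prod (volume.restrict (Ioi (0 : ℝ))) := by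
  set n := Module.finrank ℝ E - 1
  have hG : Measurable fun x : E => (φ ‖x‖ / ‖x‖ ^ n) • F x := by fun_prop
  rw [← map_polar_withDensity (E := E), integral_map (by fun_prop) hG.aestronglyMeasurable]
  have : ∀ p : E × ℝ, ENNReal.ofReal (p.2 ^ n) = ((p.2 ^ n).toNNReal : ℝ≥0∞) := fun p => rfl
  simp_rw [n] at this
  simp_rw [this]
  rw [integral_withDensity_eq_integral_smul (by fun_prop)]
  have hae : ∀ᵐ p ∂(unitSphereMeasure E).prod (volume.restrict (Ioi (0 : ℝ))),
      ‖p.1‖ = 1 ∧ 0 < p.2 := by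
    refine Filter.Eventually.and ?_ ?_
    · exact Measure.quasiMeasurePreserving_fst.ae ae_unitSphereMeasure_norm_eq_one
    · exact Measure.quasiMeasurePreserving_snd.ae (ae_restrict_mem measurableSet_Ioi)
  refine integral_congr_ae ?_
  filter_upwards [hae] with p hp
  have h2 : ‖p.2 • p.1‖ = p.2 := by rw [norm_smul, hp.1, mul_one, Real.norm_of_nonneg hp.2.le]
  rw [h2, NNReal.smul_def, Real.coe_toNNReal _ (pow_nonneg hp.2.le _), smul_smul]
  congr 1
  have := hp.2.ne'
  field_simp
  exact mul_comm _ _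

end

section
open Set
open scoped Pointwise

theorem lipschitzOnWith_inv_norm_smul {E : Type*} [NormedAddCommGroup E] [NormedSpace ℝ E] :
    LipschitzOnWith 2 (fun x : E => ‖x‖⁻¹ • x) {x | 1 ≤ ‖x‖} := by
  refine LipschitzOnWith.of_dist_le_mul fun x hx y hy => ?_
  simp only [mem_ofPred_eq] at hx hy
  have hx0 : ‖x‖ ≠ 0 := by linarith
  have hy0 : ‖y‖ ≠ 0 := by linarith
  rw [dist_eq_norm, dist_eq_norm]
  have : ‖x‖⁻¹ • x - ‖y‖⁻¹ • y = ‖x‖⁻¹ • ((x - y) + ((‖y‖ - ‖x‖) * ‖y‖⁻¹) • y) := by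
    rw [smul_add, smul_sub, smul_smul, sub_add, ← sub_smul]
    congr 2
    field_simp
    ring
  rw [this, norm_smul, norm_inv, norm_norm]
  calc ‖x‖⁻¹ * ‖x - y + ((‖y‖ - ‖x‖) * ‖y‖⁻¹) • y‖
      ≤ 1 * (‖x - y‖ + ‖x - y‖) := by
        gcongr
        · exact inv_le_one_of_one_le₀ hx
        · refine (norm_add_le _ _).trans ?_
          gcongr
          rw [norm_smul, norm_mul, norm_inv, norm_norm, mul_assoc, inv_mul_cancel₀ hy0, mul_one,
            norm_sub_rev x y]
          exact abs_norm_sub_norm_le y x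
    _ = _ := by push_cast; ring

/-- The affine chart of the hyperplane `x i = s`. -/
def hyperplaneChart {n : ℕ} (i : Fin (n + 1)) (s : ℝ) (u : Fin n → ℝ) :
    EuclideanSpace ℝ (Fin (n + 1)) :=
  WithLp.toLp 2 (i.insertNth s u : Fin (n + 1) → ℝ)

theorem exists_lipschitzWith_hyperplaneChart (n : ℕ) :
    ∃ K : ℝ≥0, ∀ (i : Fin (n + 1)) (s : ℝ), LipschitzWith K (hyperplaneChart i s) := by
  refine ⟨_, fun i s => (PiLp.lipschitzWith_toLp 2 (fun _ : Fin (n + 1) => ℝ)).comp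
    (LipschitzWith.of_dist_le_mul (K := 1) fun u v => ?_)⟩
  rw [NNReal.coe_one, one_mul]
  refine (dist_pi_le_iff dist_nonneg).2 fun j => ?_
  refine Fin.succAboveCases i ?_ (fun j => ?_) j
  · simp
  · simpa using dist_le_pi_dist u v j

theorem one_le_norm_hyperplaneChart {n : ℕ} (i : Fin (n + 1)) {s : ℝ} (hs : |s| = 1)
    (u : Fin n → ℝ) : 1 ≤ ‖hyperplaneChart i s u‖ := by
  have := PiLp.norm_apply_le (hyperplaneChart i s u) i
  simpa [hyperplaneChart, hs] using this

theorem norm_hyperplaneChart_le {n : ℕ} (i : Fin (n + 1)) {s : ℝ} (hs : |s| = 1)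
    {u : Fin n → ℝ} (hu : ∀ j, |u j| ≤ 1) : ‖hyperplaneChart i s u‖ ≤ Real.sqrt (n + 1) := by
  rw [EuclideanSpace.norm_eq]
  refine Real.sqrt_le_sqrt ?_
  calc ∑ j, ‖hyperplaneChart i s u j‖ ^ 2 ≤ ∑ j : Fin (n + 1), (1 : ℝ) := by
        refine Finset.sum_le_sum fun j _ => pow_le_one₀ (norm_nonneg _) ?_
        refine Fin.succAboveCases i ?_ (fun j => ?_) j
        · simp [hyperplaneChart, hs]
        · simpa [hyperplaneChart] using hu j
    _ = n + 1 := by simp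

theorem lintegral_mul_volume_le_volume_cone {n : ℕ} (i : Fin (n + 1)) (s b : ℝ)
    {U : Set (Fin n → ℝ)} (hU : MeasurableSet U) :
    (∫⁻ τ in {τ : ℝ | 0 < s * τ ∧ s * τ < b}, ENNReal.ofReal ((s * τ) ^ n)) * volume U ≤
      volume {x : EuclideanSpace ℝ (Fin (n + 1)) |
        (0 < s * x i ∧ s * x i < b) ∧ (fun j => (s * x i)⁻¹ * x (i.succAbove j)) ∈ U} := by
  set T : Set (ℝ × (Fin n → ℝ)) :=
    {p | (0 < s * p.1 ∧ s * p.1 < b) ∧ (fun j => (s * p.1)⁻¹ * p.2 j) ∈ U} with hT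
  have hTm : MeasurableSet T := by
    refine MeasurableSet.inter ?_ ?_
    · have h : Measurable fun p : ℝ × (Fin n → ℝ) => s * p.1 := by fun_prop
      exact h measurableSet_Ioo
    · exact (show Measurable fun p : ℝ × (Fin n → ℝ) => (fun j => (s * p.1)⁻¹ * p.2 j) by
        fun_prop) hU
  have hmp := (volume_preserving_piFinSuccAbove (fun _ : Fin (n + 1) => ℝ) i).comp
    (PiLp.volume_preserving_ofLp (Fin (n + 1)))
  have e : {x : EuclideanSpace ℝ (Fin (n + 1)) |
        (0 < s * x i ∧ s * x i < b) ∧ (fun j => (s * x i)⁻¹ * x (i.succAbove j)) ∈ U} =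
      ((MeasurableEquiv.piFinSuccAbove (fun _ : Fin (n + 1) => ℝ) i) ∘ WithLp.ofLp) ⁻¹' T := by
    ext x
    rfl
  have hS : MeasurableSet {τ : ℝ | 0 < s * τ ∧ s * τ < b} :=
    (measurable_const_mul s) measurableSet_Ioo
  rw [e, hmp.measure_preimage hTm.nullMeasurableSet, Measure.volume_eq_prod,
    Measure.prod_apply hTm, ← lintegral_mul_const _ (by fun_prop), ← lintegral_indicator hS]
  refine lintegral_mono fun τ => ?_
  by_cases hτ : τ ∈ {τ : ℝ | 0 < s * τ ∧ s * τ < b}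
  · rw [indicator_of_mem hτ]
    have h0 : s * τ ≠ 0 := hτ.1.ne'
    have : Prod.mk τ ⁻¹' T = (s * τ) • U := by
      ext w
      rw [mem_smul_set_iff_inv_smul_mem₀ h0]
      simp only [hT, mem_preimage, mem_ofPred_eq]
      exact ⟨fun h => h.2, fun h => ⟨hτ, h⟩⟩
    rw [this, Measure.addHaar_smul_of_nonneg _ hτ.1.le]
    simp
  · rw [indicator_of_notMem hτ]
    exact zero_le

theorem lintegral_cone_ne_zero (n : ℕ) {s b : ℝ} (hs : |s| = 1) (hb : 0 < b) :
    (∫⁻ τ in {τ : ℝ | 0 < s * τ ∧ s * τ < b}, ENNReal.ofReal ((s * τ) ^ n)) ≠ 0 := by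
  have hS : IsOpen {τ : ℝ | 0 < s * τ ∧ s * τ < b} :=
    isOpen_Ioo.preimage (continuous_const_mul s)
  refine ne_of_gt ?_
  rw [setLIntegral_pos_iff (by fun_prop)]
  refine lt_of_lt_of_le (hS.measure_pos volume ⟨s * (b / 2), ?_⟩) (measure_mono ?_)
  · have : s * s = 1 := by rw [← abs_mul_abs_self, hs, one_mul]
    simp only [mem_ofPred_eq, ← mul_assoc, this]
    constructor <;> linarith
  · intro τ hτ
    refine ⟨?_, hτ⟩
    have : 0 < (s * τ) ^ n := pow_pos hτ.1 n
    simpa using this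

theorem hausdorffMeasure_chart_le {n : ℕ} {K : ℝ≥0}
    (hK : ∀ (i : Fin (n + 1)) (s : ℝ), LipschitzWith K (hyperplaneChart i s))
    (i : Fin (n + 1)) {s : ℝ} (hs : |s| = 1) (U : Set (Fin n → ℝ)) :
    Measure.hausdorffMeasure (n : ℝ)
      ((fun u => ‖hyperplaneChart i s u‖⁻¹ • hyperplaneChart i s u) '' U) ≤
      ((2 * K : ℝ≥0) : ℝ≥0∞) ^ n * volume U := by
  have hL : LipschitzOnWith (2 * K)
      (fun u => ‖hyperplaneChart i s u‖⁻¹ • hyperplaneChart i s u) U :=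
    lipschitzOnWith_inv_norm_smul.comp (hK i s).lipschitzOnWith
      fun u _ => one_le_norm_hyperplaneChart i hs u
  refine (hL.hausdorffMeasure_image_le (Nat.cast_nonneg n)).trans ?_
  rw [ENNReal.rpow_natCast]
  gcongr
  have := hausdorffMeasure_pi_real (ι := Fin n)
  rw [Fintype.card_fin] at this
  rw [this]

theorem exists_sphereMeasure_le (d : ℕ) (hd : 1 ≤ d) :
    ∃ C : ℝ≥0∞, C ≠ ∞ ∧ ∀ s, MeasurableSet s →
      sphereMeasure d s ≤ C * unitSphereMeasure (EuclideanSpace ℝ (Fin d)) s := by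
  obtain ⟨n, rfl⟩ := Nat.exists_eq_add_of_le' hd
  obtain ⟨K, hK⟩ := exists_lipschitzWith_hyperplaneChart n
  set b : ℝ := (Real.sqrt (n + 1))⁻¹ with hb
  have hb0 : 0 < b := by positivity
  set c : ℝ → ℝ≥0∞ := fun s =>
    min (∫⁻ τ in {τ : ℝ | 0 < s * τ ∧ s * τ < b}, ENNReal.ofReal ((s * τ) ^ n)) 1 with hc
  have hcne : ∀ s : ℝ, |s| = 1 → c s ≠ 0 := fun s hs h => by
    rcases min_eq_bot.1 h with h | h
    · exact lintegral_cone_ne_zero n hs hb0 h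
    · exact one_ne_zero h
  have key : ∀ (i : Fin (n + 1)) (s : ℝ), |s| = 1 → ∀ A : Set (EuclideanSpace ℝ (Fin (n + 1))),
      MeasurableSet A →
      Measure.hausdorffMeasure (n : ℝ)
        ((fun u => ‖hyperplaneChart i s u‖⁻¹ • hyperplaneChart i s u) ''
          {u | (∀ j, |u j| ≤ 1) ∧ ‖hyperplaneChart i s u‖⁻¹ • hyperplaneChart i s u ∈ A}) ≤
        ((2 * K : ℝ≥0) : ℝ≥0∞) ^ n * (c s)⁻¹ *
          unitSphereMeasure (EuclideanSpace ℝ (Fin (n + 1))) A := by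
    intro i s hs A hA
    have hss : s * s = 1 := by rw [← abs_mul_abs_self, hs, one_mul]
    set U := {u | (∀ j, |u j| ≤ 1) ∧ ‖hyperplaneChart i s u‖⁻¹ • hyperplaneChart i s u ∈ A} with hU
    have hUm : MeasurableSet U := by
      have h1 : Measurable (hyperplaneChart i s) := (hK i s).continuous.measurable
      refine MeasurableSet.inter ?_ ((h1.norm.inv.smul h1) hA)
      have h2 : {u : Fin n → ℝ | ∀ j, |u j| ≤ 1} = ⋂ j, {u | |u j| ≤ 1} := by ext; simp
      change MeasurableSet {u : Fin n → ℝ | ∀ j, |u j| ≤ 1}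
      rw [h2]
      exact MeasurableSet.iInter fun j =>
        measurableSet_le (f := fun u : Fin n → ℝ => |u j|) (measurable_pi_apply j).abs
          measurable_const
    refine (hausdorffMeasure_chart_le hK i hs U).trans ?_
    rw [mul_assoc]
    gcongr
    have h2 := lintegral_mul_volume_le_volume_cone i s b hUm
    have hc0 : c s ≠ 0 := hcne s hs
    have hsub : {x : EuclideanSpace ℝ (Fin (n + 1)) |
        (0 < s * x i ∧ s * x i < b) ∧ (fun j => (s * x i)⁻¹ * x (i.succAbove j)) ∈ U} ⊆
        Ioo (0 : ℝ) 1 • (A ∩ Metric.sphere 0 1) := by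
      rintro x ⟨⟨hx0, hx1⟩, hx2⟩
      set u : Fin n → ℝ := fun j => (s * x i)⁻¹ * x (i.succAbove j) with hu
      have hxu : x = (s * x i) • hyperplaneChart i s u := by
        ext j
        refine Fin.succAboveCases i ?_ (fun j => ?_) j
        · simp only [hyperplaneChart, PiLp.smul_apply, Fin.insertNth_apply_same, smul_eq_mul]
          linear_combination (-x i) * hss
        · simp only [hyperplaneChart, PiLp.smul_apply, Fin.insertNth_apply_succAbove, smul_eq_mul, hu]
          rw [mul_inv_cancel_left₀ hx0.ne']
      have hn1 := one_le_norm_hyperplaneChart i hs u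
      have hn2 := norm_hyperplaneChart_le i hs hx2.1
      have hn0 : ‖hyperplaneChart i s u‖ ≠ 0 := by linarith
      refine ⟨(s * x i) * ‖hyperplaneChart i s u‖, ⟨by positivity, ?_⟩,
        ‖hyperplaneChart i s u‖⁻¹ • hyperplaneChart i s u, ⟨hx2.2, ?_⟩, ?_⟩
      · calc (s * x i) * ‖hyperplaneChart i s u‖ ≤ (s * x i) * Real.sqrt (n + 1) := by gcongr
          _ < b * Real.sqrt (n + 1) := by gcongr
          _ = 1 := inv_mul_cancel₀ (by positivity)
      · simp [norm_smul, hn0]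
      · simp only [smul_smul]
        rw [mul_assoc, mul_inv_cancel₀ hn0, mul_one, ← hxu]
    have h3 : c s * volume U ≤ unitSphereMeasure (EuclideanSpace ℝ (Fin (n + 1))) A := by
      refine (mul_le_mul_left (min_le_left _ _) _).trans (h2.trans ((measure_mono hsub).trans ?_))
      rw [unitSphereMeasure_apply hA]
      refine le_mul_of_one_le_left zero_le ?_
      simp
    have h : c s ≠ ∞ := ((min_le_right _ _).trans_lt one_lt_top).ne
    rw [← ENNReal.div_eq_inv_mul, ENNReal.le_div_iff_mul_le (.inl hc0) (.inl h), mul_comm]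
    exact h3
  have hcov : ∀ A : Set (EuclideanSpace ℝ (Fin (n + 1))), A ∩ Metric.sphere 0 1 ⊆
      ⋃ i : Fin (n + 1), ⋃ t : Bool, (fun u => ‖hyperplaneChart i (bif t then 1 else -1) u‖⁻¹ •
          hyperplaneChart i (bif t then 1 else -1) u) ''
        {u | (∀ j, |u j| ≤ 1) ∧ ‖hyperplaneChart i (bif t then 1 else -1) u‖⁻¹ •
          hyperplaneChart i (bif t then 1 else -1) u ∈ A} := by
    rintro A x ⟨hxA, hx1⟩
    obtain ⟨i, hi⟩ := Finite.exists_max fun j => |x j|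
    have hx1' : ‖x‖ = 1 := by simpa using hx1
    have hxi : x i ≠ 0 := by
      intro h0
      have : x = 0 := by
        ext j
        have := hi j
        rw [h0, abs_zero] at this
        simpa using this
      rw [this] at hx1'
      simp at hx1'
    obtain ⟨t, ht⟩ : ∃ t : Bool, |x i| * (bif t then 1 else -1) = x i := by
      rcases lt_or_gt_of_ne hxi with h | h
      · exact ⟨false, by simp [abs_of_neg h]⟩
      · exact ⟨true, by simp [abs_of_pos h]⟩
    set s : ℝ := bif t then 1 else -1
    set u : Fin n → ℝ := fun j => |x i|⁻¹ * x (i.succAbove j) with hu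
    have hai : 0 < |x i| := abs_pos.2 hxi
    have hxu : hyperplaneChart i s u = |x i|⁻¹ • x := by
      ext j
      refine Fin.succAboveCases i ?_ (fun j => ?_) j
      · simp only [hyperplaneChart, PiLp.smul_apply, Fin.insertNth_apply_same, smul_eq_mul]
        rw [eq_inv_mul_iff_mul_eq₀ hai.ne', ht]
      · simp [hyperplaneChart, hu]
    have hxx : ‖hyperplaneChart i s u‖⁻¹ • hyperplaneChart i s u = x := by
      rw [hxu, norm_smul, hx1', smul_smul]
      simp [hxi]
    refine mem_iUnion₂.2 ⟨i, t, u, ⟨fun j => ?_, ?_⟩, hxx⟩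
    · rw [hu]
      simp only [abs_mul, abs_inv, abs_abs]
      rw [inv_mul_le_iff₀ hai, mul_one]
      exact hi _
    · rw [hxx]; exact hxA
  refine ⟨∑ i : Fin (n + 1), ∑ t : Bool,
    ((2 * K : ℝ≥0) : ℝ≥0∞) ^ n * (c (bif t then 1 else -1))⁻¹, ?_, fun A hA => ?_⟩
  · refine ENNReal.sum_ne_top.2 fun i _ => ENNReal.sum_ne_top.2 fun t _ =>
      ENNReal.mul_ne_top (by finiteness) (ENNReal.inv_ne_top.2 ?_)
    exact hcne _ (by cases t <;> simp)
  · have hdn : (((n + 1 : ℕ) : ℝ) - 1) = n := by push_cast; ring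
    rw [sphereMeasure, Measure.restrict_apply hA, hdn, Finset.sum_mul]
    refine (measure_mono (hcov A)).trans ((measure_iUnion_fintype_le _ _).trans ?_)
    refine Finset.sum_le_sum fun i _ => (measure_iUnion_fintype_le _ _).trans ?_
    rw [Finset.sum_mul]
    exact Finset.sum_le_sum fun t _ => key i _ (by cases t <;> simp) A hA

end

section
open scoped FourierTransform SchwartzMap Convolution

variable {E : Type*} [NormedAddCommGroup E] [InnerProductSpace ℝ E] [FiniteDimensional ℝ E]
  [MeasurableSpace E] [BorelSpace E]

/-- The bilinear form `∬ K (x - y) u y v x` of convolution with `K`. -/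
def convForm (K u v : E → ℂ) : ℂ := ∫ p : E × E, K (p.1 - p.2) * u p.2 * v p.1

theorem lintegral_conv_le {k a b : E → ℝ≥0∞} (hk : Measurable k) (ha : Measurable a)
    (hb : Measurable b) :
    ∫⁻ p : E × E, k (p.1 - p.2) * a p.2 * b p.1 ≤
      (∫⁻ x, k x) * ((∫⁻ x, a x ^ (2 : ℝ)) ^ (1 / 2 : ℝ) * (∫⁻ x, b x ^ (2 : ℝ)) ^ (1 / 2 : ℝ)) := by
  have h := ENNReal.lintegral_mul_le_Lp_mul_Lq (volume : Measure (E × E))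
    (p := 2) (q := 2) (by constructor <;> norm_num)
    (f := fun p => k (p.1 - p.2) ^ (1 / 2 : ℝ) * a p.2)
    (g := fun p => k (p.1 - p.2) ^ (1 / 2 : ℝ) * b p.1)
    (by fun_prop) (by fun_prop)
  have hsq : ∀ x : ℝ≥0∞, x ^ (1 / 2 : ℝ) * x ^ (1 / 2 : ℝ) = x := fun x => by
    rw [← ENNReal.rpow_add_of_nonneg _ _ (by norm_num) (by norm_num)]; norm_num
  have hsq' : ∀ x y : ℝ≥0∞, (x ^ (1 / 2 : ℝ) * y) ^ (2 : ℝ) = x * y ^ (2 : ℝ) := fun x y => by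
    rw [ENNReal.mul_rpow_of_nonneg _ _ (by norm_num), ← ENNReal.rpow_mul]; norm_num
  simp only [Pi.mul_apply, hsq'] at h
  have e1 : ∫⁻ p : E × E, k (p.1 - p.2) * a p.2 ^ (2 : ℝ) = (∫⁻ x, k x) * ∫⁻ x, a x ^ (2 : ℝ) := by
    rw [Measure.volume_eq_prod, lintegral_prod_symm' _ (by fun_prop)]
    simp only
    rw [← lintegral_const_mul _ (by fun_prop)]
    refine lintegral_congr fun y => ?_
    rw [lintegral_mul_const _ (by fun_prop), lintegral_sub_right_eq_self k y]
  have e2 : ∫⁻ p : E × E, k (p.1 - p.2) * b p.1 ^ (2 : ℝ) = (∫⁻ x, k x) * ∫⁻ x, b x ^ (2 : ℝ) := by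
    rw [Measure.volume_eq_prod, lintegral_prod _ (by fun_prop)]
    simp only
    rw [← lintegral_const_mul _ (by fun_prop)]
    refine lintegral_congr fun y => ?_
    rw [lintegral_mul_const _ (by fun_prop), lintegral_sub_left_eq_self k y]
  rw [e1, e2, ENNReal.mul_rpow_of_nonneg _ _ (by norm_num),
    ENNReal.mul_rpow_of_nonneg _ _ (by norm_num), mul_mul_mul_comm, hsq] at h
  refine le_trans (lintegral_mono fun p => le_of_eq ?_) h
  rw [mul_mul_mul_comm, hsq, mul_assoc]

theorem lintegral_enorm_convForm_le {K u v : E → ℂ} (hK : Measurable K) (hu : Measurable u)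
    (hv : Measurable v) :
    ∫⁻ p : E × E, ‖K (p.1 - p.2) * u p.2 * v p.1‖ₑ ≤
      eLpNorm K 1 volume * (eLpNorm u 2 volume * eLpNorm v 2 volume) := by
  have := lintegral_conv_le hK.enorm hu.enorm hv.enorm
  rw [eLpNorm_one_eq_lintegral_enorm, eLpNorm_eq_lintegral_rpow_enorm_toReal (by norm_num) (by norm_num),
    eLpNorm_eq_lintegral_rpow_enorm_toReal (by norm_num) (by norm_num)]
  simpa only [enorm_mul, ENNReal.toReal_ofNat] using this

theorem integrable_convForm {K u v : E → ℂ} (hK : Measurable K) (hu : Measurable u)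
    (hv : Measurable v) (hK1 : Integrable K) (hu2 : MemLp u 2) (hv2 : MemLp v 2) :
    Integrable fun p : E × E => K (p.1 - p.2) * u p.2 * v p.1 := by
  refine ⟨(by fun_prop : Measurable _).aestronglyMeasurable, ?_⟩
  refine (lintegral_enorm_convForm_le hK hu hv).trans_lt ?_
  have := (memLp_one_iff_integrable.2 hK1).2
  exact ENNReal.mul_lt_top this (ENNReal.mul_lt_top hu2.2 hv2.2)

theorem convForm_congr {K u u' v v' : E → ℂ} (hu : u =ᵐ[volume] u') (hv : v =ᵐ[volume] v') :
    convForm K u v = convForm K u' v' := by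
  refine integral_congr_ae ?_
  filter_upwards [(Measure.quasiMeasurePreserving_snd (μ := volume) (ν := volume)).ae hu,
    (Measure.quasiMeasurePreserving_fst (μ := volume) (ν := volume)).ae hv] with p h1 h2
  rw [h1, h2]

/-- The convolution form as a continuous bilinear form on `L²`. -/
def convFormL {K : E → ℂ} (hK : Measurable K) (hK1 : Integrable K) :
    Lp ℂ 2 (volume : Measure E) →L[ℂ] Lp ℂ 2 (volume : Measure E) →L[ℂ] ℂ :=
  LinearMap.mkContinuous₂
    (LinearMap.mk₂ ℂ (fun u v => convForm K u v)
      (fun u u' v => by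
        rw [convForm_congr (Lp.coeFn_add u u') (ae_eq_refl _), convForm, convForm, convForm,
          ← integral_add (integrable_convForm hK (Lp.stronglyMeasurable _).measurable
            (Lp.stronglyMeasurable _).measurable hK1 (Lp.memLp _) (Lp.memLp _))
            (integrable_convForm hK (Lp.stronglyMeasurable _).measurable
            (Lp.stronglyMeasurable _).measurable hK1 (Lp.memLp _) (Lp.memLp _))]
        refine integral_congr_ae (.of_forall fun p => ?_)
        simp only [Pi.add_apply]
        ring)
      (fun c u v => by
        rw [convForm_congr (Lp.coeFn_smul c u) (ae_eq_refl _), convForm, convForm,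
          ← integral_smul]
        refine integral_congr_ae (.of_forall fun p => ?_)
        simp only [Pi.smul_apply, smul_eq_mul]
        ring)
      (fun u v v' => by
        rw [convForm_congr (ae_eq_refl _) (Lp.coeFn_add v v'), convForm, convForm, convForm,
          ← integral_add (integrable_convForm hK (Lp.stronglyMeasurable _).measurable
            (Lp.stronglyMeasurable _).measurable hK1 (Lp.memLp _) (Lp.memLp _))
            (integrable_convForm hK (Lp.stronglyMeasurable _).measurable
            (Lp.stronglyMeasurable _).measurable hK1 (Lp.memLp _) (Lp.memLp _))]
        refine integral_congr_ae (.of_forall fun p => ?_)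
        simp only [Pi.add_apply]
        ring)
      (fun c u v => by
        rw [convForm_congr (ae_eq_refl _) (Lp.coeFn_smul c v), convForm, convForm,
          ← integral_smul]
        refine integral_congr_ae (.of_forall fun p => ?_)
        simp only [Pi.smul_apply, smul_eq_mul]
        ring))
    (eLpNorm K 1 volume).toReal
    (fun u v => by
      have h := (enorm_integral_le_lintegral_enorm _).trans (lintegral_enorm_convForm_le hK
        (Lp.stronglyMeasurable u).measurable (Lp.stronglyMeasurable v).measurable)
      have hK' := (memLp_one_iff_integrable.2 hK1).2
      have h2 := ENNReal.toReal_mono (ENNReal.mul_lt_top hK'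
        (ENNReal.mul_lt_top (Lp.memLp u).2 (Lp.memLp v).2)).ne h
      rw [ENNReal.toReal_mul, ENNReal.toReal_mul, toReal_enorm] at h2
      rw [mul_assoc]
      exact h2)

theorem convFormL_apply {K : E → ℂ} (hK : Measurable K) (hK1 : Integrable K)
    (u v : Lp ℂ 2 (volume : Measure E)) : convFormL hK hK1 u v = convForm K u v := rfl

theorem norm_convForm_schwartz_le {K : E → ℂ} (hK : Measurable K) (hK1 : Integrable K) {C : ℝ}
    (hC : ∀ ξ, ‖𝓕 K ξ‖ ≤ C) (u w : 𝓢(E, ℂ)) :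
    ‖convForm K u (𝓕 w : 𝓢(E, ℂ))‖ ≤ C * (‖u.toLp 2‖ * ‖w.toLp 2‖) := by
  have hC0 : 0 ≤ C := (norm_nonneg _).trans (hC 0)
  have hconv : Integrable (K ⋆[ContinuousLinearMap.mul ℂ ℂ] u) :=
    hK1.integrable_convolution _ u.integrable
  have h1 : convForm K u (𝓕 w : 𝓢(E, ℂ)) = ∫ x, (K ⋆[ContinuousLinearMap.mul ℂ ℂ] u) x * 𝓕 w x := by
    have hm : Measurable (𝓕 w : 𝓢(E, ℂ)) := (𝓕 w).continuous.measurable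
    rw [convForm, Measure.volume_eq_prod, integral_prod]
    · refine integral_congr_ae (.of_forall fun x => ?_)
      simp only
      rw [integral_mul_const, convolution_eq_swap]
      simp only [ContinuousLinearMap.mul_apply']
    · exact integrable_convForm hK u.continuous.measurable hm hK1 (u.memLp 2) ((𝓕 w).memLp 2)
  have h2 : ∫ x, (K ⋆[ContinuousLinearMap.mul ℂ ℂ] u) x * 𝓕 w x =
      ∫ x, (𝓕 K x * 𝓕 u x) * w x := by
    have := VectorFourier.integral_fourierIntegral_smul_eq_flip (L := innerₗ E) (μ := volume)
      (ν := volume) Real.continuous_fourierChar continuous_inner hconv w.integrable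
    simp only [flip_innerₗ, smul_eq_mul] at this
    rw [SchwartzMap.fourier_coe]
    refine Eq.trans this.symm ?_
    refine integral_congr_ae (.of_forall fun x => ?_)
    simp only
    rw [SchwartzMap.fourier_coe, ← Real.fourier_mul_convolution_eq hK1 u.integrable x]
    rfl
  have hF : Measurable (𝓕 u : 𝓢(E, ℂ)) := (𝓕 u).continuous.measurable
  have h_int : Integrable fun x => ‖(𝓕 u) x‖ * ‖w x‖ :=
    MemLp.integrable_mul (p := 2) (q := 2) ((𝓕 u).memLp 2).norm (w.memLp 2).norm
  rw [h1, h2]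
  have h3 : ∫ x, ‖(𝓕 u) x‖ * ‖w x‖ ≤ ‖(𝓕 u).toLp 2‖ * ‖w.toLp 2‖ := by
    have := integral_mul_le_Lp_mul_Lq_of_nonneg (μ := (volume : Measure E)) (p := 2) (q := 2)
      (by constructor <;> norm_num)
      (f := fun x => ‖(𝓕 u) x‖) (g := fun x => ‖w x‖) (.of_forall fun _ => norm_nonneg _)
      (.of_forall fun _ => norm_nonneg _) (by simpa using ((𝓕 u).memLp 2).norm)
      (by simpa using (w.memLp 2).norm)
    refine this.trans (le_of_eq ?_)
    rw [SchwartzMap.norm_toLp, SchwartzMap.norm_toLp]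
    have k1 : MemLp (𝓕 u : 𝓢(E, ℂ)) 2 := (𝓕 u : 𝓢(E, ℂ)).memLp 2
    have k2 : MemLp w 2 := w.memLp 2
    rw [k1.eLpNorm_eq_integral_rpow_norm (by norm_num) (by norm_num),
      k2.eLpNorm_eq_integral_rpow_norm (by norm_num) (by norm_num),
      ENNReal.toReal_ofReal (by positivity), ENNReal.toReal_ofReal (by positivity)]
    simp
  calc ‖∫ x, (𝓕 K x * 𝓕 u x) * w x‖ ≤ ∫ x, C * (‖(𝓕 u) x‖ * ‖w x‖) := by
        refine norm_integral_le_of_norm_le (h_int.const_mul C) (.of_forall fun x => ?_)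
        rw [norm_mul, norm_mul, mul_assoc]
        gcongr
        exact hC x
    _ ≤ _ := by
        rw [integral_const_mul]
        gcongr
        rw [← SchwartzMap.norm_fourier_toL2_eq u]
        exact h3

theorem norm_convForm_le {K : E → ℂ} (hK : Measurable K) (hK1 : Integrable K) {C : ℝ}
    (hC : ∀ ξ, ‖𝓕 K ξ‖ ≤ C) (u v : Lp ℂ 2 (volume : Measure E)) :
    ‖convForm K u v‖ ≤ C * (‖u‖ * ‖v‖) := by
  have hd := SchwartzMap.denseRange_toLpCLM (E := E) (F := ℂ) (μ := volume) (p := 2) (by norm_num)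
  simp only [← convFormL_apply hK hK1]
  refine hd.induction_on₂ (p := fun u v => ‖convFormL hK hK1 u v‖ ≤ C * (‖u‖ * ‖v‖)) ?_ ?_ u v
  · exact isClosed_le (by fun_prop) (by fun_prop)
  · intro u v
    have := norm_convForm_schwartz_le hK hK1 hC u (𝓕⁻ v)
    rw [FourierTransform.fourier_fourierInv_eq] at this
    have e : ‖(𝓕⁻ v).toLp 2‖ = ‖v.toLp 2‖ := by
      rw [← SchwartzMap.norm_fourier_toL2_eq, FourierTransform.fourier_fourierInv_eq]
    rw [e] at this
    simp only [SchwartzMap.toLpCLM_apply, convFormL_apply]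
    rwa [convForm_congr (SchwartzMap.coeFn_toLp _ _ _) (SchwartzMap.coeFn_toLp _ _ _)]

end

section

theorem sum_geometric_bump_le {q u : ℝ} (hq : 1 < q) (hu : 0 ≤ u) (N : ℕ) :
    ∑ j ∈ Finset.range N, q ^ j * u / (1 + q ^ j * u) ^ 2 ≤ q / (q - 1) := by
  have hq0 : 0 < q := by linarith
  have hq1 : 0 < q - 1 := by linarith
  have hstep : ∀ v : ℝ, 0 ≤ v →
      v / (1 + v) ^ 2 ≤ q / (q - 1) * (q * v / (1 + q * v) - v / (1 + v)) := by
    intro v hv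
    have h1 : 0 < 1 + v := by linarith
    have h2 : 0 < 1 + q * v := by positivity
    have : q / (q - 1) * (q * v / (1 + q * v) - v / (1 + v)) =
        v * q / ((1 + q * v) * (1 + v)) := by
      field_simp
      ring
    rw [this, div_le_div_iff₀ (by positivity) (by positivity)]
    have : 0 ≤ v * (1 + v) * (q - 1) := by positivity
    nlinarith
  have hsum : ∀ N : ℕ, ∑ j ∈ Finset.range N, q ^ j * u / (1 + q ^ j * u) ^ 2 ≤
      q / (q - 1) * (q ^ N * u / (1 + q ^ N * u) - u / (1 + u)) := by
    intro N
    induction N with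
    | zero => simp
    | succ N ih =>
      rw [Finset.sum_range_succ]
      have := hstep (q ^ N * u) (by positivity)
      rw [← mul_assoc, ← pow_succ'] at this
      linarith
  refine (hsum N).trans ?_
  have h1 : q ^ N * u / (1 + q ^ N * u) ≤ 1 := by
    rw [div_le_one (by positivity)]
    linarith
  have h2 : 0 ≤ u / (1 + u) := by positivity
  have h3 : 0 < q / (q - 1) := by positivity
  nlinarith

theorem norm_sub_taylor_le {S a : ℝ} (M : ℕ) :
    ∀ {F : ℕ → ℝ → ℂ}, (∀ k r, HasDerivAt (F k) (F (k + 1) r) r) →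
      (∀ r, a ≤ r → ‖F M r‖ ≤ S) → ∀ s, 0 ≤ s →
      ‖F 0 (a + s) - ∑ k ∈ Finset.range M, ((s ^ k / k.factorial : ℝ) : ℂ) * F k a‖ ≤
        S * s ^ M := by
  induction M with
  | zero =>
    intro F _ hS s hs
    simpa using hS (a + s) (by linarith)
  | succ M ih =>
    intro F hF hS s hs
    have ih' := ih (F := fun k => F (k + 1)) (fun k r => hF (k + 1) r) hS
    set R : ℝ → ℂ := fun s =>
      F 0 (a + s) - ∑ k ∈ Finset.range (M + 1), ((s ^ k / k.factorial : ℝ) : ℂ) * F k a with hR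
    have hd : ∀ x, HasDerivAt R (F 1 (a + x) -
        ∑ k ∈ Finset.range M, ((x ^ k / k.factorial : ℝ) : ℂ) * F (k + 1) a) x := by
      intro x
      refine HasDerivAt.sub ?_ ?_
      · exact (hF 0 (a + x)).comp_const_add a x
      · have h1 : (fun s : ℝ => ∑ k ∈ Finset.range (M + 1),
            ((s ^ k / k.factorial : ℝ) : ℂ) * F k a) = fun s : ℝ => (∑ k ∈ Finset.range M,
            ((s ^ (k + 1) / (k + 1).factorial : ℝ) : ℂ) * F (k + 1) a) + F 0 a := by
          funext s
          rw [Finset.sum_range_succ']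
          simp
        rw [h1]
        refine HasDerivAt.add_const _ ?_
        refine HasDerivAt.fun_sum fun k _ => ?_
        refine HasDerivAt.mul_const ?_ _
        refine HasDerivAt.ofReal_comp ?_
        refine ((hasDerivAt_pow (k + 1) x).div_const _).congr_deriv ?_
        rw [Nat.factorial_succ]
        push_cast
        have : (k.factorial : ℝ) ≠ 0 := by positivity
        field_simp
    have hS0 : 0 ≤ S := (norm_nonneg _).trans (hS a le_rfl)
    have := (convex_Icc (0 : ℝ) s).norm_image_sub_le_of_norm_hasDerivWithin_le
      (f := R) (C := S * s ^ M) (fun x _ => (hd x).hasDerivWithinAt)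
      (fun x hx => (ih' x hx.1).trans (by gcongr; exacts [hx.1, hx.2]))
      (Set.left_mem_Icc.2 hs) (Set.right_mem_Icc.2 hs)
    have hR0 : R 0 = 0 := by
      simp [hR, Finset.sum_range_succ']
    rw [hR0, sub_zero, sub_zero, Real.norm_of_nonneg hs, mul_assoc, ← pow_succ] at this
    exact this

theorem exists_polynomial_eval_eq_zero (M : ℕ) : ∃ P : Polynomial ℝ, P.eval 1 = 1 ∧
    ∀ k, 1 ≤ k → k < M → P.eval ((1 / 2 : ℝ) ^ k) = 0 := by
  set Q : Polynomial ℝ := ∏ k ∈ Finset.Ico 1 M, (Polynomial.X - Polynomial.C ((1 / 2 : ℝ) ^ k))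
  have hQ : Q.eval 1 ≠ 0 := by
    rw [Polynomial.eval_prod, Finset.prod_ne_zero_iff]
    intro k hk
    rw [Polynomial.eval_sub, Polynomial.eval_X, Polynomial.eval_C, sub_ne_zero]
    have := pow_lt_one₀ (a := (1 / 2 : ℝ)) (by norm_num) (by norm_num)
      (Nat.one_le_iff_ne_zero.1 (Finset.mem_Ico.1 hk).1)
    exact this.ne'
  refine ⟨Polynomial.C (Q.eval 1)⁻¹ * Q, ?_, fun k h1 h2 => ?_⟩
  · simp [hQ]
  · have hQ0 : Q.eval ((1 / 2 : ℝ) ^ k) = 0 := by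
      rw [Polynomial.eval_prod]
      refine Finset.prod_eq_zero (Finset.mem_Ico.2 ⟨h1, h2⟩) ?_
      rw [Polynomial.eval_sub, Polynomial.eval_X, Polynomial.eval_C, sub_self]
    rw [Polynomial.eval_mul, hQ0, mul_zero]

/-- A profile on `(0, 1]` of mass one whose moments of order `1, …, M - 1` vanish. -/
theorem exists_moment_profile (M : ℕ) : ∃ (η : ℝ → ℝ) (B : ℝ), Measurable η ∧ 0 ≤ B ∧
    (∀ t, t ∉ Set.Ioc (0 : ℝ) 1 → η t = 0) ∧ (∀ t, 0 ≤ t → |η t| ≤ B * t) ∧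
    ∫ t, η t = 1 ∧ ∀ k, 1 ≤ k → k < M → ∫ t, t ^ k * η t = 0 := by
  obtain ⟨P, hP1, hP0⟩ := exists_polynomial_eval_eq_zero M
  set h : ℕ → ℝ := fun i => (1 / 2 : ℝ) ^ i with hh
  have hpos : ∀ i, 0 < h i := fun i => by positivity
  have hsucc : ∀ i, h (i + 1) = h i / 2 := fun i => by simp only [hh, pow_succ]; ring
  have hle : ∀ i, h i ≤ 1 := fun i => pow_le_one₀ (by norm_num) (by norm_num)
  set η : ℝ → ℝ := fun t => ∑ i ∈ Finset.range (P.natDegree + 1),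
    P.coeff i * (Set.Ioc (h (i + 1)) (h i)).indicator (fun _ => 2 / h i) t with hη
  have hmom : ∀ k : ℕ, ∫ t, t ^ k * η t =
      (2 * (1 - (1 / 2 : ℝ) ^ (k + 1)) / (k + 1)) * P.eval ((1 / 2 : ℝ) ^ k) := by
    intro k
    have h1 : ∀ i, ∀ t : ℝ, t ^ k * (P.coeff i *
        (Set.Ioc (h (i + 1)) (h i)).indicator (fun _ => 2 / h i) t) =
        (Set.Ioc (h (i + 1)) (h i)).indicator (fun t => (P.coeff i * (2 / h i)) * t ^ k) t := by
      intro i t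
      by_cases ht : t ∈ Set.Ioc (h (i + 1)) (h i)
      · simp only [Set.indicator_of_mem ht]; ring
      · simp only [Set.indicator_of_notMem ht]; ring
    have h_int : ∀ i, Integrable (fun t : ℝ => (Set.Ioc (h (i + 1)) (h i)).indicator
        (fun t => (P.coeff i * (2 / h i)) * t ^ k) t) := by
      intro i
      rw [integrable_indicator_iff measurableSet_Ioc]
      refine (ContinuousOn.integrableOn_compact isCompact_Icc ?_).mono_set Set.Ioc_subset_Icc_self
      fun_prop
    simp only [hη, Finset.mul_sum, h1]
    rw [integral_finsetSum _ fun i _ => h_int i, Polynomial.eval_eq_sum_range, Finset.mul_sum]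
    refine Finset.sum_congr rfl fun i _ => ?_
    rw [integral_indicator measurableSet_Ioc, ← intervalIntegral.integral_of_le
      (by rw [hsucc]; linarith [hpos i]), intervalIntegral.integral_const_mul, integral_pow, hsucc]
    have e : ((1 / 2 : ℝ) ^ k) ^ i = h i ^ k := by
      simp only [hh]
      rw [← pow_mul, ← pow_mul, mul_comm]
    rw [e]
    have := (hpos i).ne'
    have : (k : ℝ) + 1 ≠ 0 := by positivity
    field_simp
    rw [div_eq_mul_one_div (h i) 2, mul_pow]
    ring
  refine ⟨η, (∑ i ∈ Finset.range (P.natDegree + 1), |P.coeff i| * (4 / h i ^ 2)), ?_,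
    by positivity, ?_, ?_, ?_, ?_⟩
  · refine Finset.measurable_fun_sum _ fun i _ => ?_
    exact (measurable_const.indicator measurableSet_Ioc).const_mul _
  · intro t ht
    refine Finset.sum_eq_zero fun i _ => ?_
    rw [Set.indicator_of_notMem, mul_zero]
    exact fun h' => ht ⟨(hpos _).trans h'.1, h'.2.trans (hle i)⟩
  · intro t ht
    rw [Finset.sum_mul]
    refine (Finset.abs_sum_le_sum_abs _ _).trans (Finset.sum_le_sum fun i _ => ?_)
    rw [abs_mul, mul_assoc]
    gcongr
    by_cases h' : t ∈ Set.Ioc (h (i + 1)) (h i)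
    · rw [Set.indicator_of_mem h', abs_of_nonneg (by positivity)]
      have h2 := h'.1
      rw [hsucc] at h2
      have := hpos i
      rw [div_mul_eq_mul_div, div_le_div_iff₀ (by positivity) (by positivity)]
      nlinarith
    · rw [Set.indicator_of_notMem h', abs_zero]
      positivity
  · have := hmom 0
    simp only [pow_zero, one_mul, hP1] at this
    rw [this]; norm_num
  · intro k h1 h2
    rw [hmom, hP0 k h1 h2, mul_zero]

end

section
set_option linter.unusedSectionVars false
open scoped FourierTransform

variable {E : Type*} [NormedAddCommGroup E] [InnerProductSpace ℝ E] [FiniteDimensional ℝ E]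
  [MeasurableSpace E] [BorelSpace E]

/-- A radial kernel concentrated on the shell `1 < ‖x‖ ≤ 1 + 2⁻ʲ`. -/
def shellKernel (E : Type*) [NormedAddCommGroup E] [InnerProductSpace ℝ E] (η : ℝ → ℝ) (j : ℕ)
    (x : E) : ℝ :=
  2 ^ j * η (2 ^ j * (‖x‖ - 1)) / ‖x‖ ^ (Module.finrank ℝ E - 1)

/-- The increments of the sequence `shellKernel`. -/
def shellDiff (E : Type*) [NormedAddCommGroup E] [InnerProductSpace ℝ E] (η : ℝ → ℝ) :
    ℕ → E → ℝ
  | 0, x => shellKernel E η 0 x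
  | j + 1, x => shellKernel E η (j + 1) x - shellKernel E η j x

/-- The analytic family `∑_{j ≤ N} 2^(-j z) shellDiff j` of kernels. -/
def stripKernel (E : Type*) [NormedAddCommGroup E] [InnerProductSpace ℝ E] (η : ℝ → ℝ) (N : ℕ)
    (z : ℂ) (x : E) : ℂ :=
  ∑ j ∈ Finset.range (N + 1), Complex.exp (-((j * Real.log 2 : ℝ) : ℂ) * z) * shellDiff E η j x

theorem stripKernel_zero (η : ℝ → ℝ) (N : ℕ) (x : E) :
    stripKernel E η N 0 x = shellKernel E η N x := by
  simp only [stripKernel, mul_zero, Complex.exp_zero, one_mul]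
  rw [← Complex.ofReal_sum, Complex.ofReal_inj]
  induction N with
  | zero => simp [shellDiff]
  | succ N ih => rw [Finset.sum_range_succ, ih, shellDiff]; ring

theorem measurable_shellKernel {η : ℝ → ℝ} (hη : Measurable η) (j : ℕ) :
    Measurable (shellKernel E η j) := by
  unfold shellKernel
  fun_prop

theorem measurable_shellDiff {η : ℝ → ℝ} (hη : Measurable η) (j : ℕ) :
    Measurable (shellDiff E η j) := by
  cases j with
  | zero => exact measurable_shellKernel hη 0
  | succ j => exact (measurable_shellKernel hη (j + 1)).sub (measurable_shellKernel hη j)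

theorem measurable_stripKernel {η : ℝ → ℝ} (hη : Measurable η) (N : ℕ) (z : ℂ) :
    Measurable (stripKernel E η N z) := by
  unfold stripKernel
  have := fun j => measurable_shellDiff (E := E) hη j
  refine Finset.measurable_fun_sum _ fun j _ => ?_
  exact (Complex.measurable_ofReal.comp (this j)).const_mul _

theorem abs_profile_le {η : ℝ → ℝ} {B : ℝ} (hB : 0 ≤ B) (h0 : ∀ t, t ∉ Set.Ioc (0 : ℝ) 1 → η t = 0)
    (hb : ∀ t, 0 ≤ t → |η t| ≤ B * t) (t : ℝ) : |η t| ≤ B := by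
  by_cases ht : t ∈ Set.Ioc (0 : ℝ) 1
  · exact (hb t ht.1.le).trans (by nlinarith [ht.2])
  · rw [h0 t ht, abs_zero]; exact hB

theorem abs_shellKernel_le {η : ℝ → ℝ} (h0 : ∀ t, t ∉ Set.Ioc (0 : ℝ) 1 → η t = 0)
    (j : ℕ) (x : E) : |shellKernel E η j x| ≤ 2 ^ j * |η (2 ^ j * (‖x‖ - 1))| := by
  unfold shellKernel
  by_cases h : 2 ^ j * (‖x‖ - 1) ∈ Set.Ioc (0 : ℝ) 1
  · have h1 : 1 ≤ ‖x‖ := by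
      have := pos_of_mul_pos_right h.1 (by positivity)
      linarith
    rw [abs_div, abs_mul, abs_of_pos (by positivity : (0 : ℝ) < 2 ^ j), abs_pow, abs_norm]
    exact div_le_self (by positivity) (one_le_pow₀ h1)
  · rw [h0 _ h]; simp

theorem integrable_shellKernel {η : ℝ → ℝ} {B : ℝ} (hη : Measurable η) (hB : 0 ≤ B)
    (h0 : ∀ t, t ∉ Set.Ioc (0 : ℝ) 1 → η t = 0)
    (hb : ∀ t, 0 ≤ t → |η t| ≤ B * t) (j : ℕ) : Integrable (shellKernel E η j) := by
  have hs : Function.support (shellKernel E η j) ⊆ Metric.closedBall 0 2 := by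
    intro x hx
    rw [mem_closedBall_zero_iff]
    by_contra h
    refine hx ?_
    unfold shellKernel
    rw [h0, mul_zero, zero_div]
    intro h'
    have := one_le_pow₀ (a := (2 : ℝ)) (n := j) (by norm_num)
    push Not at h
    nlinarith [h'.2]
  rw [← integrableOn_iff_integrable_of_support_subset hs]
  refine Measure.integrableOn_of_bounded (M := 2 ^ j * B) ?_
    (measurable_shellKernel hη j).aestronglyMeasurable (.of_forall fun x => ?_)
  · exact measure_closedBall_lt_top.ne
  · refine (abs_shellKernel_le h0 j x).trans ?_
    gcongr
    exact abs_profile_le hB h0 hb _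

theorem integrable_shellDiff {η : ℝ → ℝ} {B : ℝ} (hη : Measurable η) (hB : 0 ≤ B)
    (h0 : ∀ t, t ∉ Set.Ioc (0 : ℝ) 1 → η t = 0)
    (hb : ∀ t, 0 ≤ t → |η t| ≤ B * t) (j : ℕ) : Integrable (shellDiff E η j) := by
  cases j with
  | zero => exact integrable_shellKernel hη hB h0 hb 0
  | succ j =>
    have h1 : Integrable (shellKernel E η (j + 1)) := integrable_shellKernel hη hB h0 hb _
    have h2 : Integrable (shellKernel E η j) := integrable_shellKernel hη hB h0 hb _
    exact h1.sub h2

theorem integrable_stripKernel {η : ℝ → ℝ} {B : ℝ} (hη : Measurable η) (hB : 0 ≤ B)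
    (h0 : ∀ t, t ∉ Set.Ioc (0 : ℝ) 1 → η t = 0)
    (hb : ∀ t, 0 ≤ t → |η t| ≤ B * t) (N : ℕ) (z : ℂ) : Integrable (stripKernel E η N z) := by
  unfold stripKernel
  refine integrable_finsetSum _ fun j _ => ?_
  have h : Integrable (shellDiff E η j) :=
    integrable_shellDiff hη hB h0 hb j
  exact h.ofReal.const_mul _

theorem sum_le_of_step {A b : ℕ → ℝ} {a L S : ℝ} (hL : 0 ≤ L) (hb : ∀ j, 0 ≤ b j) (h0 : A 0 ≤ a)
    (hs : ∀ j, A (j + 1) ≤ b (j + 1) + L * b j)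
    (hS : ∀ N, ∑ j ∈ Finset.range N, b j ≤ S) (N : ℕ) :
    ∑ j ∈ Finset.range (N + 1), A j ≤ a + (1 + L) * S := by
  rw [Finset.sum_range_succ']
  have h1 : ∑ j ∈ Finset.range N, A (j + 1) ≤
      ∑ j ∈ Finset.range N, b (j + 1) + L * ∑ j ∈ Finset.range N, b j := by
    rw [Finset.mul_sum, ← Finset.sum_add_distrib]
    exact Finset.sum_le_sum fun j _ => hs j
  have h2 := hS (N + 1)
  rw [Finset.sum_range_succ'] at h2
  have h3 := mul_le_mul_of_nonneg_left (hS N) hL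
  linarith [hb 0]

theorem norm_exp_log_two (j : ℕ) (z : ℂ) :
    ‖Complex.exp (-((j * Real.log 2 : ℝ) : ℂ) * z)‖ = (2 : ℝ) ^ (-(j * z.re)) := by
  rw [Complex.norm_exp, ← Complex.ofReal_neg, Complex.re_ofReal_mul,
    Real.rpow_def_of_pos (by norm_num)]
  congr 1
  ring

theorem norm_stripKernel_le {η : ℝ → ℝ} {B : ℝ} (hB : 0 ≤ B)
    (h0 : ∀ t, t ∉ Set.Ioc (0 : ℝ) 1 → η t = 0) (hb : ∀ t, 0 ≤ t → |η t| ≤ B * t)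
    (N : ℕ) {z : ℂ} (hz : z.re = 1) (x : E) : ‖stripKernel E η N z x‖ ≤ B + 16 * B := by
  set t : ℝ := max (‖x‖ - 1) 0 with ht
  have ht0 : 0 ≤ t := le_max_right _ _
  set b : ℕ → ℝ := fun j => 4 * B * (2 ^ j * t / (1 + 2 ^ j * t) ^ 2) with hbdef
  have hb0 : ∀ j, 0 ≤ b j := fun j => by positivity
  have hk : ∀ j, |η (2 ^ j * (‖x‖ - 1))| ≤ b j := by
    intro j
    by_cases h : 2 ^ j * (‖x‖ - 1) ∈ Set.Ioc (0 : ℝ) 1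
    · have h1 : 0 < ‖x‖ - 1 := pos_of_mul_pos_right h.1 (by positivity)
      have h2 : t = ‖x‖ - 1 := max_eq_left h1.le
      rw [← h2] at h ⊢
      refine (hb _ h.1.le).trans ?_
      simp only [hbdef]
      obtain ⟨h3, h4⟩ := h
      generalize 2 ^ j * t = u at *
      rw [mul_div_assoc', le_div_iff₀ (by positivity)]
      have : (1 + u) ^ 2 ≤ 4 := by nlinarith
      nlinarith [mul_le_mul_of_nonneg_left this (by positivity : 0 ≤ B * u)]
    · rw [h0 _ h, abs_zero]; exact hb0 j
  have hS : ∀ N, ∑ j ∈ Finset.range N, b j ≤ 8 * B := by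
    intro N
    rw [← Finset.mul_sum]
    have := sum_geometric_bump_le (q := 2) (by norm_num) ht0 N
    norm_num at this
    nlinarith
  have hnorm : ∀ j : ℕ, ‖Complex.exp (-((j * Real.log 2 : ℝ) : ℂ) * z) * shellDiff E η j x‖ =
      (2 ^ j)⁻¹ * |shellDiff E η j x| := by
    intro j
    rw [norm_mul, norm_exp_log_two, hz, mul_one, Real.rpow_neg (by norm_num), Real.rpow_natCast,
      Complex.norm_real, Real.norm_eq_abs]
  refine (norm_sum_le _ _).trans ?_
  simp only [hnorm]
  refine (sum_le_of_step (A := fun j => (2 ^ j)⁻¹ * |shellDiff E η j x|) (b := b) (a := B) (L := 1)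
    zero_le_one hb0 ?_ ?_ hS N).trans (by linarith)
  · simp only [pow_zero, inv_one, one_mul, shellDiff]
    refine (abs_shellKernel_le h0 0 x).trans ?_
    simpa using abs_profile_le hB h0 hb _
  · intro j
    simp only [shellDiff]
    have h1 := (abs_shellKernel_le h0 (j + 1) x).trans
      (mul_le_mul_of_nonneg_left (hk (j + 1)) (by positivity))
    have h2 := (abs_shellKernel_le h0 j x).trans
      (mul_le_mul_of_nonneg_left (hk j) (by positivity))
    have h3 := abs_sub (shellKernel E η (j + 1) x) (shellKernel E η j x)
    rw [inv_mul_le_iff₀ (by positivity)]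
    have h4 : 0 ≤ (2 : ℝ) ^ j * b j := mul_nonneg (by positivity) (hb0 j)
    rw [pow_succ] at *
    nlinarith

end

section
set_option linter.unusedSectionVars false
open scoped FourierTransform

variable {E : Type*} [NormedAddCommGroup E] [InnerProductSpace ℝ E] [FiniteDimensional ℝ E]
  [MeasurableSpace E] [BorelSpace E]

theorem integrable_profile {η : ℝ → ℝ} {B : ℝ} (hη : Measurable η) (hB : 0 ≤ B)
    (h0 : ∀ t, t ∉ Set.Ioc (0 : ℝ) 1 → η t = 0)
    (hb : ∀ t, 0 ≤ t → |η t| ≤ B * t) : Integrable η := by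
  have hs : Function.support η ⊆ Set.Ioc 0 1 := by
    intro x hx
    by_contra h
    exact hx (h0 x h)
  rw [← integrableOn_iff_integrable_of_support_subset hs]
  exact Measure.integrableOn_of_bounded (M := B) (by simp) hη.aestronglyMeasurable
    (.of_forall fun x => abs_profile_le hB h0 hb x)

theorem norm_integral_profile_mul_le {η : ℝ → ℝ} {B S : ℝ} (hB : 0 ≤ B)
    (h0 : ∀ t, t ∉ Set.Ioc (0 : ℝ) 1 → η t = 0)
    (hb : ∀ t, 0 ≤ t → |η t| ≤ B * t) {G : ℝ → ℂ} (hG : ∀ t ∈ Set.Ioc (0 : ℝ) 1, ‖G t‖ ≤ S) :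
    ‖∫ t, (η t : ℂ) * G t‖ ≤ B * S := by
  rw [← setIntegral_eq_integral_of_forall_compl_eq_zero (s := Set.Ioc (0 : ℝ) 1)]
  · have := norm_setIntegral_le_of_norm_le_const (μ := volume) (s := Set.Ioc (0 : ℝ) 1)
      (f := fun t => (η t : ℂ) * G t) (C := B * S) (by simp) (fun t ht => by
        rw [norm_mul, Complex.norm_real, Real.norm_eq_abs]
        exact mul_le_mul (abs_profile_le hB h0 hb t) (hG t ht) (norm_nonneg _) hB)
    simpa using this
  · intro t ht
    rw [h0 t ht]; simp

/-- The average of `s ↦ expMoment σ e 0 s` over `[ρ, (1 + 2⁻ʲ) ρ]` against the profile `η`. -/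
def shellMoment (σ : Measure E) (η : ℝ → ℝ) (e : E) (j : ℕ) (ρ : ℝ) : ℂ :=
  ∫ t, (η t : ℂ) * expMoment σ e 0 (ρ + (2 ^ j)⁻¹ * t * ρ)

theorem fourier_shellKernel [Nontrivial E] {η : ℝ → ℝ} {B : ℝ} (hη : Measurable η) (hB : 0 ≤ B)
    (h0 : ∀ t, t ∉ Set.Ioc (0 : ℝ) 1 → η t = 0)
    (hb : ∀ t, 0 ≤ t → |η t| ≤ B * t) (j : ℕ) {ξ e : E} (hξ : ξ = (-‖ξ‖) • e) :
    𝓕 (fun x => (shellKernel E η j x : ℂ)) ξ =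
      shellMoment (unitSphereMeasure E) η e j (2 * Real.pi * ‖ξ‖) := by
  set φ : ℝ → ℝ := fun r => 2 ^ j * η (2 ^ j * (r - 1)) with hφ
  have hφm : Measurable φ := by fun_prop
  have hφi : Integrable φ := by
    have := (((integrable_profile hη hB h0 hb).comp_mul_left' (R := 2 ^ j)
      (by positivity)).comp_sub_right 1).const_mul (2 ^ j)
    exact this
  set F : E → ℂ := fun x => Complex.exp (((-2 * Real.pi * inner ℝ x ξ : ℝ) : ℂ) * Complex.I) with hF
  have hFm : Measurable F := by fun_prop
  have hF1 : ∀ x, ‖F x‖ = 1 := fun x => Complex.norm_exp_ofReal_mul_I _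
  rw [Real.fourier_eq']
  have e1 : ∀ x : E, Complex.exp (((-2 * Real.pi * inner ℝ x ξ : ℝ) : ℂ) * Complex.I) •
      (shellKernel E η j x : ℂ) = (φ ‖x‖ / ‖x‖ ^ (Module.finrank ℝ E - 1)) • F x := by
    intro x
    rw [Complex.real_smul, smul_eq_mul, mul_comm]
    rfl
  simp only [e1]
  rw [integral_radial_smul φ hφm hFm, integral_prod_symm]
  · have e2 : ∀ r : ℝ, ∫ ω, φ r • F (r • ω) ∂unitSphereMeasure E =
        (φ r : ℂ) * expMoment (unitSphereMeasure E) e 0 (2 * Real.pi * ‖ξ‖ * r) := by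
      intro r
      rw [integral_smul, Complex.real_smul, expMoment]
      congr 1
      refine integral_congr_ae (.of_forall fun ω => ?_)
      simp only [hF, pow_zero, one_mul]
      congr 1
      rw [inner_smul_left, hξ, inner_smul_right, ← hξ]
      push_cast
      simp
      ring
    simp only [e2]
    rw [setIntegral_eq_integral_of_forall_compl_eq_zero]
    · have e3 := Measure.integral_comp_mul_left (fun t : ℝ => (η t : ℂ) *
        expMoment (unitSphereMeasure E) e 0 (2 * Real.pi * ‖ξ‖ + (2 ^ j)⁻¹ * t *
          (2 * Real.pi * ‖ξ‖))) ((2 : ℝ) ^ j)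
      have e4 := integral_sub_right_eq_self (μ := volume) (fun r : ℝ => (η (2 ^ j * r) : ℂ) *
        expMoment (unitSphereMeasure E) e 0 (2 * Real.pi * ‖ξ‖ + (2 ^ j)⁻¹ * (2 ^ j * r) *
          (2 * Real.pi * ‖ξ‖))) (1 : ℝ)
      rw [← e4, abs_of_pos (by positivity), ← inv_smul_eq_iff₀ (by positivity), inv_inv] at e3
      rw [shellMoment, ← e3, ← integral_smul]
      refine integral_congr_ae (.of_forall fun r => ?_)
      simp only [hφ]
      rw [inv_mul_cancel_left₀ (by positivity), Complex.real_smul]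
      push_cast
      rw [mul_assoc]
      congr 4
      ring
    · intro r hr
      simp only [hφ]
      rw [h0]
      · simp
      · intro h
        have := pos_of_mul_pos_right h.1 (by positivity)
        simp only [Set.mem_Ioi, not_lt] at hr
        linarith
  · have : Integrable (fun p : E × ℝ => (1 : ℝ) * φ p.2)
        ((unitSphereMeasure E).prod (volume.restrict (Set.Ioi 0))) :=
      (integrable_const (1 : ℝ)).mul_prod hφi.integrableOn
    refine this.mono (by fun_prop : Measurable _).aestronglyMeasurable (.of_forall fun p => ?_)
    rw [norm_smul, hF1, mul_one, one_mul]

theorem norm_shellMoment_le {σ : Measure E} {η : ℝ → ℝ} {B S : ℝ} (hB : 0 ≤ B)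
    (h0 : ∀ t, t ∉ Set.Ioc (0 : ℝ) 1 → η t = 0)
    (hb : ∀ t, 0 ≤ t → |η t| ≤ B * t) {e : E} {ρ : ℝ} (hρ : 0 ≤ ρ)
    (hS : ∀ r, ρ ≤ r → ‖expMoment σ e 0 r‖ ≤ S) (j : ℕ) :
    ‖shellMoment σ η e j ρ‖ ≤ B * S := by
  refine norm_integral_profile_mul_le hB h0 hb fun t ht => hS _ ?_
  have := ht.1
  have : 0 ≤ (2 ^ j)⁻¹ * t * ρ := by positivity
  linarith

theorem norm_shellMoment_sub_le {σ : Measure E} [IsFiniteMeasure σ] (hσ1 : ∀ᵐ ω ∂σ, ‖ω‖ = 1)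
    {η : ℝ → ℝ} {B S : ℝ} (hη : Measurable η) (hB : 0 ≤ B)
    (h0 : ∀ t, t ∉ Set.Ioc (0 : ℝ) 1 → η t = 0)
    (hb : ∀ t, 0 ≤ t → |η t| ≤ B * t) (h_int : ∫ t, η t = 1) {M : ℕ}
    (hM : ∀ k, 1 ≤ k → k < M → ∫ t, t ^ k * η t = 0) (hM1 : 1 ≤ M)
    {e : E} (he : ‖e‖ = 1) {ρ : ℝ} (hρ : 0 ≤ ρ)
    (hS : ∀ r, ρ ≤ r → ‖expMoment σ e M r‖ ≤ S) (j : ℕ) :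
    ‖shellMoment σ η e j ρ - expMoment σ e 0 ρ‖ ≤ B * (S * ((2 ^ j)⁻¹ * ρ) ^ M) := by
  have hS0 : 0 ≤ S := (norm_nonneg _).trans (hS ρ le_rfl)
  set F : ℕ → ℝ → ℂ := fun k r => Complex.I ^ k * expMoment σ e k r with hF
  have hFd : ∀ k r, HasDerivAt (F k) (F (k + 1) r) r := by
    intro k r
    refine ((hasDerivAt_expMoment σ hσ1 he k r).const_mul _).congr_deriv ?_
    simp only [hF, pow_succ]
    ring
  have hFS : ∀ r, ρ ≤ r → ‖F M r‖ ≤ S := by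
    intro r hr
    simpa [hF] using hS r hr
  have hT := norm_sub_taylor_le M hFd hFS
  have hF0 : ∀ r, F 0 r = expMoment σ e 0 r := fun r => by simp [hF]
  have hcont : Continuous (F 0) := continuous_iff_continuousAt.2 fun r => (hFd 0 r).continuousAt
  have hηi := integrable_profile hη hB h0 hb
  have hpow : ∀ k : ℕ, Integrable fun t : ℝ => t ^ k * η t := by
    intro k
    refine hηi.mono (by fun_prop : Measurable _).aestronglyMeasurable (.of_forall fun t => ?_)
    by_cases ht : t ∈ Set.Ioc (0 : ℝ) 1
    · rw [norm_mul]
      refine mul_le_of_le_one_left (norm_nonneg _) ?_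
      rw [norm_pow, Real.norm_of_nonneg ht.1.le]
      exact pow_le_one₀ ht.1.le ht.2
    · rw [h0 t ht]; simp
  have hmain : Integrable fun t : ℝ => (η t : ℂ) * F 0 (ρ + (2 ^ j)⁻¹ * t * ρ) := by
    refine Integrable.mul_bdd (c := σ.real Set.univ) hηi.ofReal ?_ (.of_forall fun t => ?_)
    · exact (by fun_prop : Continuous fun t : ℝ => F 0 (ρ + (2 ^ j)⁻¹ * t * ρ)).aestronglyMeasurable
    · rw [hF0]
      exact norm_expMoment_le σ hσ1 he _ _
  have hterm : ∀ k, Integrable fun t : ℝ => (η t : ℂ) *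
      ((((((2 ^ j)⁻¹ * t * ρ) ^ k / k.factorial : ℝ)) : ℂ) * F k ρ) := by
    intro k
    have : Integrable fun t : ℝ => ((t ^ k * η t : ℝ) : ℂ) *
        (((((2 ^ j)⁻¹ * ρ) ^ k / k.factorial : ℝ) : ℂ) * F k ρ) :=
      ((hpow k).ofReal (𝕜 := ℂ)).mul_const _
    refine this.congr (.of_forall fun t => ?_)
    simp only
    push_cast
    rw [mul_pow, mul_pow, mul_pow]
    ring
  have hsum : ∫ t, (η t : ℂ) * ∑ k ∈ Finset.range M,
      (((((2 ^ j)⁻¹ * t * ρ) ^ k / k.factorial : ℝ) : ℂ) * F k ρ) = F 0 ρ := by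
    simp only [Finset.mul_sum]
    rw [integral_finsetSum _ fun k _ => hterm k, Finset.sum_eq_single 0]
    · simp only [pow_zero, Nat.factorial_zero, Nat.cast_one, div_one, Complex.ofReal_one, one_mul]
      rw [integral_mul_const, integral_complex_ofReal, h_int]
      simp
    · intro k hk hk0
      have : ∀ t : ℝ, (η t : ℂ) * (((((2 ^ j)⁻¹ * t * ρ) ^ k / k.factorial : ℝ) : ℂ) * F k ρ) =
          ((t ^ k * η t : ℝ) : ℂ) * (((((2 ^ j)⁻¹ * ρ) ^ k / k.factorial : ℝ) : ℂ) * F k ρ) := by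
        intro t
        push_cast
        rw [mul_pow, mul_pow, mul_pow]
        ring
      simp only [this]
      rw [integral_mul_const, integral_complex_ofReal,
        hM k (Nat.one_le_iff_ne_zero.2 hk0) (Finset.mem_range.1 hk)]
      simp
    · intro h
      exact absurd (Finset.mem_range.2 hM1) h
  have hsumi : Integrable fun t : ℝ => (η t : ℂ) * ∑ k ∈ Finset.range M,
      (((((2 ^ j)⁻¹ * t * ρ) ^ k / k.factorial : ℝ) : ℂ) * F k ρ) := by
    simp only [Finset.mul_sum]
    exact integrable_finsetSum _ fun k _ => hterm k
  have hdiff : shellMoment σ η e j ρ - expMoment σ e 0 ρ =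
      ∫ t, (η t : ℂ) * (F 0 (ρ + (2 ^ j)⁻¹ * t * ρ) - ∑ k ∈ Finset.range M,
      (((((2 ^ j)⁻¹ * t * ρ) ^ k / k.factorial : ℝ) : ℂ) * F k ρ)) := by
    simp only [mul_sub]
    rw [integral_sub hmain hsumi, hsum, hF0, shellMoment]
    simp only [hF0]
  rw [hdiff]
  refine norm_integral_profile_mul_le hB h0 hb fun t ht => ?_
  have ht0 := ht.1.le
  refine (hT _ (by positivity)).trans ?_
  gcongr
  exact mul_le_of_le_one_right (by positivity) ht.2

theorem exists_norm_fourier_stripKernel_le {n : ℕ} (hn1 : 1 ≤ n)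
    (hn : Module.finrank ℝ E = n + 1) {η : ℝ → ℝ} {B : ℝ} (hη : Measurable η) (hB : 0 ≤ B)
    (h0 : ∀ t, t ∉ Set.Ioc (0 : ℝ) 1 → η t = 0)
    (hb : ∀ t, 0 ≤ t → |η t| ≤ B * t) (h_int : ∫ t, η t = 1)
    (hM : ∀ k, 1 ≤ k → k < n + 1 → ∫ t, t ^ k * η t = 0) :
    ∃ C : ℝ, ∀ (N : ℕ) (z : ℂ), z.re = -(n / 2 : ℝ) → ∀ ξ : E, ‖𝓕 (stripKernel E η N z) ξ‖ ≤ C := by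
  have : Nontrivial E := Module.nontrivial_of_finrank_pos (R := ℝ) (by omega)
  set σ := unitSphereMeasure E with hσdef
  have hσ1 : ∀ᵐ ω ∂σ, ‖ω‖ = 1 := ae_unitSphereMeasure_norm_eq_one
  obtain ⟨C₀, hC₀, hd₀⟩ := exists_norm_expMoment_le_rpow σ hσ1 map_unitSphereMeasure hn 0
  obtain ⟨C₁, hC₁, hd₁⟩ := exists_norm_expMoment_le_rpow σ hσ1 map_unitSphereMeasure hn (n + 1)
  set C₂ : ℝ := (B + 1) * C₀ + B * C₁ with hC₂
  have hC₂0 : 0 ≤ C₂ := by positivity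
  set q : ℝ := Real.sqrt 2 with hq
  have hq1 : 1 < q := by rw [hq, Real.lt_sqrt] <;> norm_num
  have hq2 : q ^ 2 = 2 := Real.sq_sqrt (by norm_num)
  have hq0 : 0 < q := by linarith
  refine ⟨B * σ.real Set.univ + (1 + q ^ n) * (4 * C₂ * (q / (q - 1))), fun N z hz ξ => ?_⟩
  obtain ⟨e, he, hξ⟩ : ∃ e : E, ‖e‖ = 1 ∧ ξ = (-‖ξ‖) • e := by
    by_cases h : ξ = 0
    · obtain ⟨e, he⟩ := exists_norm_eq E zero_le_one
      exact ⟨e, he, by simp [h]⟩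
    · have h' : ‖ξ‖ ≠ 0 := norm_ne_zero_iff.2 h
      refine ⟨(-‖ξ‖⁻¹) • ξ, ?_, ?_⟩
      · rw [norm_smul, norm_neg, norm_inv, norm_norm, inv_mul_cancel₀ h']
      · rw [smul_smul, neg_mul_neg, mul_inv_cancel₀ h', one_smul]
  set ρ : ℝ := 2 * Real.pi * ‖ξ‖ with hρ
  have hρ0 : 0 ≤ ρ := by positivity
  set H : ℕ → ℂ := fun j => shellMoment σ η e j ρ with hH
  have hker : ∀ j, 𝓕 (fun x => (shellKernel E η j x : ℂ)) ξ = H j := fun j =>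
    fourier_shellKernel hη hB h0 hb j hξ
  -- the Fourier transforms of the increments
  set D : ℕ → ℂ := fun j => 𝓕 (fun x => (shellDiff E η j x : ℂ)) ξ with hD
  have hD0 : D 0 = H 0 := hker 0
  have hDs : ∀ j, D (j + 1) = H (j + 1) - H j := by
    intro j
    rw [← hker, ← hker]
    simp only [hD, Real.fourier_eq']
    rw [← integral_sub]
    · refine integral_congr_ae (.of_forall fun x => ?_)
      simp only [shellDiff, smul_eq_mul]
      push_cast
      ring
    all_goals
      refine Integrable.bdd_mul (c := 1)
        (integrable_shellKernel (E := E) hη hB h0 hb _).ofReal ?_ (.of_forall fun x => ?_)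
      · exact (by fun_prop : Measurable _).aestronglyMeasurable
      · rw [Complex.norm_exp_ofReal_mul_I]
  have hsum : 𝓕 (stripKernel E η N z) ξ = ∑ j ∈ Finset.range (N + 1),
      Complex.exp (-((j * Real.log 2 : ℝ) : ℂ) * z) * D j := by
    simp only [hD, Real.fourier_eq', stripKernel, Finset.smul_sum]
    rw [integral_finsetSum]
    · refine Finset.sum_congr rfl fun j _ => ?_
      rw [← integral_const_mul]
      refine integral_congr_ae (.of_forall fun x => ?_)
      simp only [smul_eq_mul]
      ring
    · intro j _
      refine Integrable.bdd_mul (c := 1)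
        ((integrable_shellDiff (E := E) hη hB h0 hb _).ofReal.const_mul _) ?_
        (.of_forall fun x => ?_)
      · exact (by fun_prop : Measurable _).aestronglyMeasurable
      · rw [Complex.norm_exp_ofReal_mul_I]
  have hcoef : ∀ j : ℕ, ‖Complex.exp (-((j * Real.log 2 : ℝ) : ℂ) * z) * D j‖ =
      (q ^ j) ^ n * ‖D j‖ := by
    intro j
    rw [norm_mul, norm_exp_log_two, hz]
    congr 1
    rw [← hq2, ← Real.rpow_natCast q 2, ← Real.rpow_mul hq0.le, ← pow_mul, ← Real.rpow_natCast]
    congr 1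
    push_cast
    rw [show q ^ (2 : ℝ) = 2 by exact_mod_cast hq2]
    ring
  rw [hsum]
  refine (norm_sum_le _ _).trans ?_
  simp only [hcoef]
  -- the size of the differences
  set s : ℝ := (Real.sqrt ρ)⁻¹ with hs
  have hs0 : 0 ≤ s := by positivity
  set b : ℕ → ℝ := fun j => 4 * C₂ * (q ^ j * s / (1 + q ^ j * s) ^ 2) with hbdef
  have hb0 : ∀ j, 0 ≤ b j := fun j => by positivity
  have herr : ∀ j, (q ^ j) ^ n * ‖H j - expMoment σ e 0 ρ‖ ≤ b j := by
    intro j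
    rcases hρ0.eq_or_lt with h | hρpos
    · have : H j = expMoment σ e 0 ρ := by
        simp only [hH, shellMoment, ← h, mul_zero, add_zero]
        rw [integral_mul_const, integral_complex_ofReal, h_int]
        simp
      rw [this, sub_self, norm_zero, mul_zero]
      exact hb0 j
    have hsq : Real.sqrt ρ ^ 2 = ρ := Real.sq_sqrt hρ0
    have hsqpos : 0 < Real.sqrt ρ := Real.sqrt_pos.2 hρpos
    have hspos : 0 < s := by positivity
    have hrp : ρ ^ (-(n / 2 : ℝ)) = s ^ n := by
      rw [hs, inv_pow, Real.rpow_neg hρ0, Real.sqrt_eq_rpow, ← Real.rpow_natCast,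
        ← Real.rpow_mul hρ0]
      congr 2
      ring
    have hmono : ∀ r, ρ ≤ r → r ^ (-(n / 2 : ℝ)) ≤ s ^ n := by
      intro r hr
      rw [← hrp]
      exact Real.rpow_le_rpow_of_nonpos hρpos hr (by simp; positivity)
    have k0 : ∀ r, ρ ≤ r → ‖expMoment σ e 0 r‖ ≤ C₀ * s ^ n := fun r hr =>
      (hd₀ e he r (hρpos.trans_le hr)).trans (by gcongr; exact hmono r hr)
    have k1 : ∀ r, ρ ≤ r → ‖expMoment σ e (n + 1) r‖ ≤ C₁ * s ^ n := fun r hr =>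
      (hd₁ e he r (hρpos.trans_le hr)).trans (by gcongr; exact hmono r hr)
    have a1 : ‖H j - expMoment σ e 0 ρ‖ ≤ (B + 1) * C₀ * s ^ n := by
      refine (norm_sub_le _ _).trans ?_
      have := norm_shellMoment_le hB h0 hb hρ0 k0 j
      have := k0 ρ le_rfl
      simp only [hH]
      linarith
    have a2 : ‖H j - expMoment σ e 0 ρ‖ ≤ B * (C₁ * s ^ n * ((2 ^ j)⁻¹ * ρ) ^ (n + 1)) :=
      norm_shellMoment_sub_le hσ1 hη hB h0 hb h_int hM (by omega) he hρ0 k1 j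
    set v : ℝ := q ^ j * s with hv
    have hvpos : 0 < v := by positivity
    have hvx : (2 ^ j)⁻¹ * ρ = (v ^ 2)⁻¹ := by
      rw [hv, mul_pow, ← pow_mul, mul_comm j 2, pow_mul, hq2, mul_inv, hs, inv_pow, inv_inv, hsq]
    have hvn : (q ^ j) ^ n * s ^ n = v ^ n := by rw [hv, mul_pow]
    have hqj : 0 ≤ (q ^ j) ^ n := by positivity
    simp only [hbdef]
    rw [mul_div_assoc', le_div_iff₀ (by positivity)]
    rcases le_total v 1 with hv1 | hv1
    · have t1 : (q ^ j) ^ n * ‖H j - expMoment σ e 0 ρ‖ ≤ C₂ * v := by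
        calc _ ≤ (q ^ j) ^ n * ((B + 1) * C₀ * s ^ n) := by gcongr
          _ = (B + 1) * C₀ * v ^ n := by rw [← hvn]; ring
          _ ≤ C₂ * v := by
            have hvv : v ^ n ≤ v := pow_le_of_le_one hvpos.le hv1 (by omega)
            have : 0 ≤ B * C₁ := by positivity
            have : (B + 1) * C₀ ≤ C₂ := by linarith
            gcongr
      have t2 : (1 + v) ^ 2 ≤ 4 := by nlinarith
      calc _ ≤ C₂ * v * 4 := by gcongr
        _ = _ := by ring
    · have t1 : (q ^ j) ^ n * ‖H j - expMoment σ e 0 ρ‖ ≤ C₂ * v⁻¹ := by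
        calc _ ≤ (q ^ j) ^ n * (B * (C₁ * s ^ n * ((v ^ 2)⁻¹) ^ (n + 1))) := by
              rw [← hvx]; gcongr
          _ = B * C₁ * (v ^ n * ((v ^ 2)⁻¹) ^ (n + 1)) := by rw [← hvn]; ring
          _ = B * C₁ * (v⁻¹ ^ (n + 2)) := by
            congr 1
            rw [inv_pow, inv_pow, ← pow_mul]
            field_simp
            ring
          _ ≤ C₂ * v⁻¹ := by
            have hvv : v⁻¹ ^ (n + 2) ≤ v⁻¹ :=
              pow_le_of_le_one (by positivity) (inv_le_one_of_one_le₀ hv1) (by omega)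
            have : 0 ≤ (B + 1) * C₀ := by positivity
            have : B * C₁ ≤ C₂ := by linarith
            gcongr
      have t2 : (1 + v) ^ 2 ≤ 4 * v ^ 2 := by nlinarith
      calc _ ≤ C₂ * v⁻¹ * (4 * v ^ 2) := by gcongr
        _ = _ := by field_simp; rw [hv]; ring
  have hS : ∀ N, ∑ j ∈ Finset.range N, b j ≤ 4 * C₂ * (q / (q - 1)) := by
    intro N
    rw [← Finset.mul_sum]
    have := sum_geometric_bump_le hq1 hs0 N
    gcongr
  refine sum_le_of_step (A := fun j => (q ^ j) ^ n * ‖D j‖) (b := b) (L := q ^ n) (by positivity)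
    hb0 ?_ ?_ hS N
  · simp only [pow_zero, one_pow, one_mul, hD0]
    exact norm_shellMoment_le hB h0 hb hρ0 (fun r _ => norm_expMoment_le σ hσ1 he 0 r) 0
  · intro j
    have h1 := herr (j + 1)
    have h2 := mul_le_mul_of_nonneg_left (herr j) (by positivity : 0 ≤ q ^ n)
    rw [hDs]
    have h3 : ‖H (j + 1) - H j‖ ≤ ‖H (j + 1) - expMoment σ e 0 ρ‖ + ‖H j - expMoment σ e 0 ρ‖ := by
      have := norm_sub_le (H (j + 1) - expMoment σ e 0 ρ) (H j - expMoment σ e 0 ρ)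
      simpa using this
    have h4 : (q ^ (j + 1)) ^ n = q ^ n * (q ^ j) ^ n := by
      rw [pow_succ, mul_pow, mul_comm]
    calc _ ≤ (q ^ (j + 1)) ^ n * (‖H (j + 1) - expMoment σ e 0 ρ‖ + ‖H j - expMoment σ e 0 ρ‖) := by
          gcongr
      _ = (q ^ (j + 1)) ^ n * ‖H (j + 1) - expMoment σ e 0 ρ‖ +
          q ^ n * ((q ^ j) ^ n * ‖H j - expMoment σ e 0 ρ‖) := by rw [h4]; ring
      _ ≤ _ := add_le_add h1 h2

end

section
set_option linter.unusedSectionVars false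
open scoped FourierTransform

theorem norm_ofReal_cpow_le_one {w : ℝ} (h0 : 0 ≤ w) (h1 : w ≤ 1) {a : ℂ} (ha : 0 < a.re) :
    ‖(w : ℂ) ^ a‖ ≤ 1 := by
  rw [Complex.norm_cpow_eq_rpow_re_of_nonneg h0 ha.ne']
  exact Real.rpow_le_one h0 h1 ha.le

theorem measurable_ofReal_cpow {α : Type*} [MeasurableSpace α] {W : α → ℝ} (hW : Measurable W)
    (a : ℂ) : Measurable fun p => (W p : ℂ) ^ a := by
  fun_prop

theorem differentiableAt_integral_mul_cpow {α : Type*} [MeasurableSpace α] {μ : Measure α}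
    {k : α → ℂ} (hk : Integrable k μ) {W : α → ℝ} (hW : Measurable W)
    (h0 : ∀ p, 0 ≤ W p) (h1 : ∀ p, W p ≤ 1) {a : ℂ} (ha : 0 < a.re) :
    DifferentiableAt ℂ (fun a : ℂ => ∫ p, k p * (W p : ℂ) ^ a ∂μ) a := by
  set δ : ℝ := a.re / 2 with hδ
  have hδ0 : 0 < δ := by positivity
  have hre : ∀ b ∈ Metric.ball a δ, δ < b.re := by
    intro b hb
    rw [Metric.mem_ball, dist_eq_norm] at hb
    have h2 := (abs_le.1 ((Complex.abs_re_le_norm (b - a)).trans hb.le)).1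
    have h3 := (abs_lt.1 ((Complex.abs_re_le_norm (b - a)).trans_lt hb)).1
    rw [Complex.sub_re] at h3
    linarith
  refine (hasDerivAt_integral_of_dominated_loc_of_deriv_le (μ := μ)
    (F := fun (a : ℂ) p => k p * (W p : ℂ) ^ a)
    (F' := fun (a : ℂ) p => k p * ((W p : ℂ) ^ a * Complex.log (W p)))
    (bound := fun p => ‖k p‖ * (1 / δ)) (Metric.ball_mem_nhds a hδ0) ?_ ?_ ?_ ?_ ?_ ?_).2.differentiableAt
  · exact .of_forall fun b => hk.1.mul (measurable_ofReal_cpow hW b).aestronglyMeasurable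
  · exact hk.mul_bdd (c := 1) (measurable_ofReal_cpow hW a).aestronglyMeasurable
      (.of_forall fun p => norm_ofReal_cpow_le_one (h0 p) (h1 p) ha)
  · exact hk.1.mul ((measurable_ofReal_cpow hW a).mul (by fun_prop)).aestronglyMeasurable
  · refine .of_forall fun p b hb => ?_
    rw [norm_mul]
    gcongr
    have hb' := hre b hb
    rcases (h0 p).eq_or_lt with h | h
    · rw [← h]; simp; positivity
    · rw [norm_mul, Complex.norm_cpow_eq_rpow_re_of_nonneg h.le (hδ0.trans hb').ne',
        ← Complex.ofReal_log h.le, Complex.norm_real, Real.norm_eq_abs]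
      have := Real.abs_log_mul_self_rpow_lt (W p) b.re h (h1 p) (hδ0.trans hb')
      rw [abs_mul, abs_of_nonneg (Real.rpow_nonneg h.le _), mul_comm] at this
      refine this.le.trans ?_
      gcongr
  · exact hk.norm.mul_const _
  · refine .of_forall fun p b hb => ?_
    have hb0 : b ≠ 0 := by
      rintro rfl
      have := hre 0 hb
      simp at this
      linarith
    exact (Complex.hasStrictDerivAt_const_cpow (Or.inr hb0)).hasDerivAt.const_mul _

variable {E : Type*} [NormedAddCommGroup E] [InnerProductSpace ℝ E] [FiniteDimensional ℝ E]
  [MeasurableSpace E] [BorelSpace E]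

theorem abs_shellDiff_le {η : ℝ → ℝ} {B : ℝ} (hB : 0 ≤ B)
    (h0 : ∀ t, t ∉ Set.Ioc (0 : ℝ) 1 → η t = 0)
    (hb : ∀ t, 0 ≤ t → |η t| ≤ B * t) (j : ℕ) (x : E) :
    |shellDiff E η j x| ≤ 2 * (2 ^ j * B) := by
  have h : ∀ i, |shellKernel E η i x| ≤ 2 ^ i * B := fun i =>
    (abs_shellKernel_le h0 i x).trans (by gcongr; exact abs_profile_le hB h0 hb _)
  have hp : 0 ≤ (2 : ℝ) ^ j * B := by positivity
  cases j with
  | zero => 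
    refine (h 0).trans ?_
    linarith
  | succ j =>
    have h1 := abs_sub (shellKernel E η (j + 1) x) (shellKernel E η j x)
    have h2 := h j
    have h3 := h (j + 1)
    rw [shellDiff]
    rw [pow_succ] at *
    nlinarith

/-- Three lines applied to the analytic family: functions bounded by one. -/
theorem exists_shellKernel_form_le_of_le_one {n : ℕ} (hn1 : 1 ≤ n)
    (hn : Module.finrank ℝ E = n + 1) {η : ℝ → ℝ} {B : ℝ} (hη : Measurable η) (hB : 0 ≤ B)
    (h0 : ∀ t, t ∉ Set.Ioc (0 : ℝ) 1 → η t = 0)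
    (hb : ∀ t, 0 ≤ t → |η t| ≤ B * t) (h_int : ∫ t, η t = 1)
    (hM : ∀ k, 1 ≤ k → k < n + 1 → ∫ t, t ^ k * η t = 0) :
    ∃ C : ℝ, 0 ≤ C ∧ ∀ (N : ℕ) (f g : E → ℝ) (R : ℝ), Measurable f → Measurable g →
      (∀ x, 0 ≤ f x) → (∀ x, 0 ≤ g x) → (∀ x, f x ≤ 1) → (∀ x, g x ≤ 1) →
      (∀ x, x ∉ Metric.closedBall 0 R → f x = 0) → (∀ x, x ∉ Metric.closedBall 0 R → g x = 0) →
      ∫ p : E × E, shellKernel E η N (p.1 - p.2) * f p.2 * g p.1 ≤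
        C * ((∫ x, f x ^ ((n + 2 : ℝ) / (n + 1))) * ∫ x, g x ^ ((n + 2 : ℝ) / (n + 1))) ^
          ((n + 1 : ℝ) / (n + 2)) := by
  obtain ⟨C₀, hC₀⟩ := exists_norm_fourier_stripKernel_le hn1 hn hη hB h0 hb h_int hM
  have hC₀0 : 0 ≤ C₀ := (norm_nonneg _).trans (hC₀ 0 (-(n / 2 : ℝ) : ℝ) (by simp) 0)
  set C₁ : ℝ := B + 16 * B with hC₁
  have hC₁0 : 0 ≤ C₁ := by positivity
  set q : ℝ := (n + 2 : ℝ) / (n + 1) with hq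
  have hq0 : 0 < q := by positivity
  set s₀ : ℝ := (n : ℝ) / (n + 2) with hs₀
  refine ⟨C₀ ^ (1 - s₀) * C₁ ^ s₀, by positivity, ?_⟩
  intro N f g R hf hg hf0 hg0 hf1 hg1 hfR hgR
  set X : ℝ := ∫ x, f x ^ q with hX
  set Y : ℝ := ∫ x, g x ^ q with hY
  have hX0 : 0 ≤ X := integral_nonneg fun x => Real.rpow_nonneg (hf0 x) _
  have hY0 : 0 ≤ Y := integral_nonneg fun x => Real.rpow_nonneg (hg0 x) _
  set Z : ℂ → ℂ := fun a => ((n : ℂ) + 1) * (a - 1) with hZ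
  have hZre : ∀ a : ℂ, (Z a).re = (n + 1 : ℝ) * (a.re - 1) := by
    intro a
    have : Z a = ((n + 1 : ℝ) : ℂ) * (a - 1) := by simp [hZ]
    rw [this, Complex.re_ofReal_mul, Complex.sub_re, Complex.one_re]
  set Φ : ℂ → ℂ := fun a => convForm (stripKernel E η N (Z a)) (fun y => (f y : ℂ) ^ a)
    (fun x => (g x : ℂ) ^ a) with hΦ
  -- the restriction to a bounded set and the expansion of the form
  set S : Set (E × E) := Metric.closedBall 0 R ×ˢ Metric.closedBall 0 R with hSdef
  have hS : MeasurableSet S := Metric.isClosed_closedBall.measurableSet.prod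
    Metric.isClosed_closedBall.measurableSet
  have : IsFiniteMeasure ((volume : Measure (E × E)).restrict S) := by
    constructor
    rw [Measure.restrict_apply_univ, hSdef, Measure.volume_eq_prod, Measure.prod_prod]
    exact ENNReal.mul_lt_top measure_closedBall_lt_top measure_closedBall_lt_top
  set W : E × E → ℝ := fun p => f p.2 * g p.1 with hW
  have hWm : Measurable W := by fun_prop
  have hW0 : ∀ p, 0 ≤ W p := fun p => mul_nonneg (hf0 _) (hg0 _)
  have hW1 : ∀ p, W p ≤ 1 := fun p => mul_le_one₀ (hf1 _) (hg0 _) (hg1 _)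
  have hki : ∀ j, Integrable (fun p : E × E => (shellDiff E η j (p.1 - p.2) : ℂ))
      (volume.restrict S) := by
    intro j
    have hm := measurable_shellDiff (E := E) hη j
    refine Integrable.of_bound (C := 2 * (2 ^ j * B))
      (by fun_prop : Measurable _).aestronglyMeasurable (.of_forall fun p => ?_)
    rw [Complex.norm_real]
    exact abs_shellDiff_le hB h0 hb j _
  set Ψ : ℕ → ℂ → ℂ := fun j a => ∫ p in S, (shellDiff E η j (p.1 - p.2) : ℂ) * (W p : ℂ) ^ a
    with hΨ
  have hcp : ∀ (a : ℂ) (p : E × E), (f p.2 : ℂ) ^ a * (g p.1 : ℂ) ^ a = (W p : ℂ) ^ a := by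
    intro a p
    rw [hW, Complex.ofReal_mul, Complex.mul_cpow_ofReal_nonneg (hf0 _) (hg0 _)]
  have hexp : ∀ a : ℂ, 0 < a.re → Φ a = ∑ j ∈ Finset.range (N + 1),
      Complex.exp (-((j * Real.log 2 : ℝ) : ℂ) * Z a) * Ψ j a := by
    intro a ha
    have ha0 : a ≠ 0 := by rintro rfl; simp at ha
    simp only [hΦ, convForm, hΨ]
    rw [← setIntegral_eq_integral_of_forall_compl_eq_zero (s := S)]
    · simp only [stripKernel, ← integral_const_mul]
      rw [← integral_finsetSum]
      · refine integral_congr_ae (.of_forall fun p => ?_)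
        simp only
        rw [mul_assoc, hcp, Finset.sum_mul]
        simp only [mul_assoc]
      · intro j _
        exact ((hki j).mul_bdd (c := 1) (measurable_ofReal_cpow hWm a).aestronglyMeasurable
          (.of_forall fun p => norm_ofReal_cpow_le_one (hW0 p) (hW1 p) ha)).const_mul _
    · intro p hp
      rw [mul_assoc, hcp]
      have : W p = 0 := by
        by_cases h1 : p.1 ∈ Metric.closedBall (0 : E) R
        · have h2 : p.2 ∉ Metric.closedBall (0 : E) R := fun h2 => hp ⟨h1, h2⟩
          simp only [hW, hfR _ h2, zero_mul]
        · simp only [hW, hgR _ h1, mul_zero]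
      rw [this, Complex.ofReal_zero, Complex.zero_cpow ha0, mul_zero]
  have hΨd : ∀ j (a : ℂ), 0 < a.re → DifferentiableAt ℂ (Ψ j) a := fun j a ha =>
    differentiableAt_integral_mul_cpow (hki j) hWm hW0 hW1 ha
  have hΦd : ∀ a : ℂ, 0 < a.re → DifferentiableAt ℂ Φ a := by
    intro a ha
    have h1 : DifferentiableAt ℂ (fun a => ∑ j ∈ Finset.range (N + 1),
      Complex.exp (-((j * Real.log 2 : ℝ) : ℂ) * Z a) * Ψ j a) a := by
      refine DifferentiableAt.fun_sum fun j _ => ?_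
      refine DifferentiableAt.mul ?_ (hΨd j a ha)
      simp only [hZ]
      fun_prop
    refine h1.congr_of_eventuallyEq ?_
    filter_upwards [(isOpen_lt continuous_const Complex.continuous_re).mem_nhds ha] with b hb
    exact hexp b hb
  have hq2 : 0 < q / 2 := by positivity
  have hqq : q / 2 < q := by linarith
  have hdc : DiffContOnCl ℂ Φ (Complex.HadamardThreeLines.verticalStrip (q / 2) q) := by
    refine DifferentiableOn.diffContOnCl fun a ha => ?_
    have : closure (Complex.HadamardThreeLines.verticalStrip (q / 2) q) ⊆
        Complex.re ⁻¹' Set.Icc (q / 2) q := by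
      refine closure_minimal ?_ (isClosed_Icc.preimage Complex.continuous_re)
      exact Set.preimage_mono Set.Ioo_subset_Icc_self
    exact (hΦd a (hq2.trans_le (this ha).1)).differentiableWithinAt
  have hbdd : BddAbove ((norm ∘ Φ) '' Complex.HadamardThreeLines.verticalClosedStrip (q / 2) q) := by
    refine ⟨∑ j ∈ Finset.range (N + 1), (2 : ℝ) ^ (j * (n + 1 : ℝ)) *
      ∫ p in S, ‖(shellDiff E η j (p.1 - p.2) : ℂ)‖, ?_⟩
    rintro _ ⟨a, ha, rfl⟩
    have ha0 : 0 < a.re := hq2.trans_le ha.1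
    rw [Function.comp_apply, hexp a ha0]
    refine (norm_sum_le _ _).trans (Finset.sum_le_sum fun j _ => ?_)
    rw [norm_mul, norm_exp_log_two, hZre]
    gcongr ?_ * ?_
    · refine Real.rpow_le_rpow_of_exponent_le (by norm_num) ?_
      have : 0 ≤ (j : ℝ) * ((n + 1 : ℝ) * a.re) := by positivity
      linarith
    · refine norm_integral_le_of_norm_le (hki j).norm (.of_forall fun p => ?_)
      rw [norm_mul]
      exact mul_le_of_le_one_right (norm_nonneg _)
        (norm_ofReal_cpow_le_one (hW0 p) (hW1 p) ha0)
  -- the two boundary lines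
  have hmemLp : ∀ {u : E → ℝ}, Measurable u → (∀ x, 0 ≤ u x) → (∀ x, u x ≤ 1) →
      (∀ x, x ∉ Metric.closedBall 0 R → u x = 0) → ∀ b : ℝ, 0 < b →
      Integrable (fun x => u x ^ b) := by
    intro u hu hu0 hu1 huR b hb
    have hs : Function.support (fun x => u x ^ b) ⊆ Metric.closedBall 0 R := by
      intro x hx
      by_contra h
      refine hx ?_
      simp only [huR x h, Real.zero_rpow hb.ne']
    rw [← integrableOn_iff_integrable_of_support_subset hs]
    refine Measure.integrableOn_of_bounded (M := 1) measure_closedBall_lt_top.ne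
      (by fun_prop : Measurable _).aestronglyMeasurable (.of_forall fun x => ?_)
    rw [Real.norm_of_nonneg (Real.rpow_nonneg (hu0 x) _)]
    exact Real.rpow_le_one (hu0 x) (hu1 x) hb.le
  have hL2 : ∀ {u : E → ℝ}, Measurable u → (∀ x, 0 ≤ u x) → (∀ x, u x ≤ 1) →
      (∀ x, x ∉ Metric.closedBall 0 R → u x = 0) → ∀ a : ℂ, a.re = q / 2 →
      ∃ h : MemLp (fun x => (u x : ℂ) ^ a) 2 volume, ‖h.toLp‖ = (∫ x, u x ^ q) ^ (1 / 2 : ℝ) := by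
    intro u hu hu0 hu1 huR a ha
    have hnorm : ∀ x, ‖(u x : ℂ) ^ a‖ ^ 2 = u x ^ q := by
      intro x
      rw [Complex.norm_cpow_eq_rpow_re_of_nonneg (hu0 x) (by rw [ha]; positivity), ha,
        ← Real.rpow_natCast, ← Real.rpow_mul (hu0 x)]
      congr 1
      push_cast
      ring
    have hmem : MemLp (fun x => (u x : ℂ) ^ a) 2 volume := by
      refine (memLp_two_iff_integrable_sq_norm
        (measurable_ofReal_cpow hu a).aestronglyMeasurable).2 ?_
      simp only [hnorm]
      exact hmemLp hu hu0 hu1 huR q hq0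
    refine ⟨hmem, ?_⟩
    rw [Lp.norm_toLp, hmem.eLpNorm_eq_integral_rpow_norm (by norm_num) (by norm_num),
      ENNReal.toReal_ofReal (by positivity)]
    simp only [ENNReal.toReal_ofNat, Real.rpow_ofNat, hnorm, one_div]
  have hline0 : ∀ a ∈ Complex.re ⁻¹' {q / 2}, ‖Φ a‖ ≤ C₀ * (X * Y) ^ (1 / 2 : ℝ) := by
    intro a ha
    have ha' : a.re = q / 2 := ha
    obtain ⟨h1, h1'⟩ := hL2 hf hf0 hf1 hfR a ha'
    obtain ⟨h2, h2'⟩ := hL2 hg hg0 hg1 hgR a ha'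
    have := norm_convForm_le (measurable_stripKernel (E := E) hη N (Z a))
      (integrable_stripKernel hη hB h0 hb N (Z a)) (C := C₀) (hC₀ N (Z a) ?_) h1.toLp h2.toLp
    · rw [convForm_congr h1.coeFn_toLp h2.coeFn_toLp, h1', h2',
        ← Real.mul_rpow hX0 hY0] at this
      exact this
    · rw [hZre, ha', hq]
      field_simp
      ring
  have hline1 : ∀ a ∈ Complex.re ⁻¹' {q}, ‖Φ a‖ ≤ C₁ * (X * Y) := by
    intro a ha
    have ha' : a.re = q := ha
    have hZ1 : (Z a).re = 1 := by
      rw [hZre, ha', hq]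
      field_simp
      ring
    have hXY : ∫ p : E × E, C₁ * (f p.2 ^ q * g p.1 ^ q) = C₁ * (X * Y) := by
      rw [integral_const_mul, mul_comm X Y, hX, hY, ← integral_prod_mul]
      simp only [Measure.volume_eq_prod, mul_comm]
    rw [← hXY]
    refine norm_integral_le_of_norm_le ?_ (.of_forall fun p => ?_)
    · have := ((hmemLp hg hg0 hg1 hgR q hq0).mul_prod (hmemLp hf hf0 hf1 hfR q hq0)).const_mul C₁
      simpa only [Measure.volume_eq_prod, mul_comm] using this
    · rw [mul_assoc, norm_mul, norm_mul,
        Complex.norm_cpow_eq_rpow_re_of_nonneg (hf0 _) (by rw [ha']; positivity),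
        Complex.norm_cpow_eq_rpow_re_of_nonneg (hg0 _) (by rw [ha']; positivity), ha']
      gcongr
      · exact mul_nonneg (Real.rpow_nonneg (hf0 _) _) (Real.rpow_nonneg (hg0 _) _)
      · exact norm_stripKernel_le hB h0 hb N hZ1 _
  have hone : (1 : ℂ) ∈ Complex.HadamardThreeLines.verticalClosedStrip (q / 2) q := by
    simp only [Complex.HadamardThreeLines.verticalClosedStrip, Set.mem_preimage, Complex.one_re,
      Set.mem_Icc, hq]
    constructor
    · rw [div_div, div_le_one (by positivity)]
      linarith [(Nat.cast_nonneg n : (0 : ℝ) ≤ n)]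
    · rw [one_le_div (by positivity)]
      linarith
  have key := Complex.HadamardThreeLines.norm_le_interp_of_mem_verticalClosedStrip' hqq hone hdc
    hbdd hline0 hline1
  have hexpo : ((1 : ℂ).re - q / 2) / (q - q / 2) = s₀ := by
    rw [Complex.one_re, hq, hs₀]
    field_simp
    ring
  have hs1 : 1 - s₀ = 2 / (n + 2) := by rw [hs₀]; field_simp; ring
  rw [hexpo] at key
  have hΦ1 : Φ 1 = ((∫ p : E × E, shellKernel E η N (p.1 - p.2) * f p.2 * g p.1 : ℝ) : ℂ) := by
    rw [← integral_complex_ofReal]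
    simp only [hΦ, convForm, hZ, sub_self, mul_zero, stripKernel_zero, Complex.cpow_one]
    push_cast
    rfl
  rw [hΦ1, Complex.norm_real] at key
  refine (le_abs_self _).trans (key.trans (le_of_eq ?_))
  have hXY0 : 0 ≤ X * Y := by positivity
  rw [Real.mul_rpow hC₀0 (by positivity), Real.mul_rpow hC₁0 hXY0, ← Real.rpow_mul hXY0,
    mul_mul_mul_comm]
  congr 1
  rw [← Real.rpow_add_of_nonneg hXY0 (by rw [hs1]; positivity) (by positivity)]
  congr 1
  rw [hs1, hs₀]
  field_simp
  ring

end

section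
set_option linter.unusedSectionVars false
open Filter Topology

variable {E : Type*} [NormedAddCommGroup E] [InnerProductSpace ℝ E] [FiniteDimensional ℝ E]
  [MeasurableSpace E] [BorelSpace E]

theorem measurePreserving_sub_fst :
    MeasurePreserving (fun p : E × E => (p.1 - p.2, p.1))
      ((volume : Measure E).prod volume) ((volume : Measure E).prod volume) := by
  have h : MeasurePreserving (fun p : E × E => (p.1, p.1 - p.2))
      ((volume : Measure E).prod volume) ((volume : Measure E).prod volume) :=
    (MeasurePreserving.id volume).skew_product (g := fun x y => x - y) (by fun_prop)
      (.of_forall fun x => (Measure.measurePreserving_sub_left volume x).map_eq)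
  exact Measure.measurePreserving_swap.comp h

theorem integral_sub_mul_mul {K f g : E → ℝ} (hK : Measurable K) (hf : Measurable f)
    (hg : Measurable g) (hK1 : Integrable K) (hg1 : Integrable g) (hf0 : ∀ x, 0 ≤ f x)
    (hf1 : ∀ x, f x ≤ 1) :
    ∫ p : E × E, K (p.1 - p.2) * f p.2 * g p.1 = ∫ z, K z * ∫ x, f (x - z) * g x := by
  have hm : Measurable fun q : E × E => K q.1 * f (q.2 - q.1) * g q.2 := by fun_prop
  have h1 : ∫ p : E × E, K (p.1 - p.2) * f p.2 * g p.1 =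
      ∫ q : E × E, K q.1 * f (q.2 - q.1) * g q.2 := by
    rw [Measure.volume_eq_prod, ← (measurePreserving_sub_fst (E := E)).map_eq,
      integral_map (by fun_prop) hm.aestronglyMeasurable]
    rw [(measurePreserving_sub_fst (E := E)).map_eq]
    simp
  have hi : Integrable (fun q : E × E => K q.1 * f (q.2 - q.1) * g q.2)
      ((volume : Measure E).prod volume) := by
    have h2 : Integrable (fun q : E × E => K q.1 * g q.2)
      ((volume : Measure E).prod volume) := hK1.mul_prod hg1
    have h3 := h2.mul_bdd (c := 1) (g := fun q : E × E => f (q.2 - q.1))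
      (by fun_prop : Measurable _).aestronglyMeasurable
      (.of_forall fun q => by rw [Real.norm_of_nonneg (hf0 _)]; exact hf1 _)
    refine h3.congr (.of_forall fun q => ?_)
    simp only
    ring
  rw [h1, Measure.volume_eq_prod, integral_prod _ hi]
  refine integral_congr_ae (.of_forall fun z => ?_)
  simp only [mul_assoc]
  rw [integral_const_mul]

theorem integral_shellKernel_mul [Nontrivial E] {η : ℝ → ℝ} {B : ℝ} (hη : Measurable η)
    (hB : 0 ≤ B) (h0 : ∀ t, t ∉ Set.Ioc (0 : ℝ) 1 → η t = 0)
    (hb : ∀ t, 0 ≤ t → |η t| ≤ B * t) (N : ℕ) {H : E → ℝ} (hH : Measurable H) {A : ℝ}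
    (hA : ∀ x, |H x| ≤ A) :
    ∫ z, shellKernel E η N z * H z =
      ∫ t, η t * ∫ ω, H ((1 + t / 2 ^ N) • ω) ∂unitSphereMeasure E := by
  have h2 : (0 : ℝ) < 2 ^ N := by positivity
  set φ : ℝ → ℝ := fun r => 2 ^ N * η (2 ^ N * (r - 1)) with hφ
  have hφm : Measurable φ := by fun_prop
  have hφi : Integrable φ :=
    (((integrable_profile hη hB h0 hb).comp_mul_left' h2.ne').comp_sub_right 1).const_mul _
  have key := integral_radial_smul (E := E) φ hφm (F := fun x => (H x : ℂ)) (by fun_prop)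
  have e1 : ∫ z, shellKernel E η N z * H z = ∫ p, φ p.2 * H (p.2 • p.1)
      ∂(unitSphereMeasure E).prod (volume.restrict (Set.Ioi (0 : ℝ))) := by
    have : ∀ a b : ℝ, a • (b : ℂ) = ((a * b : ℝ) : ℂ) := by intro a b; simp
    simp only [this, integral_complex_ofReal] at key
    exact_mod_cast key
  have hi : Integrable (fun p : E × ℝ => φ p.2 * H (p.2 • p.1))
      ((unitSphereMeasure E).prod (volume.restrict (Set.Ioi (0 : ℝ)))) := by
    have h3 : Integrable (fun p : E × ℝ => (1 : ℝ) * φ p.2)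
        ((unitSphereMeasure E).prod (volume.restrict (Set.Ioi (0 : ℝ)))) :=
      (integrable_const (μ := unitSphereMeasure E) (1 : ℝ)).mul_prod hφi.restrict
    simp only [one_mul] at h3
    exact h3.mul_bdd (c := A) (by fun_prop : Measurable _).aestronglyMeasurable
      (.of_forall fun p => hA _)
  rw [e1, integral_prod_symm _ hi]
  simp only [integral_const_mul]
  rw [setIntegral_eq_integral_of_forall_compl_eq_zero]
  · rw [← integral_sub_right_eq_self (fun r => φ r * ∫ ω, H (r • ω) ∂unitSphereMeasure E) (-1)]
    have := Measure.integral_comp_div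
      (fun t => φ (t - -1) * ∫ ω, H ((t - -1) • ω) ∂unitSphereMeasure E) ((2 : ℝ) ^ N)
    rw [abs_of_pos h2, smul_eq_mul] at this
    rw [← mul_right_inj' h2.ne', ← this, ← integral_const_mul]
    refine integral_congr_ae (.of_forall fun t => ?_)
    simp only [hφ]
    rw [show 2 ^ N * (t / 2 ^ N - -1 - 1) = t by field_simp; ring,
      show t / 2 ^ N - -1 = 1 + t / 2 ^ N by ring]
    ring
  · intro r hr
    simp only [Set.mem_Ioi, not_lt] at hr
    simp only [hφ]
    rw [h0, mul_zero, zero_mul]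
    intro h
    nlinarith [h.1]

theorem tendsto_shellKernel_form [Nontrivial E] {η : ℝ → ℝ} {B : ℝ} (hη : Measurable η)
    (hB : 0 ≤ B) (h0 : ∀ t, t ∉ Set.Ioc (0 : ℝ) 1 → η t = 0)
    (hb : ∀ t, 0 ≤ t → |η t| ≤ B * t) (h_int : ∫ t, η t = 1) {f g : E → ℝ} (hf : Continuous f)
    (hg : Measurable g) (hg1 : Integrable g) (hf0 : ∀ x, 0 ≤ f x) (hf1 : ∀ x, f x ≤ 1) :
    Tendsto (fun N => ∫ p : E × E, shellKernel E η N (p.1 - p.2) * f p.2 * g p.1) atTop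
      (𝓝 (∫ ω, (∫ x, f (x - ω) * g x) ∂unitSphereMeasure E)) := by
  set H : E → ℝ := fun z => ∫ x, f (x - z) * g x with hH
  set A : ℝ := ∫ x, |g x| with hA
  have hfn : ∀ x, ‖f x‖ ≤ 1 := fun x => by rw [Real.norm_of_nonneg (hf0 _)]; exact hf1 _
  have hbd : ∀ z x, ‖f (x - z) * g x‖ ≤ |g x| := fun z x => by
    rw [norm_mul]
    exact mul_le_of_le_one_left (abs_nonneg _) (hfn _)
  have hHA : ∀ z, |H z| ≤ A := fun z =>
    norm_integral_le_of_norm_le hg1.norm (.of_forall (hbd z))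
  have hHc : Continuous H := by
    refine continuous_of_dominated (bound := fun x => |g x|) (fun z => ?_)
      (fun z => .of_forall (hbd z)) hg1.norm (.of_forall fun x => by fun_prop)
    exact (by fun_prop : Measurable _).aestronglyMeasurable
  set h : ℝ → ℝ := fun r => ∫ ω, H (r • ω) ∂unitSphereMeasure E with hh
  have hhc : Continuous h := by
    refine continuous_of_dominated (bound := fun x => A) (fun z => ?_)
      (fun z => .of_forall fun ω => hHA _) (integrable_const _) (.of_forall fun x => by fun_prop)
    exact (by fun_prop : Measurable _).aestronglyMeasurable
  have hhA : ∀ r, ‖h r‖ ≤ A * (unitSphereMeasure E).real Set.univ := fun r =>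
    norm_integral_le_of_norm_le_const (.of_forall fun ω => hHA _)
  have e : ∀ N, ∫ p : E × E, shellKernel E η N (p.1 - p.2) * f p.2 * g p.1 =
      ∫ t, η t * h (1 + t / 2 ^ N) := fun N => by
    rw [integral_sub_mul_mul (measurable_shellKernel hη N) hf.measurable hg
      (integrable_shellKernel hη hB h0 hb N) hg1 hf0 hf1]
    exact integral_shellKernel_mul hη hB h0 hb N hHc.measurable hHA
  simp only [e]
  have hlim : ∫ ω, (∫ x, f (x - ω) * g x) ∂unitSphereMeasure E = ∫ t, η t * h 1 := by
    rw [integral_mul_const, h_int, one_mul]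
    simp [hh, hH]
  rw [hlim]
  refine tendsto_integral_of_dominated_convergence
    (bound := fun t => |η t| * (A * (unitSphereMeasure E).real Set.univ)) (fun N => ?_)
    ((integrable_profile hη hB h0 hb).norm.mul_const _) (fun N => .of_forall fun t => ?_)
    (.of_forall fun t => ?_)
  · exact (by fun_prop : Measurable _).aestronglyMeasurable
  · rw [norm_mul]
    exact mul_le_mul_of_nonneg_left (hhA _) (abs_nonneg _)
  · refine Tendsto.const_mul _ ((hhc.tendsto 1).comp ?_)
    have h3 : Tendsto (fun N : ℕ => (2 : ℝ) ^ N) atTop atTop :=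
      tendsto_pow_atTop_atTop_of_one_lt (by norm_num)
    simpa using (h3.const_div_atTop t).const_add 1

theorem exists_sphere_form_le_of_continuous {n : ℕ} (hn1 : 1 ≤ n)
    (hn : Module.finrank ℝ E = n + 1) :
    ∃ C : ℝ≥0, ∀ (f g : E → ℝ) (R : ℝ), Continuous f → Measurable g →
      (∀ x, 0 ≤ f x) → (∀ x, 0 ≤ g x) → (∀ x, f x ≤ 1) → (∀ x, g x ≤ 1) →
      (∀ x, x ∉ Metric.closedBall 0 R → f x = 0) → (∀ x, x ∉ Metric.closedBall 0 R → g x = 0) →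
      ∫⁻ ω, (∫⁻ x, ENNReal.ofReal (f (x - ω)) * ENNReal.ofReal (g x)) ∂unitSphereMeasure E ≤
        C * ((∫⁻ x, ENNReal.ofReal (f x) ^ ((n + 2 : ℝ) / (n + 1))) *
          ∫⁻ x, ENNReal.ofReal (g x) ^ ((n + 2 : ℝ) / (n + 1))) ^ ((n + 1 : ℝ) / (n + 2)) := by
  have : Nontrivial E := Module.nontrivial_of_finrank_pos (R := ℝ) (by omega)
  obtain ⟨η, B, hη, hB, h0, hb, h_int, hM⟩ := exists_moment_profile (n + 1)
  obtain ⟨C, hC0, hC⟩ := exists_shellKernel_form_le_of_le_one hn1 hn hη hB h0 hb h_int hM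
  refine ⟨C.toNNReal, fun f g R hf hg hf0 hg0 hf1 hg1 hfR hgR => ?_⟩
  have h_int' : ∀ u : E → ℝ, Measurable u → (∀ x, 0 ≤ u x) → (∀ x, u x ≤ 1) →
      (∀ x, x ∉ Metric.closedBall 0 R → u x = 0) → Integrable u := by
    intro u hu h0 h1 hR
    rw [← integrableOn_iff_integrable_of_support_subset (s := Metric.closedBall 0 R)]
    · exact Measure.integrableOn_of_bounded (M := 1) measure_closedBall_lt_top.ne
        hu.aestronglyMeasurable (.of_forall fun x => by
          rw [Real.norm_of_nonneg (h0 _)]; exact h1 x)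
    · intro x hx
      by_contra h
      exact hx (hR x h)
  have hgi := h_int' g hg hg0 hg1 hgR
  have key := le_of_tendsto' (tendsto_shellKernel_form (E := E) hη hB h0 hb h_int hf hg hgi hf0 hf1)
    (fun N => hC N f g R hf.measurable hg hf0 hg0 hf1 hg1 hfR hgR)
  set q : ℝ := (n + 2 : ℝ) / (n + 1) with hq
  have hq0 : 0 < q := by positivity
  have hpow : ∀ u : E → ℝ, Measurable u → (∀ x, 0 ≤ u x) → (∀ x, u x ≤ 1) →
      (∀ x, x ∉ Metric.closedBall 0 R → u x = 0) →
      ENNReal.ofReal (∫ x, u x ^ q) = ∫⁻ x, ENNReal.ofReal (u x) ^ q := by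
    intro u hu h0 h1 hR
    rw [ofReal_integral_eq_lintegral_ofReal]
    · refine lintegral_congr fun x => ?_
      rw [ENNReal.ofReal_rpow_of_nonneg (h0 x) hq0.le]
    · refine h_int' _ (by fun_prop) (fun x => Real.rpow_nonneg (h0 x) _)
        (fun x => Real.rpow_le_one (h0 x) (h1 x) hq0.le) fun x hx => ?_
      rw [hR x hx, Real.zero_rpow hq0.ne']
    · exact .of_forall fun x => Real.rpow_nonneg (h0 x) _
  rw [← hpow f hf.measurable hf0 hf1 hfR, ← hpow g hg hg0 hg1 hgR]
  have hX0 : 0 ≤ ∫ x, f x ^ q := integral_nonneg fun x => Real.rpow_nonneg (hf0 x) _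
  have hY0 : 0 ≤ ∫ x, g x ^ q := integral_nonneg fun x => Real.rpow_nonneg (hg0 x) _
  rw [← ENNReal.ofReal_mul hX0, ENNReal.ofReal_rpow_of_nonneg (by positivity) (by positivity)]
  change _ ≤ ENNReal.ofReal C * _
  rw [← ENNReal.ofReal_mul hC0]
  refine le_trans (le_of_eq ?_) (ENNReal.ofReal_le_ofReal key)
  have hfi : ∀ ω, Integrable fun x => f (x - ω) * g x := fun ω =>
    hgi.bdd_mul (c := 1) (by fun_prop : Measurable _).aestronglyMeasurable
      (.of_forall fun x => by rw [Real.norm_of_nonneg (hf0 _)]; exact hf1 _)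
  have hnn : ∀ ω, 0 ≤ ∫ x, f (x - ω) * g x := fun ω =>
    integral_nonneg fun x => mul_nonneg (hf0 _) (hg0 _)
  rw [ofReal_integral_eq_lintegral_ofReal _ (.of_forall hnn)]
  · refine lintegral_congr fun ω => ?_
    rw [ofReal_integral_eq_lintegral_ofReal (hfi ω)
      (.of_forall fun x => mul_nonneg (hf0 _) (hg0 _))]
    refine lintegral_congr fun x => ?_
    rw [ENNReal.ofReal_mul (hf0 _)]
  · refine (integrable_const (∫ x, g x)).mono' ?_ (.of_forall fun ω => ?_)
    · have : StronglyMeasurable fun p : E × E => f (p.2 - p.1) * g p.2 :=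
        (by fun_prop : Measurable _).stronglyMeasurable
      exact this.integral_prod_right.aestronglyMeasurable
    · rw [Real.norm_of_nonneg (hnn ω)]
      exact integral_mono (hfi ω) hgi fun x => mul_le_of_le_one_left (hg0 x) (hf1 _)

end

section
set_option linter.unusedSectionVars false
open Filter Topology

variable {E : Type*} [NormedAddCommGroup E] [InnerProductSpace ℝ E] [FiniteDimensional ℝ E]
  [MeasurableSpace E] [BorelSpace E]

/-- The average `x ↦ ∫ f (x - ω) dμ(ω)` of a nonnegative function. -/
def measureAvg (μ : Measure E) (f : E → ℝ≥0∞) (x : E) : ℝ≥0∞ := ∫⁻ ω, f (x - ω) ∂μ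

theorem measurable_measureAvg {μ : Measure E} [SFinite μ] {f : E → ℝ≥0∞} (hf : Measurable f) :
    Measurable (measureAvg μ f) :=
  Measurable.lintegral_prod_right' (ν := μ) (f := fun p : E × E => f (p.1 - p.2)) (by fun_prop)

theorem lintegral_measureAvg_mul {μ : Measure E} [SFinite μ] {f g : E → ℝ≥0∞}
    (hf : Measurable f) (hg : Measurable g) :
    ∫⁻ x, measureAvg μ f x * g x = ∫⁻ ω, (∫⁻ x, f (x - ω) * g x) ∂μ := by
  rw [lintegral_lintegral_swap (by fun_prop)]
  refine lintegral_congr fun x => ?_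
  rw [lintegral_mul_const _ (by fun_prop)]
  rfl

theorem ae_ae_sub {μ : Measure E} [SFinite μ] {p : E → Prop} (hp : ∀ᵐ y, p y) :
    ∀ᵐ x, ∀ᵐ ω ∂μ, p (x - ω) := by
  obtain ⟨T, hTs, hTm, hT0⟩ := exists_measurable_superset_of_null (ae_iff.1 hp)
  have h1 : ∀ᵐ ω ∂μ, ∀ᵐ x : E, x - ω ∉ T := .of_forall fun ω =>
    (measurePreserving_sub_right volume ω).quasiMeasurePreserving.ae
      (p := fun y => y ∉ T) (measure_eq_zero_iff_ae_notMem.1 hT0)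
  have hTm' : MeasurableSet {p : E × E | p.2 - p.1 ∉ T} :=
    (show Measurable fun p : E × E => p.2 - p.1 by fun_prop) hTm.compl
  rw [Measure.ae_ae_comm hTm'] at h1
  filter_upwards [h1] with x hx
  filter_upwards [hx] with ω hω
  by_contra h
  exact hω (hTs h)

theorem measureAvg_const_mul {μ : Measure E} {f : E → ℝ≥0∞} (hf : Measurable f) (c : ℝ≥0∞) (x : E) :
    measureAvg μ (fun y => c * f y) x = c * measureAvg μ f x :=
  lintegral_const_mul _ (by fun_prop)

theorem exists_lintegral_measureAvg_pow_le_of_le_one {n : ℕ} (hn1 : 1 ≤ n)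
    (hn : Module.finrank ℝ E = n + 1) :
    ∃ C : ℝ≥0, ∀ (f : E → ℝ) (R : ℝ), Continuous f → (∀ x, 0 ≤ f x) → (∀ x, f x ≤ 1) →
      (∀ x, x ∉ Metric.closedBall 0 R → f x = 0) →
      ∫⁻ x, measureAvg (unitSphereMeasure E) (fun y => ENNReal.ofReal (f y)) x ^ (n + 2) ≤
        C * (∫⁻ x, ENNReal.ofReal (f x) ^ ((n + 2 : ℝ) / (n + 1))) ^ (n + 1) := by
  obtain ⟨C, hC⟩ := exists_sphere_form_le_of_continuous (E := E) hn1 hn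
  refine ⟨C ^ (n + 2), fun f R hf hf0 hf1 hfR => ?_⟩
  set σ := unitSphereMeasure E with hσ
  set u : E → ℝ≥0∞ := measureAvg σ fun y => ENNReal.ofReal (f y) with hu
  have hum : Measurable u := measurable_measureAvg (by fun_prop)
  set m : ℝ := (σ Set.univ).toReal + 1 with hm
  have hm0 : 0 < m := by positivity
  have hum' : ∀ x, u x ≤ ENNReal.ofReal m := by
    intro x
    calc u x ≤ ∫⁻ ω, 1 ∂σ := lintegral_mono fun ω => by
          simpa using hf1 (x - ω)
      _ = σ Set.univ := lintegral_one
      _ = ENNReal.ofReal (σ Set.univ).toReal := (ENNReal.ofReal_toReal (measure_ne_top _ _)).symm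
      _ ≤ ENNReal.ofReal m := ENNReal.ofReal_le_ofReal (by linarith)
  have hu_top : ∀ x, u x ≠ ∞ := fun x => ((hum' x).trans_lt ENNReal.ofReal_lt_top).ne
  have hutm : ∀ x, (u x).toReal ≤ m := fun x => ENNReal.toReal_le_of_le_ofReal hm0.le (hum' x)
  have huR : ∀ x, x ∉ Metric.closedBall 0 (R + 1) → u x = 0 := by
    intro x hx
    refine (lintegral_congr_ae (g := fun _ => 0) ?_).trans lintegral_zero
    filter_upwards [ae_unitSphereMeasure_norm_eq_one (E := E)] with ω hω
    rw [hfR, ENNReal.ofReal_zero]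
    rw [mem_closedBall_zero_iff] at hx ⊢
    intro h
    refine hx ?_
    have := norm_add_le (x - ω) ω
    rw [sub_add_cancel] at this
    linarith
  set c : ℝ := (m ^ (n + 1))⁻¹ with hc
  have hc0 : 0 < c := by positivity
  set g : E → ℝ := fun x => c * (u x).toReal ^ (n + 1) with hg
  have hgm : Measurable g := by fun_prop
  set q : ℝ := (n + 2 : ℝ) / (n + 1) with hq
  have hq0 : 0 < q := by positivity
  have hgu : ∀ x, ENNReal.ofReal (g x) = ENNReal.ofReal c * u x ^ (n + 1) := fun x => by
    rw [hg, ENNReal.ofReal_mul hc0.le, ENNReal.ofReal_pow ENNReal.toReal_nonneg,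
      ENNReal.ofReal_toReal (hu_top x)]
  have key := hC f g (R + 1) hf hgm hf0 (fun x => by positivity) hf1
    (fun x => by
      rw [hg, hc, inv_mul_le_iff₀ (by positivity), mul_one]
      exact pow_le_pow_left₀ ENNReal.toReal_nonneg (hutm x) _)
    (fun x hx => hfR x fun h => hx (Metric.closedBall_subset_closedBall (by linarith) h))
    (fun x hx => by simp [hg, huR x hx])
  rw [← lintegral_measureAvg_mul (f := fun y => ENNReal.ofReal (f y))
    (g := fun y => ENNReal.ofReal (g y)) (by fun_prop) (by fun_prop)] at key
  simp only [hgu] at key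
  set Z : ℝ≥0∞ := ∫⁻ x, u x ^ (n + 2) with hZ
  set X : ℝ≥0∞ := ∫⁻ x, ENNReal.ofReal (f x) ^ q with hX
  have e1 : ∫⁻ x, u x * (ENNReal.ofReal c * u x ^ (n + 1)) = ENNReal.ofReal c * Z := by
    rw [hZ, ← lintegral_const_mul _ (by fun_prop)]
    refine lintegral_congr fun x => ?_
    ring
  have e2 : ∫⁻ x, (ENNReal.ofReal c * u x ^ (n + 1)) ^ q = ENNReal.ofReal c ^ q * Z := by
    rw [hZ, ← lintegral_const_mul _ (by fun_prop)]
    refine lintegral_congr fun x => ?_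
    rw [ENNReal.mul_rpow_of_nonneg _ _ hq0.le, ← ENNReal.rpow_natCast, ← ENNReal.rpow_natCast,
      ← ENNReal.rpow_mul]
    congr 2
    rw [hq]
    push_cast
    field_simp
  set s : ℝ := (n + 1 : ℝ) / (n + 2) with hs
  have hs0 : 0 < s := by positivity
  have hqs : q * s = 1 := by rw [hq, hs]; field_simp
  rw [e1, e2, show X * (ENNReal.ofReal c ^ q * Z) = ENNReal.ofReal c ^ q * (X * Z) by ring,
    ENNReal.mul_rpow_of_nonneg _ _ hs0.le, ← ENNReal.rpow_mul, hqs, ENNReal.rpow_one,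
    mul_left_comm, ENNReal.mul_le_mul_iff_right (by simpa using hc0) ENNReal.ofReal_ne_top] at key
  have hZt : Z ≠ ∞ := by
    have : Z ≤ ∫⁻ _ in Metric.closedBall (0 : E) (R + 1), ENNReal.ofReal m ^ (n + 2) := by
      rw [← lintegral_indicator measurableSet_closedBall]
      refine lintegral_mono fun x => ?_
      by_cases hx : x ∈ Metric.closedBall 0 (R + 1)
      · rw [Set.indicator_of_mem hx]
        exact pow_le_pow_left' (hum' x) _
      · simp [huR x hx]
    refine (this.trans_lt ?_).ne
    rw [setLIntegral_const]
    exact ENNReal.mul_lt_top (by simp) measure_closedBall_lt_top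
  have key2 := ENNReal.rpow_le_rpow key (z := (n + 2 : ℝ)) (by positivity)
  have hsn : s * (n + 2 : ℝ) = n + 1 := by rw [hs]; field_simp
  rw [ENNReal.mul_rpow_of_nonneg _ _ (by positivity), ← ENNReal.rpow_mul, hsn,
    ENNReal.mul_rpow_of_nonneg _ _ (by positivity)] at key2
  have r1 : ∀ y : ℝ≥0∞, y ^ (n + 1 : ℝ) = y ^ (n + 1) := fun y => by
    rw [← ENNReal.rpow_natCast]; push_cast; rfl
  have r2 : ∀ y : ℝ≥0∞, y ^ (n + 2 : ℝ) = y ^ (n + 2) := fun y => by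
    rw [← ENNReal.rpow_natCast]; push_cast; rfl
  rw [r1, r1, r2, r2, pow_succ Z (n + 1), mul_comm (Z ^ (n + 1)), ← mul_assoc] at key2
  rcases eq_or_ne Z 0 with h | h
  · rw [h]; exact bot_le
  · rw [ENNReal.mul_le_mul_iff_left (pow_ne_zero _ h) (ENNReal.pow_ne_top hZt)] at key2
    simpa using key2

theorem exists_lintegral_measureAvg_pow_le_of_continuous {n : ℕ} (hn1 : 1 ≤ n)
    (hn : Module.finrank ℝ E = n + 1) :
    ∃ C : ℝ≥0, ∀ f : E → ℝ, Continuous f → HasCompactSupport f → (∀ x, 0 ≤ f x) →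
      ∫⁻ x, measureAvg (unitSphereMeasure E) (fun y => ENNReal.ofReal (f y)) x ^ (n + 2) ≤
        C * (∫⁻ x, ENNReal.ofReal (f x) ^ ((n + 2 : ℝ) / (n + 1))) ^ (n + 1) := by
  obtain ⟨C, hC⟩ := exists_lintegral_measureAvg_pow_le_of_le_one (E := E) hn1 hn
  refine ⟨C, fun f hf hfc hf0 => ?_⟩
  obtain ⟨M, hM⟩ := hf.bounded_above_of_compact_support hfc
  obtain ⟨R, hR⟩ := hfc.isBounded.subset_closedBall 0
  set a : ℝ := |M| + 1 with ha
  have ha0 : 0 < a := by positivity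
  have hfa : ∀ x, f x ≤ a := fun x => by
    have := (le_abs_self _).trans ((hM x).trans (le_abs_self M))
    linarith
  have key := hC (fun x => a⁻¹ * f x) R (by fun_prop) (fun x => by have := hf0 x; positivity)
    (fun x => by rw [inv_mul_le_iff₀ ha0, mul_one]; exact hfa x)
    (fun x hx => by
      rw [image_eq_zero_of_notMem_tsupport fun h => hx (hR h), mul_zero])
  set b : ℝ≥0∞ := ENNReal.ofReal a⁻¹ with hb
  have hb0 : b ≠ 0 := by simp [hb, ha0]
  have hbt : b ≠ ∞ := ENNReal.ofReal_ne_top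
  set q : ℝ := (n + 2 : ℝ) / (n + 1) with hq
  have hq0 : 0 < q := by positivity
  have e0 : ∀ x, ENNReal.ofReal (a⁻¹ * f x) = b * ENNReal.ofReal (f x) := fun x =>
    ENNReal.ofReal_mul (by positivity)
  have hA : Measurable (measureAvg (unitSphereMeasure E) fun y => ENNReal.ofReal (f y)) :=
    measurable_measureAvg (by fun_prop)
  simp only [e0, mul_pow, measureAvg_const_mul (f := fun y => ENNReal.ofReal (f y))
    (by fun_prop : Measurable _), ENNReal.mul_rpow_of_nonneg _ _ hq0.le] at key
  rw [lintegral_const_mul _ (by fun_prop), lintegral_const_mul _ (by fun_prop), mul_pow,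
    ← ENNReal.rpow_natCast (b ^ q), ← ENNReal.rpow_mul,
    show q * ((n + 1 : ℕ) : ℝ) = ((n + 2 : ℕ) : ℝ) by rw [hq]; push_cast; field_simp,
    ENNReal.rpow_natCast, mul_left_comm,
    ENNReal.mul_le_mul_iff_right (pow_ne_zero _ hb0) (ENNReal.pow_ne_top hbt)] at key
  exact key

theorem exists_lintegral_measureAvg_pow_le {n : ℕ} (hn1 : 1 ≤ n)
    (hn : Module.finrank ℝ E = n + 1) :
    ∃ C : ℝ≥0, ∀ f : E → ℝ≥0∞, Measurable f →
      ∫⁻ x, measureAvg (unitSphereMeasure E) f x ^ (n + 2) ≤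
        C * (∫⁻ x, f x ^ ((n + 2 : ℝ) / (n + 1))) ^ (n + 1) := by
  obtain ⟨C, hC⟩ := exists_lintegral_measureAvg_pow_le_of_continuous (E := E) hn1 hn
  refine ⟨C + 1, fun f hf => ?_⟩
  set q : ℝ := (n + 2 : ℝ) / (n + 1) with hq
  have hq0 : 0 < q := by positivity
  have hq1 : 1 ≤ q := by rw [hq, le_div_iff₀ (by positivity)]; linarith
  set X : ℝ≥0∞ := ∫⁻ x, f x ^ q with hX
  rcases eq_or_ne X ∞ with hXt | hXt
  · rw [hXt, ENNReal.top_pow (by omega), ENNReal.mul_top (by simp)]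
    exact le_top
  set σ := unitSphereMeasure E
  set P : ℝ≥0∞ := ENNReal.ofReal q with hP
  have hP0 : P ≠ 0 := by simp [hP, hq0]
  have hPt : P ≠ ∞ := ENNReal.ofReal_ne_top
  have hPq : P.toReal = q := ENNReal.toReal_ofReal hq0.le
  have : Fact (1 ≤ P) := ⟨by rw [hP]; exact ENNReal.one_le_ofReal.2 hq1⟩
  have hft : ∀ᵐ x, f x < ∞ := by
    filter_upwards [ae_lt_top (hf.pow_const q) hXt] with x hx
    exact (ENNReal.rpow_lt_top_iff_of_pos hq0).1 hx
  set F : E → ℝ := fun x => (f x).toReal with hF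
  have hFm : Measurable F := by fun_prop
  have heF : ∀ᵐ x, ‖F x‖ₑ = f x := by
    filter_upwards [hft] with x hx
    rw [hF, Real.enorm_eq_ofReal ENNReal.toReal_nonneg, ENNReal.ofReal_toReal hx.ne]
  have hFn : eLpNorm F P volume = X ^ (1 / q) := by
    rw [eLpNorm_eq_lintegral_rpow_enorm_toReal hP0 hPt, hPq, hX]
    congr 1
    refine lintegral_congr_ae ?_
    filter_upwards [heF] with x hx
    rw [hx]
  have hFL : MemLp F P := ⟨hFm.aestronglyMeasurable, by
    rw [hFn]; exact ENNReal.rpow_lt_top_of_nonneg (by positivity) hXt⟩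
  choose φ hφc hφn hφ hφL using fun k : ℕ =>
    hFL.exists_hasCompactSupport_eLpNorm_sub_le hPt (ε := (k + 1 : ℝ≥0∞)⁻¹) (by simp)
  have hδ : Tendsto (fun k : ℕ => (k + 1 : ℝ≥0∞)⁻¹) atTop (𝓝 0) := by
    have := (tendsto_add_atTop_iff_nat 1).2 ENNReal.tendsto_inv_nat_nhds_zero
    simpa using this
  have hL : Tendsto (fun k => eLpNorm (φ k - F) P volume) atTop (𝓝 0) := by
    refine tendsto_of_tendsto_of_tendsto_of_le_of_le tendsto_const_nhds hδ (fun k => bot_le)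
      fun k => ?_
    simp only
    rw [eLpNorm_sub_comm]
    exact hφn k
  obtain ⟨ns, hns, hae⟩ := (tendstoInMeasure_of_tendsto_eLpNorm hP0
    (fun k => (hφ k).aestronglyMeasurable) hFm.aestronglyMeasurable hL).exists_seq_tendsto_ae
  set ψ : ℕ → E → ℝ := fun k x => max (φ (ns k) x) 0 with hψ
  have hψc : ∀ k, Continuous (ψ k) := fun k => (hφ (ns k)).max continuous_const
  have hψs : ∀ k, HasCompactSupport (ψ k) := fun k =>
    (hφc (ns k)).comp_left (g := fun t : ℝ => max t 0) (by simp)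
  have hψ0 : ∀ k x, 0 ≤ ψ k x := fun k x => le_max_right _ _
  have hψX : ∀ k, ∫⁻ x, ENNReal.ofReal (ψ k x) ^ q ≤
      (X ^ (1 / q) + eLpNorm (φ (ns k) - F) P volume) ^ q := by
    intro k
    have h1 : eLpNorm (φ (ns k)) P volume ≤ X ^ (1 / q) + eLpNorm (φ (ns k) - F) P volume := by
      rw [← hFn]
      refine le_trans (le_of_eq ?_) (eLpNorm_add_le hFm.aestronglyMeasurable
        ((hφ (ns k)).aestronglyMeasurable.sub hFm.aestronglyMeasurable) Fact.out)
      rw [add_sub_cancel]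
    refine le_trans ?_ (ENNReal.rpow_le_rpow h1 hq0.le)
    rw [eLpNorm_eq_lintegral_rpow_enorm_toReal hP0 hPt, hPq, ← ENNReal.rpow_mul,
      one_div_mul_cancel hq0.ne', ENNReal.rpow_one]
    refine lintegral_mono fun x => ENNReal.rpow_le_rpow ?_ hq0.le
    rw [← ofReal_norm]
    exact ENNReal.ofReal_le_ofReal (max_le (le_abs_self _) (norm_nonneg _))
  have hψt : ∀ᵐ y, Tendsto (fun k => ENNReal.ofReal (ψ k y)) atTop (𝓝 (f y)) := by
    filter_upwards [hae, hft] with y hy hfy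
    have h1 : Tendsto (fun k => ψ k y) atTop (𝓝 (max (F y) 0)) := hy.max tendsto_const_nhds
    have h2 := ENNReal.tendsto_ofReal h1
    rwa [max_eq_left ENNReal.toReal_nonneg, ENNReal.ofReal_toReal hfy.ne] at h2
  have hshift : ∀ᵐ x, ∀ᵐ ω ∂σ, Tendsto (fun k => ENNReal.ofReal (ψ k (x - ω))) atTop
      (𝓝 (f (x - ω))) :=
    ae_ae_sub hψt
  have hpt : ∀ᵐ x, measureAvg σ f x ^ (n + 2) ≤
      liminf (fun k => measureAvg σ (fun y => ENNReal.ofReal (ψ k y)) x ^ (n + 2)) atTop := by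
    filter_upwards [hshift] with x hx
    have h1 : measureAvg σ f x ≤
        liminf (fun k => measureAvg σ (fun y => ENNReal.ofReal (ψ k y)) x) atTop := by
      refine le_trans (le_of_eq ?_) (lintegral_liminf_le fun k => by fun_prop)
      refine lintegral_congr_ae ?_
      filter_upwards [hx] with ω hω
      exact hω.liminf_eq.symm
    refine (pow_le_pow_left' h1 _).trans (le_of_eq ?_)
    have hmono : Monotone fun y : ℝ≥0∞ => y ^ (n + 2) := fun a b h => pow_le_pow_left' h _
    exact hmono.map_liminf_of_continuousAt _ (ENNReal.continuous_pow _).continuousAt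
  have hlim : Tendsto (fun k => (C : ℝ≥0∞) *
      ((X ^ (1 / q) + eLpNorm (φ (ns k) - F) P volume) ^ q) ^ (n + 1)) atTop
      (𝓝 (C * X ^ (n + 1))) := by
    have h1 : Tendsto (fun k => X ^ (1 / q) + eLpNorm (φ (ns k) - F) P volume) atTop
        (𝓝 (X ^ (1 / q))) := by
      simpa using (hL.comp hns.tendsto_atTop).const_add (X ^ (1 / q))
    have h2 := ((ENNReal.continuous_pow (n + 1)).tendsto _).comp
      ((ENNReal.continuous_rpow_const (y := q)).tendsto _ |>.comp h1)
    rw [← ENNReal.rpow_mul, one_div_mul_cancel hq0.ne', ENNReal.rpow_one] at h2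
    exact ENNReal.Tendsto.const_mul h2 (Or.inr ENNReal.coe_ne_top)
  calc ∫⁻ x, measureAvg σ f x ^ (n + 2)
      ≤ ∫⁻ x, liminf (fun k => measureAvg σ (fun y => ENNReal.ofReal (ψ k y)) x ^ (n + 2)) atTop :=
        lintegral_mono_ae hpt
    _ ≤ liminf (fun k => ∫⁻ x, measureAvg σ (fun y => ENNReal.ofReal (ψ k y)) x ^ (n + 2)) atTop :=
        lintegral_liminf_le fun k => (measurable_measureAvg
          (by have := (hψc k).measurable; fun_prop)).pow_const _
    _ ≤ liminf (fun k => (C : ℝ≥0∞) *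
          ((X ^ (1 / q) + eLpNorm (φ (ns k) - F) P volume) ^ q) ^ (n + 1)) atTop :=
        liminf_le_liminf (.of_forall fun k => (hC (ψ k) (hψc k) (hψs k) (hψ0 k)).trans
          (by gcongr; exact hψX k))
    _ = C * X ^ (n + 1) := hlim.liminf_eq
    _ ≤ _ := by gcongr; simp

end

section
set_option linter.unusedSectionVars false

theorem sphereMeasure_univ_lt_top (d : ℕ) (hd : 1 ≤ d) : sphereMeasure d Set.univ < ∞ := by
  obtain ⟨C, hC, h⟩ := exists_sphereMeasure_le d hd
  exact (h _ MeasurableSet.univ).trans_lt (ENNReal.mul_lt_top hC.lt_top (measure_lt_top _ _))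

theorem exists_lintegral_measureAvg_sphereMeasure_pow_le (d : ℕ) (hd : 2 ≤ d) :
    ∃ C : ℝ≥0, ∀ f : EuclideanSpace ℝ (Fin d) → ℝ≥0∞, Measurable f →
      ∫⁻ x, measureAvg (sphereMeasure d) f x ^ (d + 1) ≤
        C * (∫⁻ x, f x ^ ((d + 1 : ℝ) / d)) ^ d := by
  obtain ⟨n, rfl⟩ := Nat.exists_eq_add_of_le' (show 1 ≤ d by omega)
  obtain ⟨K, hK, hle⟩ := exists_sphereMeasure_le (n + 1) (by omega)
  obtain ⟨C, hC⟩ := exists_lintegral_measureAvg_pow_le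
    (E := EuclideanSpace ℝ (Fin (n + 1))) (n := n) (by omega) (by simp)
  lift K to ℝ≥0 using hK
  refine ⟨K ^ (n + 2) * C, fun f hf => ?_⟩
  have hμ : sphereMeasure (n + 1) ≤
      (K : ℝ≥0∞) • unitSphereMeasure (EuclideanSpace ℝ (Fin (n + 1))) :=
    Measure.le_iff.2 fun s hs => by simpa using hle s hs
  have h1 : ∀ x, measureAvg (sphereMeasure (n + 1)) f x ≤
      K * measureAvg (unitSphereMeasure _) f x := fun x => by
    refine (lintegral_mono' hμ le_rfl).trans (le_of_eq ?_)
    rw [lintegral_smul_measure]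
    rfl
  have h2 := hC f hf
  have hm := measurable_measureAvg (μ := unitSphereMeasure (EuclideanSpace ℝ (Fin (n + 1)))) hf
  calc ∫⁻ x, measureAvg (sphereMeasure (n + 1)) f x ^ (n + 1 + 1)
      ≤ ∫⁻ x, (K : ℝ≥0∞) ^ (n + 2) * measureAvg (unitSphereMeasure _) f x ^ (n + 2) :=
        lintegral_mono fun x => by
          rw [← mul_pow]; exact pow_le_pow_left' (h1 x) _
    _ = (K : ℝ≥0∞) ^ (n + 2) * ∫⁻ x, measureAvg (unitSphereMeasure _) f x ^ (n + 2) :=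
        lintegral_const_mul _ (by fun_prop)
    _ ≤ _ := by
      push_cast
      rw [mul_assoc]
      refine mul_le_mul_right (h2.trans (le_of_eq ?_)) _
      rw [show (n + 1 + 1 : ℝ) = n + 2 by ring]

variable {E : Type*} [NormedAddCommGroup E] [InnerProductSpace ℝ E] [FiniteDimensional ℝ E]
  [MeasurableSpace E] [BorelSpace E]

theorem lintegral_measureAvg {μ : Measure E} [SFinite μ] {f : E → ℝ≥0∞} (hf : Measurable f) :
    ∫⁻ x, measureAvg μ f x = μ Set.univ * ∫⁻ x, f x := by
  have := lintegral_measureAvg_mul (μ := μ) hf (measurable_const (a := (1 : ℝ≥0∞)))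
  simp only [mul_one] at this
  rw [this]
  simp [lintegral_sub_right_eq_self, mul_comm]

theorem eLpNorm_top_measureAvg_le {μ : Measure E} [SFinite μ] (f : E → ℝ≥0∞) :
    eLpNorm (measureAvg μ f) ∞ volume ≤ μ Set.univ * eLpNorm f ∞ volume := by
  rw [eLpNorm_exponent_top, eLpNorm_exponent_top]
  refine eLpNormEssSup_le_of_ae_enorm_bound ?_
  filter_upwards [ae_ae_sub (μ := μ) (ae_le_eLpNormEssSup (f := f) (μ := volume))] with x hx
  rw [enorm_eq_self]
  refine (lintegral_mono_ae hx).trans (le_of_eq ?_)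
  rw [lintegral_const, mul_comm]

theorem measureAvg_le_mul_rpow {μ : Measure E} {f : E → ℝ≥0∞} (hf : Measurable f)
    {w₀ w₁ w₂ a b : ℝ} (hw₀ : 0 ≤ w₀) (hw₁ : 0 ≤ w₁) (hw₂ : 0 ≤ w₂) (ha : 0 ≤ a) (hb : 0 ≤ b)
    (hw : w₀ + w₁ + w₂ = 1) (hab : a * w₁ + b * w₂ = 1) (x : E) :
    measureAvg μ f x ≤ μ Set.univ ^ w₀ * measureAvg μ (fun y => f y ^ a) x ^ w₁ *
      measureAvg μ (fun y => f y ^ b) x ^ w₂ := by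
  have := ENNReal.lintegral_prod_norm_pow_le (μ := μ) (Finset.univ : Finset (Fin 3))
    (f := ![fun _ => 1, fun ω => f (x - ω) ^ a, fun ω => f (x - ω) ^ b])
    (by
      intro i _
      fin_cases i
      · exact aemeasurable_const
      · exact (by fun_prop : Measurable fun ω => f (x - ω) ^ a).aemeasurable
      · exact (by fun_prop : Measurable fun ω => f (x - ω) ^ b).aemeasurable)
    (p := ![w₀, w₁, w₂]) (by simpa [Fin.sum_univ_three] using hw)
    (by intro i _; fin_cases i <;> simpa)
  simp only [Fin.prod_univ_three, Matrix.cons_val_zero, Matrix.cons_val_one, Matrix.cons_val,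
    ENNReal.one_rpow, one_mul, lintegral_one, ← ENNReal.rpow_mul] at this
  refine le_trans (le_of_eq ?_) this
  refine lintegral_congr fun ω => ?_
  rw [← ENNReal.rpow_add_of_nonneg _ _ (by positivity) (by positivity), hab, ENNReal.rpow_one]

theorem exists_lintegral_measureAvg_rpow_le {μ : Measure E} [IsFiniteMeasure μ] {d : ℕ}
    (hd : 1 ≤ d) {C : ℝ≥0}
    (hC : ∀ f : E → ℝ≥0∞, Measurable f →
      ∫⁻ x, measureAvg μ f x ^ (d + 1) ≤ C * (∫⁻ x, f x ^ ((d + 1 : ℝ) / d)) ^ d)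
    {p r w₁ w₂ : ℝ} (hp : 0 < p) (hr : 0 < r) (hw₁ : 0 ≤ w₁) (hw₂ : 0 ≤ w₂) (hw : w₁ + w₂ ≤ 1)
    (hp' : 1 / p = w₁ + w₂ * (d / (d + 1))) (hr' : 1 / r = w₁ + w₂ * (1 / (d + 1))) :
    ∃ K : ℝ≥0, ∀ f : E → ℝ≥0∞, Measurable f →
      ∫⁻ x, measureAvg μ f x ^ r ≤ K * (∫⁻ x, f x ^ p) ^ (r / p) := by
  have hd0 : (0 : ℝ) < d := by exact_mod_cast hd
  have hd1 : (0 : ℝ) < d + 1 := by positivity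
  set b : ℝ := p * (d / (d + 1)) with hb
  have hb0 : 0 ≤ b := by positivity
  have hab : p * w₁ + b * w₂ = 1 := by
    have : p * (1 / p) = 1 := by field_simp
    rw [hp'] at this
    linear_combination this
  set θ₁ : ℝ := w₁ * r with hθ₁
  set θ₂ : ℝ := w₂ * r / (d + 1) with hθ₂
  have hθ : θ₁ + θ₂ = 1 := by
    have : r * (1 / r) = 1 := by field_simp
    rw [hr'] at this
    linear_combination this
  have hθ₁0 : 0 ≤ θ₁ := by positivity
  have hθ₂0 : 0 ≤ θ₂ := by positivity
  have hθp : θ₁ + d * θ₂ = r / p := by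
    rw [hθ₁, hθ₂, div_eq_mul_one_div r p, hp']; ring
  set w₀ : ℝ := 1 - w₁ - w₂ with hw₀
  have hw₀0 : 0 ≤ w₀ := by linarith
  set m : ℝ≥0∞ := μ Set.univ with hm
  set K : ℝ≥0∞ := (m ^ w₀) ^ r * (m ^ θ₁ * (C : ℝ≥0∞) ^ θ₂) with hK
  have hmt : m ≠ ∞ := measure_ne_top _ _
  have hKt : K ≠ ∞ := by
    refine ENNReal.mul_ne_top ?_ (ENNReal.mul_ne_top ?_ ?_)
    · exact ENNReal.rpow_ne_top_of_nonneg hr.le (ENNReal.rpow_ne_top_of_nonneg hw₀0 hmt)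
    · exact ENNReal.rpow_ne_top_of_nonneg hθ₁0 hmt
    · exact ENNReal.rpow_ne_top_of_nonneg hθ₂0 ENNReal.coe_ne_top
  refine ⟨K.toNNReal, fun f hf => ?_⟩
  rw [ENNReal.coe_toNNReal hKt]
  set X : ℝ≥0∞ := ∫⁻ x, f x ^ p with hX
  set u : E → ℝ≥0∞ := measureAvg μ fun y => f y ^ p with hu
  set v : E → ℝ≥0∞ := measureAvg μ fun y => f y ^ b with hv
  have hum : Measurable u := measurable_measureAvg (by fun_prop)
  have hvm : Measurable v := measurable_measureAvg (by fun_prop)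
  have hu1 : ∫⁻ x, u x = m * X := lintegral_measureAvg (by fun_prop)
  have hv1 : ∫⁻ x, v x ^ (d + 1) ≤ C * X ^ d := by
    refine (hC (fun y => f y ^ b) (by fun_prop)).trans (le_of_eq ?_)
    simp only [← ENNReal.rpow_mul]
    rw [show b * ((d + 1 : ℝ) / d) = p by rw [hb]; field_simp]
  have hpt : ∀ x, measureAvg μ f x ^ r ≤ (m ^ w₀) ^ r * (u x ^ θ₁ * (v x ^ (d + 1)) ^ θ₂) := by
    intro x
    refine (ENNReal.rpow_le_rpow (measureAvg_le_mul_rpow hf hw₀0 hw₁ hw₂ hp.le hb0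
      (by rw [hw₀]; ring) hab x) hr.le).trans (le_of_eq ?_)
    rw [ENNReal.mul_rpow_of_nonneg _ _ hr.le, ENNReal.mul_rpow_of_nonneg _ _ hr.le,
      ← ENNReal.rpow_natCast, ← ENNReal.rpow_mul (u x), ← ENNReal.rpow_mul (v x),
      ← ENNReal.rpow_mul (v x), mul_assoc]
    congr 3
    rw [hθ₂]; push_cast; field_simp
  calc ∫⁻ x, measureAvg μ f x ^ r
      ≤ ∫⁻ x, (m ^ w₀) ^ r * (u x ^ θ₁ * (v x ^ (d + 1)) ^ θ₂) := lintegral_mono hpt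
    _ = (m ^ w₀) ^ r * ∫⁻ x, u x ^ θ₁ * (v x ^ (d + 1)) ^ θ₂ :=
        lintegral_const_mul _ (by fun_prop)
    _ ≤ (m ^ w₀) ^ r * ((∫⁻ x, u x) ^ θ₁ * (∫⁻ x, v x ^ (d + 1)) ^ θ₂) := by
        gcongr
        exact ENNReal.lintegral_mul_norm_pow_le (by fun_prop) (by fun_prop) hθ₁0 hθ₂0 hθ
    _ ≤ (m ^ w₀) ^ r * ((m * X) ^ θ₁ * (C * X ^ d) ^ θ₂) := by
        rw [hu1]
        gcongr
    _ = K * X ^ (r / p) := by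
        rw [ENNReal.mul_rpow_of_nonneg _ _ hθ₁0, ENNReal.mul_rpow_of_nonneg _ _ hθ₂0,
          ← hθp, ENNReal.rpow_add_of_nonneg _ _ hθ₁0 (by positivity),
          ENNReal.rpow_mul X (d : ℝ), ENNReal.rpow_natCast, hK]
        ring

theorem exists_weights_of_mem_convexHull_triangle {a b x y : ℝ}
    (h : (x, y) ∈ convexHull ℝ ({(0, 0), (1, 1), (a, b)} : Set (ℝ × ℝ))) :
    ∃ w₁ w₂ : ℝ, 0 ≤ w₁ ∧ 0 ≤ w₂ ∧ w₁ + w₂ ≤ 1 ∧ x = w₁ + w₂ * a ∧ y = w₁ + w₂ * b := by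
  have hsub : ({(0, 0), (1, 1), (a, b)} : Set (ℝ × ℝ)) ⊆ {v | ∃ w₁ w₂ : ℝ, 0 ≤ w₁ ∧ 0 ≤ w₂ ∧
      w₁ + w₂ ≤ 1 ∧ v.1 = w₁ + w₂ * a ∧ v.2 = w₁ + w₂ * b} := by
    rintro v (rfl | rfl | rfl)
    · exact ⟨0, 0, by simp⟩
    · exact ⟨1, 0, by simp⟩
    · exact ⟨0, 1, by simp⟩
  refine convexHull_min hsub ?_ h
  rintro u ⟨u₁, u₂, hu₁, hu₂, hu, hux, huy⟩ v ⟨v₁, v₂, hv₁, hv₂, hv, hvx, hvy⟩ s t hs ht hst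
  refine ⟨s * u₁ + t * v₁, s * u₂ + t * v₂, by positivity, by positivity, ?_, ?_, ?_⟩
  · nlinarith
  · simp only [Prod.fst_add, Prod.smul_fst, smul_eq_mul, hux, hvx]; ring
  · simp only [Prod.snd_add, Prod.smul_snd, smul_eq_mul, huy, hvy]; ring

theorem exists_eLpNorm_measureAvg_le {μ : Measure E} [IsFiniteMeasure μ] {d : ℕ}
    (hd : 1 ≤ d) {C : ℝ≥0}
    (hC : ∀ f : E → ℝ≥0∞, Measurable f →
      ∫⁻ x, measureAvg μ f x ^ (d + 1) ≤ C * (∫⁻ x, f x ^ ((d + 1 : ℝ) / d)) ^ d)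
    {p r : ℝ≥0∞} (hp : 1 ≤ p) (hr : 1 ≤ r)
    (h : ((p⁻¹).toReal, (r⁻¹).toReal) ∈
      convexHull ℝ ({(0, 0), (1, 1), ((d : ℝ)/(d + 1), 1/((d : ℝ) + 1))} : Set (ℝ × ℝ))) :
    ∃ K : ℝ≥0, ∀ f : E → ℝ≥0∞, Measurable f →
      eLpNorm (measureAvg μ f) r volume ≤ K * eLpNorm f p volume := by
  obtain ⟨w₁, w₂, hw₁, hw₂, hw, hx, hy⟩ := exists_weights_of_mem_convexHull_triangle h
  have hd0 : (0 : ℝ) < d := by exact_mod_cast hd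
  have hd1 : (0 : ℝ) < d + 1 := by positivity
  have hp0 : p ≠ 0 := (one_pos.trans_le hp).ne'
  have hr0 : r ≠ 0 := (one_pos.trans_le hr).ne'
  have hpr : p = ∞ ↔ r = ∞ := by
    have e1 : p = ∞ ↔ (p⁻¹).toReal = 0 := by
      simp [ENNReal.toReal_eq_zero_iff, hp0]
    have e2 : r = ∞ ↔ (r⁻¹).toReal = 0 := by
      simp [ENNReal.toReal_eq_zero_iff, hr0]
    have e3 : ∀ c : ℝ, 0 < c → (w₁ + w₂ * c = 0 ↔ w₁ = 0 ∧ w₂ = 0) := fun c hc => by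
      rw [add_eq_zero_iff_of_nonneg hw₁ (by positivity), mul_eq_zero, or_iff_left hc.ne']
    rw [e1, e2, hx, hy, e3 _ (by positivity), e3 _ (by positivity)]
  by_cases hpt : p = ∞
  · obtain rfl := hpr.1 hpt
    subst hpt
    refine ⟨(μ Set.univ).toNNReal, fun f _ => ?_⟩
    rw [ENNReal.coe_toNNReal (measure_ne_top _ _)]
    exact eLpNorm_top_measureAvg_le f
  · have hrt : r ≠ ∞ := fun h => hpt (hpr.2 h)
    have hP : 0 < p.toReal := ENNReal.toReal_pos hp0 hpt
    have hR : 0 < r.toReal := ENNReal.toReal_pos hr0 hrt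
    obtain ⟨K, hK⟩ := exists_lintegral_measureAvg_rpow_le hd hC hP hR hw₁ hw₂ hw
      (by rw [← hx, ENNReal.toReal_inv, one_div]) (by rw [← hy, ENNReal.toReal_inv, one_div])
    refine ⟨K ^ (1 / r.toReal), fun f hf => ?_⟩
    rw [eLpNorm_eq_lintegral_rpow_enorm_toReal hr0 hrt,
      eLpNorm_eq_lintegral_rpow_enorm_toReal hp0 hpt]
    simp only [enorm_eq_self]
    refine (ENNReal.rpow_le_rpow (hK f hf) (by positivity)).trans (le_of_eq ?_)
    rw [ENNReal.mul_rpow_of_nonneg _ _ (by positivity), ← ENNReal.rpow_mul,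
      ENNReal.coe_rpow_of_nonneg _ (by positivity)]
    congr 2
    field_simp

theorem exists_ae_le_mul_rpow {α : Type*} [MeasurableSpace α] {μ : Measure α} {r : ℝ≥0∞}
    (hr : 1 ≤ r) {F : α → ℝ≥0∞} (hF : Measurable F) :
    ∃ (U : α → ℝ≥0∞) (k : ℝ≥0∞), Measurable U ∧ (∀ᵐ x ∂μ, F x ≤ k * U x ^ (r⁻¹).toReal) ∧
      k * (∫⁻ x, U x ∂μ) ^ (r⁻¹).toReal = eLpNorm F r μ := by
  by_cases hrt : r = ∞
  · subst hrt
    refine ⟨fun _ => 0, eLpNorm F ∞ μ, measurable_const, ?_, by simp⟩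
    filter_upwards [ae_le_eLpNormEssSup (f := F) (μ := μ)] with x hx
    simpa [eLpNorm_exponent_top] using hx
  · have hr0 : r ≠ 0 := (one_pos.trans_le hr).ne'
    have hR : 0 < r.toReal := ENNReal.toReal_pos hr0 hrt
    refine ⟨fun x => F x ^ r.toReal, 1, by fun_prop, .of_forall fun x => ?_, ?_⟩
    · rw [← ENNReal.rpow_mul, ENNReal.toReal_inv, mul_inv_cancel₀ hR.ne', ENNReal.rpow_one,
        one_mul]
    · rw [eLpNorm_eq_lintegral_rpow_enorm_toReal hr0 hrt, one_mul, ENNReal.toReal_inv, one_div]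
      simp only [enorm_eq_self]

theorem lintegral_mul_mul_le_eLpNorm {α : Type*} [MeasurableSpace α] {μ : Measure α}
    {r₁ r₂ r₃ : ℝ≥0∞} (h₁ : 1 ≤ r₁) (h₂ : 1 ≤ r₂) (h₃ : 1 ≤ r₃) (hr : r₁⁻¹ + r₂⁻¹ + r₃⁻¹ = 1)
    {F G H : α → ℝ≥0∞} (hF : Measurable F) (hG : Measurable G) (hH : Measurable H) :
    ∫⁻ x, F x * G x * H x ∂μ ≤ eLpNorm F r₁ μ * (eLpNorm G r₂ μ * eLpNorm H r₃ μ) := by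
  obtain ⟨U, a, hU, hFU, ha⟩ := exists_ae_le_mul_rpow (μ := μ) h₁ hF
  obtain ⟨V, b, hV, hGV, hb⟩ := exists_ae_le_mul_rpow (μ := μ) h₂ hG
  obtain ⟨W, c, hW, hHW, hc⟩ := exists_ae_le_mul_rpow (μ := μ) h₃ hH
  have hf : ∀ r : ℝ≥0∞, 1 ≤ r → r⁻¹ ≠ ∞ := fun r h => by
    simpa using (one_pos.trans_le h).ne'
  have hsum : (r₁⁻¹).toReal + (r₂⁻¹).toReal + (r₃⁻¹).toReal = 1 := by
    rw [← ENNReal.toReal_add (hf _ h₁) (hf _ h₂),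
      ← ENNReal.toReal_add (ENNReal.add_ne_top.2 ⟨hf _ h₁, hf _ h₂⟩) (hf _ h₃), hr]
    simp
  have hold := ENNReal.lintegral_prod_norm_pow_le (μ := μ) (Finset.univ : Finset (Fin 3))
    (f := ![U, V, W])
    (by
      intro i _
      fin_cases i
      · exact hU.aemeasurable
      · exact hV.aemeasurable
      · exact hW.aemeasurable)
    (p := ![(r₁⁻¹).toReal, (r₂⁻¹).toReal, (r₃⁻¹).toReal])
    (by simpa [Fin.sum_univ_three] using hsum)
    (by intro i _; fin_cases i <;> exact ENNReal.toReal_nonneg)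
  simp only [Fin.prod_univ_three, Matrix.cons_val_zero, Matrix.cons_val_one, Matrix.cons_val]
    at hold
  calc ∫⁻ x, F x * G x * H x ∂μ
      ≤ ∫⁻ x, (a * b * c) *
          (U x ^ (r₁⁻¹).toReal * V x ^ (r₂⁻¹).toReal * W x ^ (r₃⁻¹).toReal) ∂μ := by
        refine lintegral_mono_ae ?_
        filter_upwards [hFU, hGV, hHW] with x h1 h2 h3
        refine (mul_le_mul' (mul_le_mul' h1 h2) h3).trans (le_of_eq ?_)
        ring
    _ = (a * b * c) *
          ∫⁻ x, U x ^ (r₁⁻¹).toReal * V x ^ (r₂⁻¹).toReal * W x ^ (r₃⁻¹).toReal ∂μ :=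
        lintegral_const_mul _ (by fun_prop)
    _ ≤ _ := mul_le_mul_right hold _
    _ = eLpNorm F r₁ μ * (eLpNorm G r₂ μ * eLpNorm H r₃ μ) := by
        rw [← ha, ← hb, ← hc]; ring

end

/-- **Sufficiency via Hölder and the Strichartz triangle.** Let `𝒯` be the closed
triangle with vertices `(0,0)`, `(1,1)`, `(d/(d+1), 1/(d+1))`.  If
`1/r₁ + 1/r₂ + 1/p₃ = 1`, `(1/p₁, 1/r₁) ∈ 𝒯` and `(1/p₂, 1/r₂) ∈ 𝒯`, then
`∫ Af(x) Ag(x) h(x) dx ≤ C ‖f‖_{p₁} ‖g‖_{p₂} ‖h‖_{p₃}` for all nonnegative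
measurable `f, g, h` on `ℝ^d`. -/
theorem chain_form_sufficient (d : ℕ) (hd : 2 ≤ d)
    (r₁ r₂ p₃ p₁ p₂ : ℝ≥0∞)
    (hr₁ : 1 ≤ r₁) (hr₂ : 1 ≤ r₂) (hp₃ : 1 ≤ p₃) (hp₁ : 1 ≤ p₁) (hp₂ : 1 ≤ p₂)
    (hsum : r₁⁻¹ + r₂⁻¹ + p₃⁻¹ = 1)
    (h₁ : ((p₁⁻¹).toReal, (r₁⁻¹).toReal) ∈
      convexHull ℝ ({(0, 0), (1, 1), ((d : ℝ)/(d + 1), 1/((d : ℝ) + 1))} : Set (ℝ × ℝ)))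
    (h₂ : ((p₂⁻¹).toReal, (r₂⁻¹).toReal) ∈
      convexHull ℝ ({(0, 0), (1, 1), ((d : ℝ)/(d + 1), 1/((d : ℝ) + 1))} : Set (ℝ × ℝ))) :
    ∃ C : ℝ, 0 < C ∧
      ∀ f g h : EuclideanSpace ℝ (Fin d) → ℝ≥0,
        Measurable f → Measurable g → Measurable h →
        (∫⁻ x, sphereAvg d f x * sphereAvg d g x * (h x : ℝ≥0∞)) ≤
          ENNReal.ofReal C * (nnLpNorm' p₁ f * (nnLpNorm' p₂ g * nnLpNorm' p₃ h)) := by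
  obtain ⟨C, hC⟩ := exists_lintegral_measureAvg_sphereMeasure_pow_le d hd
  have : IsFiniteMeasure (sphereMeasure d) := ⟨sphereMeasure_univ_lt_top d (by omega)⟩
  obtain ⟨K₁, hK₁⟩ := exists_eLpNorm_measureAvg_le (by omega) hC hp₁ hr₁ h₁
  obtain ⟨K₂, hK₂⟩ := exists_eLpNorm_measureAvg_le (by omega) hC hp₂ hr₂ h₂
  have hnorm : ∀ (p : ℝ≥0∞) (f : EuclideanSpace ℝ (Fin d) → ℝ≥0),
      eLpNorm (fun x => (f x : ℝ≥0∞)) p volume = nnLpNorm' p f := fun p f =>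
    eLpNorm_congr_enorm_ae (.of_forall fun x => by simp)
  refine ⟨K₁ * K₂ + 1, by positivity, fun f g h hf hg hh => ?_⟩
  have hf' : Measurable fun x => (f x : ℝ≥0∞) := by fun_prop
  have hg' : Measurable fun x => (g x : ℝ≥0∞) := by fun_prop
  have hh' : Measurable fun x => (h x : ℝ≥0∞) := by fun_prop
  calc ∫⁻ x, sphereAvg d f x * sphereAvg d g x * (h x : ℝ≥0∞)
      ≤ eLpNorm (measureAvg (sphereMeasure d) fun x => (f x : ℝ≥0∞)) r₁ volume *
          (eLpNorm (measureAvg (sphereMeasure d) fun x => (g x : ℝ≥0∞)) r₂ volume *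
            eLpNorm (fun x => (h x : ℝ≥0∞)) p₃ volume) :=
        lintegral_mul_mul_le_eLpNorm hr₁ hr₂ hp₃ hsum (measurable_measureAvg hf')
          (measurable_measureAvg hg') hh'
    _ ≤ (K₁ * nnLpNorm' p₁ f) * ((K₂ * nnLpNorm' p₂ g) * nnLpNorm' p₃ h) := by
        rw [hnorm, ← hnorm p₁, ← hnorm p₂]
        gcongr
        · exact hK₁ _ hf'
        · exact hK₂ _ hg'
    _ = (K₁ * K₂ : ℝ≥0) * (nnLpNorm' p₁ f * (nnLpNorm' p₂ g * nnLpNorm' p₃ h)) := by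
        push_cast; ring
    _ ≤ _ := by
        gcongr
        rw [← ENNReal.ofReal_coe_nnreal]
        refine ENNReal.ofReal_le_ofReal ?_
        push_cast
        linarith
end
end

section
/- Let G be a graph on {1,…,n} with edge set E, and define F : (ℝ²)^n → ℝ^{|E|} by F(x₁,…,xₙ) = (|x_i − x_j|)_{{i,j}∈E, i<j}. Write x_i = (x_i¹, x_i²) and define the linear map H : (ℝ²)^n → ℝ³ by H(x₁,…,xₙ) = (x₁¹, x₁², x₂²). Let x ∈ (ℝ²)^n satisfy F(x) = 𝟏 (all edge distances equal 1), x₁ = (0,0) and x₂ = (1,0), and suppose the Fréchet derivative of F at x is surjective onto ℝ^{|E|}. Then the Fréchet derivative at x of the combined map (F,H) : (ℝ²)^n → ℝ^{|E|} × ℝ³ is surjective. -/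
open MeasureTheory ENNReal NNReal

noncomputable section

/-- The distance map `F(x₁,…,xₙ) = (|x_i − x_j|)_{{i,j} ∈ E}` of a graph `G`,
as a map `(ℝ²)ⁿ → ℝ^{|E|}`. -/
def distMap {n : ℕ} (G : SimpleGraph (Fin n)) [Fintype G.edgeSet]
    (x : Fin n → EuclideanSpace ℝ (Fin 2)) : G.edgeSet → ℝ :=
  fun e => Sym2.lift ⟨fun i j => dist (x i) (x j), fun _ _ => dist_comm _ _⟩
    (e : Sym2 (Fin n))

/-- The pinning map `H(x₁,…,xₙ) = (x₁¹, x₁², x₂²)`. -/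
def pinMap {n : ℕ} (hn : 2 ≤ n) (x : Fin n → EuclideanSpace ℝ (Fin 2)) : Fin 3 → ℝ :=
  ![(x ⟨0, by omega⟩) 0, (x ⟨0, by omega⟩) 1, (x ⟨1, by omega⟩) 1]

/-- The pinning map as a continuous linear map. -/
def pinCLM {n : ℕ} (hn : 2 ≤ n) :
    (Fin n → EuclideanSpace ℝ (Fin 2)) →L[ℝ] (Fin 3 → ℝ) :=
  LinearMap.toContinuousLinearMap
    { toFun := pinMap hn
      map_add' := fun x y => by
        ext i
        fin_cases i <;> simp [pinMap]
      map_smul' := fun c x => by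
        ext i
        fin_cases i <;> simp [pinMap] }

@[simp]
lemma pinCLM_apply {n : ℕ} (hn : 2 ≤ n) (x : Fin n → EuclideanSpace ℝ (Fin 2)) :
    pinCLM hn x = pinMap hn x := rfl

/-- The infinitesimal rigid motion of the configuration `x` composed of the translation by
`(a, b)` and the rotation about the origin with angular velocity `c`. -/
def rigidMotion {n : ℕ} (a b c : ℝ) (x : Fin n → EuclideanSpace ℝ (Fin 2)) :
    Fin n → EuclideanSpace ℝ (Fin 2) :=
  fun i => !₂[a - c * x i 1, b + c * x i 0]

lemma distMap_add_smul_rigidMotion {n : ℕ} (G : SimpleGraph (Fin n)) [Fintype G.edgeSet]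
    (a b c t : ℝ) (x : Fin n → EuclideanSpace ℝ (Fin 2)) :
    distMap G (x + t • rigidMotion a b c x) = √(1 + (t * c) ^ 2) • distMap G x := by
  ext ⟨e, he⟩
  induction e with
  | _ i j =>
    simp only [distMap, Sym2.lift_mk, Pi.smul_apply, smul_eq_mul, EuclideanSpace.dist_eq,
      Fin.sum_univ_two, Real.dist_eq, sq_abs]
    rw [← Real.sqrt_mul (by positivity)]
    congr 1
    simp [rigidMotion]
    ring

/-- The derivative of the distance map annihilates infinitesimal rigid motions. -/
lemma fderiv_distMap_rigidMotion {n : ℕ} {G : SimpleGraph (Fin n)} [Fintype G.edgeSet]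
    {x : Fin n → EuclideanSpace ℝ (Fin 2)} (hdiff : DifferentiableAt ℝ (distMap G) x)
    (a b c : ℝ) : fderiv ℝ (distMap G) x (rigidMotion a b c x) = 0 := by
  rw [← hdiff.lineDeriv_eq_fderiv, lineDeriv]
  simp_rw [distMap_add_smul_rigidMotion]
  have hq : HasDerivAt (fun t : ℝ => 1 + (t * c) ^ 2) 0 0 := by
    simpa using (((hasDerivAt_id (0 : ℝ)).mul_const c).pow 2).const_add 1
  have hs : HasDerivAt (fun t : ℝ => √(1 + (t * c) ^ 2)) 0 0 := by
    simpa using hq.sqrt (by simp)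
  simpa using (hs.smul_const (distMap G x)).deriv

/-- **The pinned configuration space has codimension 3.** Let `x` be a unit-distance
realization of `G` with `x₁ = (0,0)` and `x₂ = (1,0)`, at which the distance map `F` is
differentiable with surjective derivative.  Then the derivative of the combined map
`(F, H) : (ℝ²)ⁿ → ℝ^{|E|} × ℝ³`, where `H(x) = (x₁¹, x₁², x₂²)`, is also surjective. -/
theorem combined_map_surjective (n : ℕ) (hn : 2 ≤ n)
    (G : SimpleGraph (Fin n)) [Fintype G.edgeSet]
    (x : Fin n → EuclideanSpace ℝ (Fin 2))
    (hx : distMap G x = fun _ => 1)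
    (hx0 : x ⟨0, by omega⟩ = 0)
    (hx1 : x ⟨1, by omega⟩ = EuclideanSpace.single (0 : Fin 2) (1 : ℝ))
    (hdiff : DifferentiableAt ℝ (distMap G) x)
    (hsurj : Function.Surjective (fderiv ℝ (distMap G) x)) :
    Function.Surjective
      (fderiv ℝ (fun y : Fin n → EuclideanSpace ℝ (Fin 2) => (distMap G y, pinMap hn y)) x) := by
  have hF : HasFDerivAt (fun y => (distMap G y, pinMap hn y))
      ((fderiv ℝ (distMap G) x).prod (pinCLM hn)) x :=
    hdiff.hasFDerivAt.prodMk (pinCLM hn).hasFDerivAt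
  rw [hF.fderiv]
  rintro ⟨v, w⟩
  obtain ⟨u, rfl⟩ := hsurj v
  set d := w - pinMap hn u with hd
  refine ⟨u + rigidMotion (d 0) (d 1) (d 2 - d 1) x, Prod.ext ?_ ?_⟩
  · simp [fderiv_distMap_rigidMotion hdiff]
  · have hpin : pinMap hn (rigidMotion (d 0) (d 1) (d 2 - d 1) x) = d := by
      ext i
      fin_cases i <;> simp [pinMap, rigidMotion, hx0, hx1]
    change pinCLM hn (u + _) = w
    rw [map_add, pinCLM_apply, pinCLM_apply, hpin, hd, add_sub_cancel]
end
end
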